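/- arXiv:2206.10193 — 13 statements merged into one kernel-verified Lean document; each statement's English description precedes it below -/
import Mathlib

section
/- Let G be a finite group and let S ⊆ G be an inverse-closed subset with 1 ∉ S that generates G. Let d_Γ denote the graph distance in the Cayley graph Cay(G,S). Then a subset C ⊆ G satisfies d_Γ(x,y) ≥ 3 for all distinct x,y ∈ C if and only if there exists a subset Y ⊆ G such that, in the complex group algebra ℂ[G], (Σ_{s ∈ S∪{1}} s) · (Σ_{c ∈ C} c) = Σ_{g ∈ G} g − Σ_{y ∈ Y} y. -/
/-- The Cayley graph of a group `G` with connection set `S`: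
vertices are elements of `G`, and `g, h` are adjacent iff `g * h⁻¹ ∈ S`
(when `S` is inverse-closed and does not contain `1`). -/
def cayleyGraph {G : Type*} [Group G] (S : Set G) : SimpleGraph G :=
  SimpleGraph.fromRel (fun g h => g * h⁻¹ ∈ S)

theorem cayleyGraph_adj_iff {G : Type*} [Group G] {S : Set G} (h1 : (1 : G) ∉ S)
    (hinv : ∀ s ∈ S, s⁻¹ ∈ S) {x y : G} : (cayleyGraph S).Adj x y ↔ y * x⁻¹ ∈ S := by
  rw [cayleyGraph, SimpleGraph.fromRel_adj]
  constructor
  · rintro ⟨-, h | h⟩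
    · simpa using hinv _ h
    · exact h
  · refine fun h => ⟨?_, Or.inr h⟩
    rintro rfl
    exact h1 (by simpa using h)

theorem cayleyGraph_connected {G : Type*} [Group G] {S : Set G} (h1 : (1 : G) ∉ S)
    (hinv : ∀ s ∈ S, s⁻¹ ∈ S) (hgen : Subgroup.closure S = ⊤) : (cayleyGraph S).Connected := by
  have key (g : G) : ∀ x, (cayleyGraph S).Reachable x (g * x) := by
    have hg : g ∈ Subgroup.closure S := hgen ▸ Subgroup.mem_top g
    induction hg using Subgroup.closure_induction with
    | mem s hs =>
      exact fun x => ((cayleyGraph_adj_iff h1 hinv).2 (by simpa using hs)).reachable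
    | one => simp
    | mul a b _ _ ha hb =>
      intro x
      rw [mul_assoc]
      exact (hb x).trans (ha (b * x))
    | inv a _ ha =>
      intro x
      simpa using (ha (a⁻¹ * x)).symm
  exact (SimpleGraph.connected_iff _).2 ⟨fun x y => by simpa using key (y * x⁻¹) x, ⟨1⟩⟩

/-- Two distinct vertices have distance at least three if and only if the closed unit balls
around them are disjoint. -/
theorem three_le_dist_cayleyGraph_iff {G : Type*} [Group G] {S : Set G} (h1 : (1 : G) ∉ S)
    (hinv : ∀ s ∈ S, s⁻¹ ∈ S) (hgen : Subgroup.closure S = ⊤) {x y : G} :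
    3 ≤ (cayleyGraph S).dist x y ↔ ∀ s ∈ insert 1 S, ∀ t ∈ insert 1 S, s * x ≠ t * y := by
  have hedist : 3 ≤ (cayleyGraph S).dist x y ↔ 2 < (cayleyGraph S).edist x y := by
    rw [← ((cayleyGraph_connected h1 hinv hgen) x y).coe_dist_eq_edist]
    exact_mod_cast Iff.rfl
  rw [hedist, SimpleGraph.two_lt_edist_iff, cayleyGraph_adj_iff h1 hinv]
  constructor
  · rintro ⟨hne, hadj, hcommon⟩ s (rfl | hs) t (rfl | ht) h
    · exact hne (by simpa using h)
    · refine hadj ?_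
      have : y * x⁻¹ = t⁻¹ := by simp [show x = t * y by simpa using h]
      exact this ▸ hinv t ht
    · refine hadj ?_
      simpa [← show s * x = y by simpa using h] using hs
    · refine Set.eq_empty_iff_forall_notMem.1 hcommon (s * x) ⟨?_, ?_⟩
      · exact (cayleyGraph_adj_iff h1 hinv).2 (by simpa using hs)
      · exact (cayleyGraph_adj_iff h1 hinv).2 (by simpa [h] using ht)
  · intro h
    refine ⟨?_, ?_, Set.eq_empty_iff_forall_notMem.2 ?_⟩
    · rintro rfl
      exact h 1 (Set.mem_insert _ _) 1 (Set.mem_insert _ _) rfl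
    · exact fun hs => h _ (Set.mem_insert_of_mem _ hs) 1 (Set.mem_insert _ _) (by simp)
    · rintro z ⟨hx, hy⟩
      exact h _ (Set.mem_insert_of_mem _ ((cayleyGraph_adj_iff h1 hinv).1 hx))
        _ (Set.mem_insert_of_mem _ ((cayleyGraph_adj_iff h1 hinv).1 hy)) (by simp)

/-- In a group algebra of characteristic zero, a product of sums over finite sets is the
complement of a sum over a finite set if and only if the products are pairwise distinct. -/
theorem exists_sum_of_mul_sum_of_eq_sub_iff_injOn {k G : Type*} [Ring k] [CharZero k] [Group G]
    [Fintype G] [DecidableEq G] (A B : Finset G) :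
    (∃ Y : Finset G,
        (∑ a ∈ A, MonoidAlgebra.of k G a) * (∑ b ∈ B, MonoidAlgebra.of k G b) =
          (∑ g : G, MonoidAlgebra.of k G g) - ∑ y ∈ Y, MonoidAlgebra.of k G y) ↔
      Set.InjOn (fun p : G × G => p.1 * p.2) (A ×ˢ B : Finset (G × G)) := by
  have hprod : (∑ a ∈ A, MonoidAlgebra.of k G a) * (∑ b ∈ B, MonoidAlgebra.of k G b) =
      ∑ p ∈ A ×ˢ B, MonoidAlgebra.of k G (p.1 * p.2) := by
    simp only [Finset.sum_mul_sum, Finset.sum_product, map_mul]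
  have hcompl (Y : Finset G) : (∑ g : G, MonoidAlgebra.of k G g) - ∑ y ∈ Y, MonoidAlgebra.of k G y
      = ∑ y ∈ Yᶜ, MonoidAlgebra.of k G y := by
    rw [sub_eq_iff_eq_add, Finset.sum_compl_add_sum]
  simp only [hprod, hcompl]
  constructor
  · rintro ⟨Y, hY⟩ p hp q hq (hpq : p.1 * p.2 = q.1 * q.2)
    have hcoeff := congrArg (fun f => f.coeff (q.1 * q.2)) hY
    simp only [MonoidAlgebra.coeff_sum, Finsupp.finsetSum_apply, MonoidAlgebra.of_apply,
      MonoidAlgebra.coeff_single, Finsupp.single_apply, Finset.sum_boole] at hcoeff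
    refine Finset.card_le_one.1 (?_ : (Finset.filter (fun r : G × G => r.1 * r.2 = q.1 * q.2)
      (A ×ˢ B)).card ≤ 1) p (Finset.mem_filter.2 ⟨hp, hpq⟩) q (Finset.mem_filter.2 ⟨hq, rfl⟩)
    rw [Nat.cast_injective hcoeff, Finset.filter_eq']
    split_ifs <;> simp
  · intro hinj
    refine ⟨((A ×ˢ B).image fun p => p.1 * p.2)ᶜ, ?_⟩
    rw [compl_compl, Finset.sum_image hinj]

theorem min_distance_three_iff_group_algebra_identity
    {G : Type*} [Group G] [Fintype G] [DecidableEq G]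
    (S : Finset G) (h1 : (1 : G) ∉ S) (hinv : ∀ s ∈ S, s⁻¹ ∈ S)
    (hgen : Subgroup.closure (S : Set G) = ⊤) (C : Finset G) :
    (∀ x ∈ C, ∀ y ∈ C, x ≠ y → 3 ≤ (cayleyGraph (S : Set G)).dist x y) ↔
      ∃ Y : Finset G,
        (∑ s ∈ insert (1 : G) S, MonoidAlgebra.of ℂ G s) *
            (∑ c ∈ C, MonoidAlgebra.of ℂ G c) =
          (∑ g : G, MonoidAlgebra.of ℂ G g) - ∑ y ∈ Y, MonoidAlgebra.of ℂ G y := by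
  have hiff (x y : G) := three_le_dist_cayleyGraph_iff (S := (S : Set G)) (x := x) (y := y)
    (by simpa using h1) (by simpa using hinv) hgen
  rw [exists_sum_of_mul_sum_of_eq_sub_iff_injOn]
  simp only [hiff, ← Finset.coe_insert, Finset.mem_coe]
  constructor
  · rintro h ⟨s, x⟩ hp ⟨t, y⟩ hq (hpq : s * x = t * y)
    simp only [Finset.coe_product, Set.mem_prod, Finset.mem_coe] at hp hq
    obtain rfl : x = y := by
      by_contra hne
      exact h x hp.2 y hq.2 hne s hp.1 t hq.1 hpq
    rw [mul_right_cancel hpq]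
  · intro h x hx y hy hne s hs t ht hst
    exact hne (congrArg Prod.snd (h (Finset.mem_product.2 ⟨hs, hx⟩ : (s, x) ∈ _)
      (Finset.mem_product.2 ⟨ht, hy⟩ : (t, y) ∈ _) hst))
end

section
/- Let G be a finite group and let S ⊆ G be an inverse-closed subset with 1 ∉ S that generates G, and let d_Γ denote the graph distance in the Cayley graph Cay(G,S). Let C ⊆ G satisfy d_Γ(c,c') ≥ 3 for all distinct c,c' ∈ C. Let H be a subgroup of G and let a_1 = 1, a_2, …, a_m ∈ G be such that G is the disjoint union of the right cosets H a_1, …, H a_m. Then for every i ∈ {1, …, m}: Σ_{j=1}^m |(S ∪ {1}) ∩ a_i⁻¹ H a_j| · |C ∩ a_j⁻¹ H| ≤ |H|. -/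
/-- Multiplying on the left by an element of `S ∪ {1}` moves a vertex by at most one step. -/
theorem cayleyGraph_exists_walk_mul_left {G : Type*} [Group G] {S : Set G}
    {t : G} (ht : t = 1 ∨ t ∈ S) (c : G) :
    ∃ w : (cayleyGraph S).Walk c (t * c), w.length ≤ 1 := by
  by_cases h : c = t * c
  · exact ⟨SimpleGraph.Walk.nil.copy rfl h, by simp⟩
  · have htS : t ∈ S := ht.resolve_left fun ht1 => h (by simp [ht1])
    have hadj : (cayleyGraph S).Adj c (t * c) := by
      rw [cayleyGraph, SimpleGraph.fromRel_adj]
      exact ⟨h, Or.inr (by simpa using htS)⟩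
    exact ⟨hadj.toWalk, by simp⟩

/-- Vertices with intersecting closed neighbourhoods are at distance at most two. -/
theorem cayleyGraph_dist_le_two {G : Type*} [Group G] {S : Set G} {t t' c c' : G}
    (ht : t = 1 ∨ t ∈ S) (ht' : t' = 1 ∨ t' ∈ S) (h : t * c = t' * c') :
    (cayleyGraph S).dist c c' ≤ 2 := by
  obtain ⟨w, hw⟩ := cayleyGraph_exists_walk_mul_left ht c
  obtain ⟨w', hw'⟩ := cayleyGraph_exists_walk_mul_left ht' c'
  refine (SimpleGraph.dist_le (w.append (w'.reverse.copy h.symm rfl))).trans ?_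
  simp only [SimpleGraph.Walk.length_append, SimpleGraph.Walk.length_copy,
    SimpleGraph.Walk.length_reverse]
  omega

theorem coset_inequality_of_min_distance_three
    {G : Type*} [Group G] [Fintype G] [DecidableEq G]
    (S : Finset G) (h1 : (1 : G) ∉ S) (hinv : ∀ s ∈ S, s⁻¹ ∈ S)
    (hgen : Subgroup.closure (S : Set G) = ⊤)
    (C : Finset G)
    (hC : ∀ c ∈ C, ∀ c' ∈ C, c ≠ c' → 3 ≤ (cayleyGraph (S : Set G)).dist c c')
    (H : Subgroup G) [DecidablePred (· ∈ H)] (m : ℕ) (hm : 0 < m) (a : Fin m → G)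
    (ha1 : a ⟨0, hm⟩ = 1)
    -- the right cosets `H * a 1, …, H * a m` are pairwise disjoint and cover `G`
    (hcover : ∀ g : G, ∃! i : Fin m, g * (a i)⁻¹ ∈ H) :
    ∀ i : Fin m,
      ∑ j : Fin m,
        ((insert (1 : G) S).filter (fun t => a i * t * (a j)⁻¹ ∈ H)).card *
          (C.filter (fun c => a j * c ∈ H)).card ≤ Nat.card H := by
  intro i
  rw [← Finset.sum_congr rfl fun j _ => Finset.card_product _ _, ← Finset.card_sigma,
    Nat.card_eq_fintype_card, Fintype.card_subtype]
  refine Finset.card_le_card_of_injOn (fun x => a i * (x.2.1 * x.2.2)) ?_ ?_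
  · rintro ⟨j, t, c⟩ hx
    simp only [Finset.coe_sigma, Set.mem_sigma_iff, Finset.mem_coe, Finset.mem_product,
      Finset.mem_filter] at hx
    simpa [mul_assoc] using H.mul_mem hx.2.1.2 hx.2.2.2
  · rintro ⟨j, t, c⟩ hx ⟨j', t', c'⟩ hx' h
    simp only [Finset.coe_sigma, Set.mem_sigma_iff, Finset.mem_coe, Finset.mem_product,
      Finset.mem_filter, Finset.mem_insert] at hx hx'
    obtain ⟨-, ⟨ht, -⟩, hc, hjc⟩ := hx
    obtain ⟨-, ⟨ht', -⟩, hc', hjc'⟩ := hx'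
    have htc : t * c = t' * c' := mul_left_cancel h
    obtain rfl : c = c' := by
      by_contra hne
      have := hC c hc c' hc' hne
      have := cayleyGraph_dist_le_two (S := (S : Set G)) ht ht' htc
      omega
    obtain rfl := mul_right_cancel htc
    obtain rfl : j = j' := (hcover c⁻¹).unique
      (by simpa using H.inv_mem hjc) (by simpa using H.inv_mem hjc')
    rfl
end

section
/- Let n ≥ 3, let S_n be the symmetric group on {1, …, n}, let S = {(i,i+1) : 1 ≤ i ≤ n−1} be the set of adjacent transpositions and T = S ∪ {id}. Let H = Stab_{S_n}(1) be the stabilizer of the point 1, and for i ∈ {1, …, n} let a_i = (1,i) (with a_1 = id). Then the cosets H a_1, …, H a_n are pairwise disjoint and cover S_n, and for all i, j ∈ {1, …, n}: |T ∩ a_i⁻¹ H a_j| equals n−1 if i = j ∈ {1, n}; equals n−2 if i = j and 2 ≤ i ≤ n−1; equals 1 if |i − j| = 1; and equals 0 otherwise. -/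
/-- The adjacent transposition exchanging `k` and `k + 1`, or the identity if `k + 1` is out of
range. -/
def adjSwap (n k : ℕ) : Equiv.Perm (Fin n) :=
  if h : k + 1 < n then Equiv.swap ⟨k, k.lt_succ_self.trans h⟩ ⟨k + 1, h⟩ else 1

theorem adjSwap_apply_val {n : ℕ} (k : ℕ) (j : Fin n) :
    (adjSwap n k j).val =
      if k + 1 < n then (if j.val = k then k + 1 else if j.val = k + 1 then k else j.val)
      else j.val := by
  unfold adjSwap
  split_ifs <;> simp_all [Equiv.swap_apply_def, Fin.ext_iff]

theorem adjSwap_injOn (n : ℕ) : Set.InjOn (adjSwap n) (Set.Iio n) := by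
  intro k hk l hl h
  simp only [Set.mem_Iio] at hk hl
  have h₁ := congrArg Fin.val (DFunLike.congr_fun h ⟨k, hk⟩)
  have h₂ := congrArg Fin.val (DFunLike.congr_fun h ⟨l, hl⟩)
  simp only [adjSwap_apply_val] at h₁ h₂
  grind

theorem insert_one_adjacent_swaps_eq_image {n : ℕ} (hn : 0 < n) :
    insert 1 {σ : Equiv.Perm (Fin n) |
      ∃ (i : Fin n) (h : i.val + 1 < n), σ = Equiv.swap i ⟨i.val + 1, h⟩} =
      adjSwap n '' Set.Iio n := by
  ext σ
  constructor
  · rintro (rfl | ⟨i, h, rfl⟩)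
    · exact ⟨n - 1, Nat.sub_lt hn one_pos, dif_neg (by omega)⟩
    · exact ⟨i, i.isLt, dif_pos h⟩
  · rintro ⟨k, hk, rfl⟩
    by_cases h : k + 1 < n
    · exact Or.inr ⟨⟨k, hk⟩, h, dif_pos h⟩
    · exact Or.inl (dif_neg h)

theorem ncard_adjSwap_apply_eq {n : ℕ} (i j : Fin n) :
    Set.ncard {t ∈ adjSwap n '' Set.Iio n | t j = i} =
      ((Finset.range n).filter fun k => adjSwap n k j = i).card := by
  rw [← Set.ncard_coe_finset, ← Set.InjOn.ncard_image (f := adjSwap n)]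
  · congr 1
    ext σ
    simp only [Set.mem_ofPred_eq, Set.mem_image, Set.mem_Iio, Finset.coe_filter, Finset.mem_range]
    grind
  · exact (adjSwap_injOn n).mono fun k hk => by simp_all

theorem card_filter_adjSwap_apply_eq {n : ℕ} (hn : 3 ≤ n) (i j : Fin n) :
    ((Finset.range n).filter fun k => adjSwap n k j = i).card =
      if i = j then
        (if i.val = 0 ∨ i.val = n - 1 then n - 1 else n - 2)
      else if i.val + 1 = j.val ∨ j.val + 1 = i.val then 1
      else 0 := by
  have hi := i.isLt
  have hj := j.isLt
  simp only [Fin.ext_iff, adjSwap_apply_val]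
  split_ifs with hij hend hadj
  · rcases hend with h | h
    · trans ((Finset.range n).erase 0).card
      · congr 1; ext k; simp only [Finset.mem_filter, Finset.mem_erase, Finset.mem_range]; grind
      · rw [Finset.card_erase_of_mem (by simp only [Finset.mem_range]; omega), Finset.card_range]
    · trans ((Finset.range n).erase (n - 2)).card
      · congr 1; ext k; simp only [Finset.mem_filter, Finset.mem_erase, Finset.mem_range]; grind
      · rw [Finset.card_erase_of_mem (by simp; omega), Finset.card_range]
  · trans (((Finset.range n).erase i.val).erase (i.val - 1)).card
    · congr 1; ext k; simp only [Finset.mem_filter, Finset.mem_erase, Finset.mem_range]; grind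
    · rw [Finset.card_erase_of_mem (by simp only [Finset.mem_erase, Finset.mem_range]; omega),
        Finset.card_erase_of_mem (by simp only [Finset.mem_range]; omega),
        Finset.card_range]
      omega
  · rw [Finset.card_eq_one]
    refine ⟨min i.val j.val, ?_⟩
    ext k; simp only [Finset.mem_filter, Finset.mem_singleton, Finset.mem_range]; grind
  · rw [Finset.card_eq_zero]
    ext k; simp only [Finset.mem_filter, Finset.notMem_empty, Finset.mem_range]; grind


theorem stabilizer_cosets_and_intersection_counts
    {n : ℕ} [NeZero n] (hn : 3 ≤ n)
    -- `S` is the set of adjacent transpositions of `{1, …, n}` (modeled on `Fin n`)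
    (S : Set (Equiv.Perm (Fin n)))
    (hS : S = {σ | ∃ (i : Fin n) (h : i.val + 1 < n), σ = Equiv.swap i ⟨i.val + 1, h⟩})
    -- `T = S ∪ {id}`
    (T : Set (Equiv.Perm (Fin n))) (hT : T = insert 1 S)
    -- `H` is the stabilizer of the first point
    (H : Subgroup (Equiv.Perm (Fin n)))
    (hH : H = MulAction.stabilizer (Equiv.Perm (Fin n)) (0 : Fin n))
    -- `a i = (1, i)`, the transposition of the first point and `i` (with `a 1 = id`)
    (a : Fin n → Equiv.Perm (Fin n)) (ha : ∀ i, a i = Equiv.swap 0 i) :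
    -- the cosets `H * (a 1), …, H * (a n)` are pairwise disjoint and cover `Sₙ`
    (∀ g : Equiv.Perm (Fin n), ∃! i : Fin n, g * (a i)⁻¹ ∈ H) ∧
    -- the values of `|T ∩ (a i)⁻¹ * H * (a j)|`
    (∀ i j : Fin n,
      Set.ncard {t ∈ T | a i * t * (a j)⁻¹ ∈ H} =
        if i = j then
          (if i.val = 0 ∨ i.val = n - 1 then n - 1 else n - 2)
        else if i.val + 1 = j.val ∨ j.val + 1 = i.val then 1
        else 0) := by
  subst hS hT hH
  obtain rfl : a = fun i => Equiv.swap 0 i := funext ha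
  constructor
  · intro g
    refine ⟨g⁻¹ 0, by simp [MulAction.mem_stabilizer_iff], fun i hi => ?_⟩
    simp only [MulAction.mem_stabilizer_iff, Equiv.swap_inv, Equiv.Perm.smul_def,
      Equiv.Perm.mul_apply, Equiv.swap_apply_left] at hi
    rw [Equiv.Perm.eq_inv_iff_eq, hi]
  · intro i j
    rw [insert_one_adjacent_swaps_eq_image (by omega), ← card_filter_adjSwap_apply_eq hn,
      ← ncard_adjSwap_apply_eq]
    simp only [MulAction.mem_stabilizer_iff, Equiv.swap_inv, Equiv.Perm.smul_def,
      Equiv.Perm.mul_apply, Equiv.swap_apply_left, Equiv.swap_apply_eq_iff]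
end

section
/- Let n ≥ 3 and let i, j ∈ {2, …, n} with i ≠ j. For any h ∈ S_n with h(1) = 1, the permutation (1,i) ∘ h ∘ (1,j) is a transposition if and only if h = (i,j). -/
theorem Equiv.swap_mul_swap_mul_swap_eq_swap {α : Type*} [DecidableEq α] {a b c : α}
    (hb : b ≠ a) (hc : c ≠ a) (hbc : b ≠ c) :
    Equiv.swap a b * Equiv.swap b c * Equiv.swap a c = Equiv.swap b c := by
  ext x
  simp only [Equiv.Perm.mul_apply, Equiv.swap_apply_def]
  grind

theorem Equiv.Perm.IsSwap.eq_swap_of_apply_eq {α : Type*} [DecidableEq α] {g : Equiv.Perm α}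
    (hg : g.IsSwap) {a b : α} (hab : a ≠ b) (h : g b = a) : g = Equiv.swap a b := by
  obtain ⟨x, y, -, rfl⟩ := hg
  ext z
  simp only [Equiv.swap_apply_def] at h ⊢
  grind

theorem swap_mul_stab_mul_swap_isSwap_iff
    {n : ℕ} [NeZero n] (hn : 3 ≤ n) (i j : Fin n)
    (hi : i ≠ 0) (hj : j ≠ 0) (hij : i ≠ j)
    (h : Equiv.Perm (Fin n)) (hh : h 0 = 0) :
    (Equiv.swap 0 i * h * Equiv.swap 0 j).IsSwap ↔ h = Equiv.swap i j := by
  have key := Equiv.swap_mul_swap_mul_swap_eq_swap hi hj hij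
  constructor
  · intro hs
    have e := hs.eq_swap_of_apply_eq hij (by simp [Equiv.Perm.mul_apply, hh])
    rw [← key, ← e]
    simp [mul_assoc]
  · rintro rfl
    exact ⟨i, j, hij, key⟩
end

section
/- Let p ≥ 7 be a prime and let M be the p × p integer matrix with M_{11} = M_{pp} = p−1, M_{ii} = p−2 for 2 ≤ i ≤ p−1, M_{i,i+1} = M_{i+1,i} = 1 for 1 ≤ i ≤ p−1, and all other entries 0. Let x = (x_1, …, x_p) be a vector of nonnegative integers with M x ≤ (p−1)!·𝟏 entrywise. Then |{i ∈ {1,…,p} : x_i ≤ (p−1)!/p}| ≥ ⌈p/3⌉. -/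
theorem row_sum_of_tridiagonal {p : ℕ} (hp2 : 2 ≤ p) (M : Matrix (Fin p) (Fin p) ℕ)
    (hM : ∀ i j : Fin p, M i j =
      if i = j then (if i.val = 0 ∨ i.val = p - 1 then p - 1 else p - 2)
      else if i.val + 1 = j.val ∨ j.val + 1 = i.val then 1 else 0)
    (i : Fin p) : ∑ j : Fin p, M i j = p := by
  have hi := i.isLt
  have hsplit : ∀ j : Fin p, M i j =
      (if i = j then (if i.val = 0 ∨ i.val = p - 1 then p - 1 else p - 2) else 0)
        + (if i.val + 1 = j.val then 1 else 0) + (if j.val + 1 = i.val then 1 else 0) := by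
    intro j
    rw [hM i j]
    simp only [Fin.ext_iff]
    split_ifs <;> omega
  have hsucc : ∑ j : Fin p, (if i.val + 1 = j.val then 1 else 0)
      = if i.val + 1 < p then 1 else 0 := by
    split_ifs with h
    · rw [Finset.sum_eq_single (⟨i.val + 1, h⟩ : Fin p)]
      · simp
      · intro j _ hj
        exact if_neg fun hij => hj (Fin.ext hij.symm)
      · simp
    · exact Finset.sum_eq_zero fun j _ => if_neg (by omega)
  have hpred : ∑ j : Fin p, (if j.val + 1 = i.val then 1 else 0)
      = if 0 < i.val then 1 else 0 := by
    split_ifs with h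
    · rw [Finset.sum_eq_single (⟨i.val - 1, by omega⟩ : Fin p)]
      · exact if_pos (Nat.sub_add_cancel h)
      · intro j _ hj
        refine if_neg fun hij => hj (Fin.ext ?_)
        simp only
        omega
      · simp
    · exact Finset.sum_eq_zero fun j _ => if_neg (by omega)
  simp only [hsplit, Finset.sum_add_distrib, hsucc, hpred, Finset.sum_ite_eq, Finset.mem_univ,
    if_true]
  split_ifs <;> omega

theorem exists_small_entry_of_row_sum_eq {ι : Type*} [Fintype ι] {n B : ℕ} (hn : 0 < n)
    (a x : ι → ℕ) (ha : ∑ j, a j = n) (h : ∑ j, a j * x j ≤ B) :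
    ∃ j, a j ≠ 0 ∧ n * x j ≤ B := by
  by_contra! hlarge
  have hle : ∑ j, a j * (B + 1) ≤ ∑ j, n * (a j * x j) := by
    refine Finset.sum_le_sum fun j _ => ?_
    by_cases hj : a j = 0
    · simp [hj]
    · calc a j * (B + 1) ≤ a j * (n * x j) := Nat.mul_le_mul_left _ (hlarge j hj)
        _ = n * (a j * x j) := by ring
  rw [← Finset.sum_mul, ← Finset.mul_sum, ha] at hle
  have := Nat.le_of_mul_le_mul_left hle hn
  omega

theorem le_three_mul_card_of_dominating_path {n : ℕ} (S : Finset (Fin n))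
    (hS : ∀ i : Fin n, ∃ s ∈ S, i = s ∨ i.val + 1 = s.val ∨ s.val + 1 = i.val) :
    n ≤ S.card * 3 := by
  have hcover : Finset.range n ⊆ S.biUnion fun s => {s.val - 1, s.val, s.val + 1} := by
    intro k hk
    obtain ⟨s, hs, h⟩ := hS ⟨k, Finset.mem_range.mp hk⟩
    simp only [Fin.ext_iff] at h
    simp only [Finset.mem_biUnion, Finset.mem_insert, Finset.mem_singleton]
    exact ⟨s, hs, by omega⟩
  calc n = (Finset.range n).card := (Finset.card_range n).symm
    _ ≤ _ := Finset.card_le_card hcover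
    _ ≤ S.card * 3 := Finset.card_biUnion_le_card_mul _ _ _ fun _ _ => Finset.card_le_three


theorem count_small_entries_of_tridiagonal_system
    {p : ℕ} (hp : p.Prime) (hp7 : 7 ≤ p)
    (M : Matrix (Fin p) (Fin p) ℕ)
    (hM : ∀ i j : Fin p, M i j =
      if i = j then (if i.val = 0 ∨ i.val = p - 1 then p - 1 else p - 2)
      else if i.val + 1 = j.val ∨ j.val + 1 = i.val then 1 else 0)
    (x : Fin p → ℕ)
    (hMx : ∀ i : Fin p, ∑ j : Fin p, M i j * x j ≤ Nat.factorial (p - 1)) :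
    -- `p * x i ≤ (p-1)!` says exactly that `x i ≤ (p-1)!/p`
    ⌈(p : ℚ) / 3⌉₊ ≤
      (Finset.univ.filter (fun i : Fin p => p * x i ≤ Nat.factorial (p - 1))).card := by
  have hcard := le_three_mul_card_of_dominating_path
    (Finset.univ.filter fun i : Fin p => p * x i ≤ Nat.factorial (p - 1)) (by
      intro i
      obtain ⟨j, hj, hsmall⟩ := exists_small_entry_of_row_sum_eq hp.pos (M i) x
        (row_sum_of_tridiagonal hp.two_le M hM i) (hMx i)
      refine ⟨j, by simpa using hsmall, ?_⟩
      by_contra! hfar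
      refine hj ?_
      rw [hM, if_neg hfar.1, if_neg (by omega)])
  rw [Nat.ceil_le, div_le_iff₀ (by norm_num)]
  exact_mod_cast hcard
end

section
/- Let p ≥ 7 be a prime and let M be the p × p integer matrix with M_{11} = M_{pp} = p−1, M_{ii} = p−2 for 2 ≤ i ≤ p−1, M_{i,i+1} = M_{i+1,i} = 1 for 1 ≤ i ≤ p−1, and all other entries 0. Let x = (x_1, …, x_p) be a vector of nonnegative integers with M x ≤ (p−1)!·𝟏 entrywise, let x_max = max{x_i : 1 ≤ i ≤ p}, and suppose Σ_{i=1}^p x_i = (p−1)! − k. Then |{i : x_i = x_max}| ≥ p − k − 2. -/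
/-- The right neighbour of `i` on a path, with the last vertex sent to itself. -/
def Fin.clampedSucc {p : ℕ} (i : Fin p) : Fin p :=
  if h : i.val + 1 < p then ⟨i.val + 1, h⟩ else i

/-- The left neighbour of `i` on a path, with the first vertex sent to itself. -/
def Fin.clampedPred {p : ℕ} (i : Fin p) : Fin p :=
  ⟨i.val - 1, by omega⟩

lemma Fin.clampedSucc_ne_clampedPred {p : ℕ} (hp : 2 ≤ p) (i : Fin p) :
    i.clampedSucc ≠ i.clampedPred := by
  intro h
  have h := congrArg Fin.val h
  unfold Fin.clampedSucc Fin.clampedPred at h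
  split_ifs at h <;> simp at h <;> omega

lemma tridiagonal_entry_eq {p : ℕ} (hp : 3 ≤ p) (i j : Fin p) :
    (if i = j then (if i.val = 0 ∨ i.val = p - 1 then p - 1 else p - 2)
      else if i.val + 1 = j.val ∨ j.val + 1 = i.val then 1 else 0) =
    (if j = i then p - 2 else 0) + (if j = i.clampedSucc then 1 else 0) +
      (if j = i.clampedPred then 1 else 0) := by
  have hs : j = i.clampedSucc ↔ (i.val + 1 = j.val ∨ (i.val = p - 1 ∧ i.val = j.val)) := by
    unfold Fin.clampedSucc
    split_ifs <;> simp only [Fin.ext_iff] <;> omega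
  have hr : j = i.clampedPred ↔ (j.val + 1 = i.val ∨ (i.val = 0 ∧ i.val = j.val)) := by
    simp only [Fin.clampedPred, Fin.ext_iff]
    omega
  simp only [hs, hr, Fin.ext_iff]
  split_ifs <;> omega

lemma sum_sum_clamped_neighbours {p : ℕ} (hp : 3 ≤ p) (f : Fin p → ℤ) :
    ∑ i : Fin p, (f i.clampedSucc + f i.clampedPred) = 2 * ∑ i, f i := by
  set B : Fin p → Fin p → ℤ := fun i j =>
    (if j = i.clampedSucc then 1 else 0) + (if j = i.clampedPred then 1 else 0) with hB
  have hsymm : ∀ i j, B i j = B j i := by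
    intro i j
    have h1 := tridiagonal_entry_eq hp i j
    have h2 := tridiagonal_entry_eq hp j i
    simp only [hB, Fin.ext_iff] at h1 h2 ⊢
    split_ifs at h1 h2 ⊢ <;> omega
  have hrow : ∀ i, f i.clampedSucc + f i.clampedPred = ∑ j, B i j * f j := by
    intro i
    simp [hB, add_mul, Finset.sum_add_distrib]
  have hone : ∀ i, ∑ j, B i j = 2 := by
    intro i
    simp [hB, Finset.sum_add_distrib]
  simp_rw [hrow]
  rw [Finset.sum_comm, Finset.mul_sum]
  refine Finset.sum_congr rfl fun j _ => ?_
  rw [← Finset.sum_mul, ← hone j]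
  simp_rw [hsymm _ j]

/-- An integer vector whose image under the tridiagonal matrix is positive attains its minimum
at many indices, unless its sum is large. -/
lemma card_minimal_entries_ge {p : ℕ} (hp : 6 ≤ p) (y : Fin p → ℤ)
    (hy : ∀ i, 1 ≤ ((p : ℤ) - 2) * y i + y i.clampedSucc + y i.clampedPred) :
    (p : ℤ) - 1 - ∑ i, y i ≤
      ((Finset.univ.filter (fun i => ∀ j, y i ≤ y j)).card : ℤ) := by
  have hp' : (6 : ℤ) ≤ p := by exact_mod_cast hp
  set C := Finset.univ.filter (fun i => ∀ j, y i ≤ y j) with hC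
  set S := Finset.univ.filter (fun i => y i < 0) with hS
  have hCpos : 1 ≤ (C.card : ℤ) := by
    have : Nonempty (Fin p) := ⟨⟨0, by omega⟩⟩
    obtain ⟨i, hi⟩ := Finite.exists_min y
    have : 0 < C.card := Finset.card_pos.mpr ⟨i, by simp [hC, hi]⟩
    exact_mod_cast this
  have hsum : ∑ i, y i = ∑ i, (y i)⁺ - ∑ i ∈ S, -y i := by
    rw [hS, Finset.sum_filter, ← Finset.sum_sub_distrib]
    refine Finset.sum_congr rfl fun i _ => ?_
    split_ifs with h
    · rw [posPart_eq_zero.mpr h.le]; ring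
    · rw [posPart_eq_self.mpr (not_lt.mp h)]; ring
  have hneg : ∀ i, 1 + ((p : ℤ) - 2) * -y i ≤ (y i.clampedSucc)⁺ + (y i.clampedPred)⁺ := by
    intro i
    have := hy i
    have := le_posPart (y i.clampedSucc)
    have := le_posPart (y i.clampedPred)
    linarith
  have hge : ∀ i ∈ S, 1 ≤ -y i := by
    intro i hi
    have : y i < 0 := by simpa [hS] using hi
    omega
  have hcardle : (S.card : ℤ) ≤ ∑ i ∈ S, -y i := by
    simpa using Finset.card_nsmul_le_sum S (fun i => -y i) 1 hge
  have hdouble : (S.card : ℤ) + ((p : ℤ) - 2) * ∑ i ∈ S, -y i ≤ 2 * ∑ i, (y i)⁺ := by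
    rw [← sum_sum_clamped_neighbours (by omega) (fun i => (y i)⁺)]
    calc (S.card : ℤ) + ((p : ℤ) - 2) * ∑ i ∈ S, -y i
        = ∑ i ∈ S, (1 + ((p : ℤ) - 2) * -y i) := by
          rw [Finset.sum_add_distrib, Finset.mul_sum]; simp
      _ ≤ ∑ i ∈ S, ((y i.clampedSucc)⁺ + (y i.clampedPred)⁺) :=
          Finset.sum_le_sum fun i _ => hneg i
      _ ≤ _ := Finset.sum_le_sum_of_subset_of_nonneg (Finset.subset_univ _)
          fun i _ _ => add_nonneg (posPart_nonneg _) (posPart_nonneg _)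
  obtain h0 | h1 | h2 : S.card = 0 ∨ S.card = 1 ∨ 2 ≤ S.card := by omega
  · have hnn : ∀ i, 0 ≤ y i := by
      intro i
      by_contra h
      have hi : i ∈ S := by simpa [hS] using h
      rw [Finset.card_eq_zero.mp h0] at hi
      simp at hi
    have hzero : (Finset.univ.filter fun i => y i = 0) ⊆ C := by
      intro i hi
      simp only [Finset.mem_filter, Finset.mem_univ, true_and, hC] at hi ⊢
      intro j
      rw [hi]
      exact hnn j
    have hcount : ∑ i, (1 - y i) ≤ ∑ i, (if y i = 0 then (1 : ℤ) else 0) := by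
      refine Finset.sum_le_sum fun i _ => ?_
      have := hnn i
      split_ifs <;> omega
    rw [← Finset.sum_filter] at hcount
    have hcard : ((Finset.univ.filter fun i => y i = 0).card : ℤ) ≤ C.card := by
      exact_mod_cast Finset.card_le_card hzero
    simp at hcount
    linarith
  · obtain ⟨i, hi⟩ := Finset.card_eq_one.mp h1
    have hpair : (y i.clampedSucc)⁺ + (y i.clampedPred)⁺ ≤ ∑ j, (y j)⁺ := by
      rw [← Finset.sum_pair (f := fun j => (y j)⁺) (i.clampedSucc_ne_clampedPred (by omega))]
      exact Finset.sum_le_sum_of_subset_of_nonneg (Finset.subset_univ _)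
        fun _ _ _ => posPart_nonneg _
    have hyi : 1 ≤ -y i := hge i (by simp [hi])
    have := hneg i
    rw [hsum, hi, Finset.sum_singleton]
    nlinarith
  · have h2' : (2 : ℤ) ≤ S.card := by exact_mod_cast h2
    rcases lt_or_ge (∑ i ∈ S, -y i) 3 with hlt | hge3
    · have hA : ∑ i ∈ S, -y i = 2 := by omega
      have hS2 : (S.card : ℤ) = 2 := by omega
      have hminus : ∀ i ∈ S, y i = -1 := by
        have heq : ∑ i ∈ S, (1 : ℤ) = ∑ i ∈ S, -y i := by rw [hA]; simpa using hS2
        intro i hi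
        have := (Finset.sum_eq_sum_iff_of_le hge).mp heq i hi
        omega
      have hSC : S ⊆ C := by
        intro i hi
        simp only [hC, Finset.mem_filter, Finset.mem_univ, true_and]
        intro j
        rw [hminus i hi]
        by_cases hj : j ∈ S
        · rw [hminus j hj]
        · have : 0 ≤ y j := by simpa [hS] using hj
          omega
      have : (S.card : ℤ) ≤ C.card := by exact_mod_cast Finset.card_le_card hSC
      rw [hA] at hdouble hsum
      linarith
    · nlinarith

theorem count_maximal_entries_of_tridiagonal_system
    {p : ℕ} (hp : p.Prime) (hp7 : 7 ≤ p)
    (M : Matrix (Fin p) (Fin p) ℕ)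
    (hM : ∀ i j : Fin p, M i j =
      if i = j then (if i.val = 0 ∨ i.val = p - 1 then p - 1 else p - 2)
      else if i.val + 1 = j.val ∨ j.val + 1 = i.val then 1 else 0)
    (x : Fin p → ℕ)
    (hMx : ∀ i : Fin p, ∑ j : Fin p, M i j * x j ≤ Nat.factorial (p - 1))
    (k : ℤ)
    (hk : ∑ i : Fin p, (x i : ℤ) = (Nat.factorial (p - 1) : ℤ) - k) :
    (p : ℤ) - k - 2 ≤
      ((Finset.univ.filter (fun i : Fin p => x i = Finset.univ.sup x)).card : ℤ) := by
  have : Fact p.Prime := ⟨hp⟩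
  obtain ⟨q, hq⟩ : (p : ℤ) ∣ (Nat.factorial (p - 1) : ℤ) + 1 := by
    rw [← ZMod.intCast_zmod_eq_zero_iff_dvd]
    push_cast
    rw [ZMod.wilsons_lemma]
    ring
  have hrow : ∀ i, ((p : ℤ) - 2) * x i + x i.clampedSucc + x i.clampedPred ≤
      (Nat.factorial (p - 1) : ℤ) := by
    intro i
    have h := hMx i
    simp only [hM, tridiagonal_entry_eq (show 3 ≤ p by omega), add_mul, ite_mul, one_mul,
      zero_mul, Finset.sum_add_distrib, Finset.sum_ite_eq',
      Finset.mem_univ, if_true] at h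
    zify [show 2 ≤ p by omega] at h
    exact h
  have hmain := card_minimal_entries_ge (show 6 ≤ p by omega) (fun i => q - (x i : ℤ)) (by
    intro i
    have := hrow i
    linarith)
  have hset : (Finset.univ.filter fun i : Fin p => ∀ j, q - (x i : ℤ) ≤ q - x j) =
      Finset.univ.filter fun i : Fin p => x i = Finset.univ.sup x := by
    refine Finset.filter_congr fun i _ => ⟨fun h => ?_, fun h j => ?_⟩
    · refine le_antisymm (Finset.le_sup (Finset.mem_univ i)) (Finset.sup_le fun j _ => ?_)
      have := h j
      omega
    · have : x j ≤ x i := h ▸ Finset.le_sup (Finset.mem_univ j)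
      omega
  rw [hset, Finset.sum_sub_distrib, hk] at hmain
  simp only [Finset.sum_const, Finset.card_univ, Fintype.card_fin, nsmul_eq_mul] at hmain
  linarith
end

section
/- Let p ≥ 7 be a prime and let M be the p × p integer matrix with M_{11} = M_{pp} = p−1, M_{ii} = p−2 for 2 ≤ i ≤ p−1, M_{i,i+1} = M_{i+1,i} = 1 for 1 ≤ i ≤ p−1, and all other entries 0. Then every vector x = (x_1, …, x_p) of nonnegative integers with M x ≤ (p−1)!·𝟏 entrywise satisfies Σ_{i=1}^p x_i ≤ (p−1)! − ⌈p/3⌉ + 2. -/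
/-- Moving a window over a function that vanishes at both ends
of the range by one does not increase the sum of a nonnegative function. -/
theorem sum_neighbors_le {p : ℕ} (h : ℕ → ℤ) (h0 : h 0 = 0) (hp : h (p + 1) = 0)
    (hnonneg : ∀ n, 0 ≤ h n) :
    ∑ n ∈ Finset.range p, (h n + h (n + 2)) ≤ 2 * ∑ n ∈ Finset.range p, h (n + 1) := by
  have e1 := Finset.sum_range_succ h p
  have e2 := Finset.sum_range_succ' h p
  have e3 := Finset.sum_range_succ (fun n => h (n + 1)) p
  have e4 := Finset.sum_range_succ' (fun n => h (n + 1)) p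
  simp only [zero_add, add_assoc, Nat.reduceAdd] at e3 e4
  rw [Finset.sum_add_distrib]
  linarith [hnonneg p, hnonneg 1]

/-- Integer sequences with `1 ≤ c * y (n + 1) + y n + y (n + 2)` and `c ≥ 5` have a large sum,
because their positive entries dominate the path and outweigh the negative entries. -/
theorem le_three_mul_sum_of_tridiagonal {p : ℕ} (y c : ℕ → ℤ) (h0 : y 0 = 0)
    (hp : y (p + 1) = 0) (hc : ∀ n < p, 5 ≤ c n)
    (h : ∀ n < p, 1 ≤ c n * y (n + 1) + y n + y (n + 2)) :
    (p : ℤ) ≤ 3 * ∑ n ∈ Finset.range p, y (n + 1) := by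
  let z : ℕ → ℤ := fun n => if 1 ≤ y n then 1 else 0
  let f : ℕ → ℤ := fun n => if 1 ≤ y n then y n - 1 else 0
  let a : ℕ → ℤ := fun n => if 1 ≤ y n then 0 else - y n
  have hz := sum_neighbors_le (p := p) z (by simp [z, h0]) (by simp [z, hp])
    (fun n => by dsimp only [z]; split_ifs <;> omega)
  have hf := sum_neighbors_le (p := p) f (by simp [f, h0]) (by simp [f, hp])
    (fun n => by dsimp only [f]; split_ifs <;> omega)
  have hy : ∑ n ∈ Finset.range p, y (n + 1) = ∑ n ∈ Finset.range p, z (n + 1)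
      + ∑ n ∈ Finset.range p, f (n + 1) - ∑ n ∈ Finset.range p, a (n + 1) := by
    rw [← Finset.sum_add_distrib, ← Finset.sum_sub_distrib]
    refine Finset.sum_congr rfl fun n _ => ?_
    dsimp only [z, f, a]
    split_ifs <;> omega
  have key : ∀ n < p, y (n + 1) ≤ 0 → 1 ≤ 5 * y (n + 1) + y n + y (n + 2) := by
    intro n hn hneg
    nlinarith [h n hn, hc n hn]
  have hdom : (p : ℤ) ≤ ∑ n ∈ Finset.range p, (z n + z (n + 2))
      + ∑ n ∈ Finset.range p, z (n + 1) := by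
    rw [← Finset.sum_add_distrib]
    calc (p : ℤ) = ∑ n ∈ Finset.range p, 1 := by simp
      _ ≤ _ := Finset.sum_le_sum fun n hn => by
        have := key n (Finset.mem_range.mp hn)
        dsimp only [z]
        split_ifs <;> omega
  have hneg : 2 * ∑ n ∈ Finset.range p, a (n + 1) ≤ ∑ n ∈ Finset.range p, (f n + f (n + 2)) := by
    rw [Finset.mul_sum]
    refine Finset.sum_le_sum fun n hn => ?_
    have := key n (Finset.mem_range.mp hn)
    dsimp only [a, f]
    split_ifs <;> omega
  linarith

/-- A row of a tridiagonal matrix with unit off-diagonals applied to a vector. -/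
theorem sum_tridiagonal_row {p : ℕ} (d : ℤ) (w : ℕ → ℤ) {i : ℕ} (hi : i < p) :
    ∑ j ∈ Finset.range p, (if i = j then d else if i + 1 = j ∨ j + 1 = i then 1 else 0) * w j =
      d * w i + (if 0 < i then w (i - 1) else 0) + (if i + 1 < p then w (i + 1) else 0) := by
  have hsplit : ∀ j ∈ Finset.range p,
      (if i = j then d else if i + 1 = j ∨ j + 1 = i then 1 else 0) * w j =
        (if i = j then d * w j else 0) + (if i - 1 = j then if 0 < i then w j else 0 else 0)
          + (if i + 1 = j then w j else 0) := by
    intro j _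
    split_ifs <;> omega
  rw [Finset.sum_congr rfl hsplit, Finset.sum_add_distrib, Finset.sum_add_distrib,
    Finset.sum_ite_eq, Finset.sum_ite_eq, Finset.sum_ite_eq]
  have : i - 1 < p := by omega
  simp [hi, this]

theorem sum_bound_of_tridiagonal_system
    {p : ℕ} (hp : p.Prime) (hp7 : 7 ≤ p)
    (M : Matrix (Fin p) (Fin p) ℕ)
    (hM : ∀ i j : Fin p, M i j =
      if i = j then (if i.val = 0 ∨ i.val = p - 1 then p - 1 else p - 2)
      else if i.val + 1 = j.val ∨ j.val + 1 = i.val then 1 else 0)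
    (x : Fin p → ℕ)
    (hMx : ∀ i : Fin p, ∑ j : Fin p, M i j * x j ≤ Nat.factorial (p - 1)) :
    ∑ i : Fin p, (x i : ℤ) ≤
      (Nat.factorial (p - 1) : ℤ) - (⌈(p : ℚ) / 3⌉₊ : ℤ) + 2 := by
  obtain ⟨k, hk⟩ : ∃ k : ℤ, (Nat.factorial (p - 1) : ℤ) + 1 = p * k := by
    have : Fact p.Prime := ⟨hp⟩
    have hw := ZMod.wilsons_lemma p
    refine (ZMod.intCast_zmod_eq_zero_iff_dvd _ p).mp ?_ |>.imp fun _ h => h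
    push_cast
    rw [hw]
    ring
  let X : ℕ → ℤ := fun n => if h : n < p then (x ⟨n, h⟩ : ℤ) else 0
  have hX : ∀ i : Fin p, (x i : ℤ) = X i := fun i => by simp [X]
  let d : ℕ → ℤ := fun i => if i = 0 ∨ i = p - 1 then (p : ℤ) - 1 else p - 2
  have hrow : ∀ i < p, d i * X i + (if 0 < i then X (i - 1) else 0)
      + (if i + 1 < p then X (i + 1) else 0) ≤ Nat.factorial (p - 1) := by
    intro i hi
    rw [← sum_tridiagonal_row (d i) X hi, ← Fin.sum_univ_eq_sum_range
      (fun j => (if i = j then d i else if i + 1 = j ∨ j + 1 = i then 1 else 0) * X j) p]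
    have := hMx ⟨i, hi⟩
    zify at this
    refine le_of_eq_of_le (Finset.sum_congr rfl fun j _ => ?_) this
    rw [hM, hX]
    congr 1
    simp only [Fin.ext_iff, d]
    split_ifs <;> push_cast <;> omega
  let y : ℕ → ℤ := fun n => if 0 < n ∧ n ≤ p then k - X (n - 1) else 0
  have hy := le_three_mul_sum_of_tridiagonal (p := p) y d (by simp [y]) (by simp [y])
    (fun n _ => by dsimp only [d]; split_ifs <;> omega) (by
      intro n hn
      have h := hrow n hn
      have e1 : y (n + 1) = k - X n := by simp [y, Nat.succ_le_of_lt hn]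
      have e0 : y n = if 0 < n then k - X (n - 1) else 0 := by simp [y, hn.le]
      have e2 : y (n + 2) = if n + 1 < p then k - X (n + 1) else 0 := by
        simp [y, Nat.succ_le_iff]
      rw [e1, e0, e2]
      dsimp only [d] at h ⊢
      split_ifs at h ⊢ <;> first | omega | linarith)
  have hsum : ∑ n ∈ Finset.range p, y (n + 1) = p * k - ∑ i : Fin p, (x i : ℤ) := by
    simp only [hX]
    rw [Fin.sum_univ_eq_sum_range X p]
    have : ∀ n ∈ Finset.range p, y (n + 1) = k - X n := fun n hn => by
      simp [y, Nat.succ_le_of_lt (Finset.mem_range.mp hn)]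
    rw [Finset.sum_congr rfl this, Finset.sum_sub_distrib]
    simp
  rw [hsum, ← hk] at hy
  have hceil : (⌈(p : ℚ) / 3⌉₊ : ℤ) ≤
      (Nat.factorial (p - 1) : ℤ) + 1 - ∑ i : Fin p, (x i : ℤ) := by
    rw [Int.natCast_ceil_eq_ceil (by positivity), Int.ceil_le, div_le_iff₀ (by norm_num)]
    rw [mul_comm]
    exact_mod_cast hy
  linarith
end

section
/- For every prime p ≥ 11, every subset C ⊆ S_p such that d_K(σ,π) ≥ 3 for all distinct σ,π ∈ C satisfies |C| ≤ (p−1)! − ⌈p/3⌉ + 2; in particular |C| ≤ (p−1)! − 2. -/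
/-- The set of adjacent transpositions `(i, i+1)` in the symmetric group on `n` points. -/
def adjacentTranspositions (n : ℕ) : Set (Equiv.Perm (Fin n)) :=
  {σ | ∃ (i : Fin n) (h : i.val + 1 < n), σ = Equiv.swap i ⟨i.val + 1, h⟩}

/-- The Cayley graph of `Sₙ` with connection set the adjacent transpositions:
`g` and `h` are adjacent iff `g * h⁻¹` is an adjacent transposition. -/
def kendallGraph (n : ℕ) : SimpleGraph (Equiv.Perm (Fin n)) :=
  SimpleGraph.fromRel (fun g h => g * h⁻¹ ∈ adjacentTranspositions n)

/-- The Kendall τ-distance: the graph distance in the Cayley graph of `Sₙ`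
with connection set the adjacent transpositions, i.e. the minimum number of
adjacent transpositions needed to transform one permutation into the other. -/
noncomputable def kendallDist {n : ℕ} (σ π : Equiv.Perm (Fin n)) : ℕ :=
  (kendallGraph n).dist σ π

/-- The adjacent transposition `(k, k+1)` for `some k`, and the identity for `none`. -/
def unitBallPerm (m : ℕ) : Option (Fin m) → Equiv.Perm (Fin (m + 1))
  | none => 1
  | some k => Equiv.swap k.castSucc k.succ

theorem unitBallPerm_mul_self {m : ℕ} (a : Option (Fin m)) :
    unitBallPerm m a * unitBallPerm m a = 1 := by
  cases a <;> simp [unitBallPerm]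

theorem unitBallPerm_apply_apply {m : ℕ} (a : Option (Fin m)) (i : Fin (m + 1)) :
    unitBallPerm m a (unitBallPerm m a i) = i := by
  rw [← Equiv.Perm.mul_apply, unitBallPerm_mul_self, Equiv.Perm.one_apply]

theorem unitBallPerm_injective (m : ℕ) : Function.Injective (unitBallPerm m) := by
  have ne_one (k : Fin m) : Equiv.swap k.castSucc k.succ ≠ 1 := by
    rw [Ne, Equiv.swap_eq_one_iff]
    exact (Fin.castSucc_lt_succ (i := k)).ne
  rintro (_ | a) (_ | b) h
  · rfl
  · exact absurd h.symm (ne_one b)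
  · exact absurd h (ne_one a)
  · have h1 : Equiv.swap a.castSucc a.succ a.castSucc
        = Equiv.swap b.castSucc b.succ a.castSucc := congrArg (· a.castSucc) h
    rw [Equiv.swap_apply_left, Equiv.swap_apply_def] at h1
    congr 1
    split_ifs at h1 with h2 h3 <;> simp [Fin.ext_iff] at * <;> omega

theorem exists_walk_unitBallPerm_mul {m : ℕ} (a : Option (Fin m))
    (σ : Equiv.Perm (Fin (m + 1))) :
    ∃ w : (kendallGraph (m + 1)).Walk σ (unitBallPerm m a * σ), w.length ≤ 1 := by
  by_cases h : unitBallPerm m a * σ = σ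
  · rw [h]
    exact ⟨.nil, by simp⟩
  · have hadj : (kendallGraph (m + 1)).Adj σ (unitBallPerm m a * σ) := by
      refine (SimpleGraph.fromRel_adj _ _ _).2 ⟨fun e => h e.symm, Or.inr ?_⟩
      rw [mul_inv_cancel_right]
      cases a with
      | none => exact absurd (by simp [unitBallPerm]) h
      | some k => exact ⟨k.castSucc, by simp, rfl⟩
    exact ⟨hadj.toWalk, by simp⟩

theorem kendallDist_le_two {m : ℕ} {a b : Option (Fin m)} {σ π : Equiv.Perm (Fin (m + 1))}
    (h : unitBallPerm m a * σ = unitBallPerm m b * π) : kendallDist σ π ≤ 2 := by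
  have hσ := exists_walk_unitBallPerm_mul a σ
  rw [h] at hσ
  obtain ⟨w, hw⟩ := hσ
  obtain ⟨v, hv⟩ := exists_walk_unitBallPerm_mul b π
  refine (SimpleGraph.dist_le (w.append v.reverse)).trans ?_
  simp only [SimpleGraph.Walk.length_append, SimpleGraph.Walk.length_reverse]
  omega

theorem card_perm_apply_zero_eq {m : ℕ} (i : Fin (m + 1)) :
    (Finset.univ.filter fun τ : Equiv.Perm (Fin (m + 1)) => τ 0 = i).card = m.factorial := by
  have h : (Finset.univ.filter fun τ : Equiv.Perm (Fin (m + 1)) => τ 0 = i)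
      = Finset.univ.image fun e : Equiv.Perm (Fin m) => Equiv.Perm.decomposeFin.symm (i, e) := by
    ext τ
    simp only [Finset.mem_filter, Finset.mem_univ, true_and, Finset.mem_image]
    constructor
    · intro hτ
      obtain ⟨⟨j, e⟩, rfl⟩ := Equiv.Perm.decomposeFin.symm.surjective τ
      rw [Equiv.Perm.decomposeFin_symm_apply_zero] at hτ
      exact ⟨e, by rw [hτ]⟩
    · rintro ⟨e, rfl⟩
      exact Equiv.Perm.decomposeFin_symm_apply_zero _ _
  rw [h, Finset.card_image_of_injective, Finset.card_univ, Fintype.card_perm, Fintype.card_fin]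
  intro e f hef
  simpa using hef

/-- Sphere packing restricted to the permutations taking a given value at `0`. -/
theorem sum_card_filter_unitBallPerm_le {m : ℕ} {C : Finset (Equiv.Perm (Fin (m + 1)))}
    (hC : ∀ σ ∈ C, ∀ π ∈ C, σ ≠ π → 3 ≤ kendallDist σ π) (i : Fin (m + 1)) :
    ∑ a, (C.filter fun σ => σ 0 = unitBallPerm m a i).card ≤ m.factorial := by
  rw [← card_perm_apply_zero_eq i, ← Finset.card_sigma]
  refine Finset.card_le_card_of_injOn (fun x => unitBallPerm m x.1 * x.2) ?_ ?_
  · rintro ⟨a, σ⟩ h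
    simp only [Finset.coe_sigma, Set.mem_sigma_iff, Finset.mem_coe, Finset.mem_filter] at h
    simp [h.2.2, unitBallPerm_apply_apply]
  · rintro ⟨a, σ⟩ hσ ⟨b, π⟩ hπ h
    simp only [Finset.coe_sigma, Set.mem_sigma_iff, Finset.mem_coe, Finset.mem_filter] at hσ hπ h
    obtain rfl : σ = π := by
      by_contra hne
      have h1 := hC σ hσ.2.1 π hπ.2.1 hne
      have h2 := kendallDist_le_two h
      omega
    obtain rfl := unitBallPerm_injective m (mul_right_cancel h)
    rfl

theorem card_moving_unitBallPerm_le {m : ℕ} (i : Fin (m + 1)) :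
    (Finset.univ.filter fun a => unitBallPerm m a i ≠ i).card ≤ 2 := by
  have hsub : (Finset.univ.filter fun a => unitBallPerm m a i ≠ i) ⊆
      ((Finset.univ.filter fun k : Fin m => k.castSucc = i) ∪
        (Finset.univ.filter fun k : Fin m => k.succ = i)).image some := by
    rintro (_ | k) h
    · exact absurd rfl (Finset.mem_filter.1 h).2
    · have := Equiv.swap_apply_ne_self_iff.1 (Finset.mem_filter.1 h).2
      simp only [Finset.mem_image, Finset.mem_union, Finset.mem_filter, Finset.mem_univ, true_and]
      exact ⟨k, by tauto, rfl⟩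
  refine (Finset.card_le_card hsub).trans (Finset.card_image_le.trans
    ((Finset.card_union_le _ _).trans (Nat.add_le_add (b := 1) (d := 1) ?_ ?_)))
  · rw [Finset.card_le_one]
    intro a ha b hb
    simp only [Finset.mem_filter, Finset.mem_univ, true_and] at ha hb
    exact Fin.castSucc_injective _ (ha.trans hb.symm)
  · rw [Finset.card_le_one]
    intro a ha b hb
    simp only [Finset.mem_filter, Finset.mem_univ, true_and] at ha hb
    exact Fin.succ_injective _ (ha.trans hb.symm)

theorem sum_sum_moving_unitBallPerm_le {m : ℕ} {f : Fin (m + 1) → ℤ} (hf : ∀ i, 0 ≤ f i) :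
    ∑ i, ∑ a with unitBallPerm m a i ≠ i, f (unitBallPerm m a i) ≤ 2 * ∑ i, f i := by
  have h1 : ∑ i, ∑ a with unitBallPerm m a i ≠ i, f (unitBallPerm m a i)
      = ∑ i, ∑ a with unitBallPerm m a i ≠ i, f i := by
    simp only [Finset.sum_filter]
    rw [Finset.sum_comm, Finset.sum_comm (γ := Fin (m + 1))]
    refine Finset.sum_congr rfl fun a _ => ?_
    rw [← Equiv.sum_comp (unitBallPerm m a) fun i => if unitBallPerm m a i ≠ i then f i else 0]
    refine Finset.sum_congr rfl fun i _ => ?_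
    rw [unitBallPerm_apply_apply]
    simp only [ne_comm]
  rw [h1, Finset.mul_sum]
  refine Finset.sum_le_sum fun i _ => ?_
  rw [Finset.sum_const, nsmul_eq_mul]
  refine mul_le_mul_of_nonneg_right ?_ (hf i)
  exact_mod_cast card_moving_unitBallPerm_le i

/-- An integer vector all of whose unit-ball sums are positive has a large sum: its positive
entries form a dominating set of the path, and its negative entries are outweighed by the
excess of their neighbours. -/
theorem le_three_mul_sum_of_unitBall_sum_pos {m : ℕ} (hm : 4 ≤ m) {y : Fin (m + 1) → ℤ}
    (hy : ∀ i, 1 ≤ ∑ a, y (unitBallPerm m a i)) : (m : ℤ) + 1 ≤ 3 * ∑ i, y i := by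
  let t : Fin (m + 1) → ℤ := fun i => if 1 ≤ y i then 1 else 0
  have hsplit (i : Fin (m + 1)) : ∃ d : ℤ, 0 ≤ d ∧ d ≤ 2 ∧
      (Finset.univ.filter fun a => unitBallPerm m a i ≠ i).card = d ∧
      1 ≤ ∑ a with unitBallPerm m a i ≠ i, y (unitBallPerm m a i) + (m + 1 - d) * y i := by
    refine ⟨_, by positivity, by exact_mod_cast card_moving_unitBallPerm_le i, rfl, ?_⟩
    have h := hy i
    rw [← Finset.sum_filter_add_sum_filter_not _ (fun a => unitBallPerm m a i ≠ i)] at h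
    have hfix : ∑ a with ¬ unitBallPerm m a i ≠ i, y (unitBallPerm m a i)
        = ∑ a with ¬ unitBallPerm m a i ≠ i, y i :=
      Finset.sum_congr rfl fun a ha => by
        rw [not_not.1 (Finset.mem_filter.1 ha).2]
    have hcard := Finset.card_filter_add_card_filter_not
      (s := (Finset.univ : Finset (Option (Fin m)))) (fun a => unitBallPerm m a i ≠ i)
    rw [Finset.card_univ, Fintype.card_option, Fintype.card_fin] at hcard
    rw [hfix, Finset.sum_const, nsmul_eq_mul] at h
    convert h using 3
    grind
  have hdom (i : Fin (m + 1)) :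
      1 ≤ t i + ∑ a with unitBallPerm m a i ≠ i, t (unitBallPerm m a i) := by
    have ht (j) : 0 ≤ t j := by simp only [t]; split_ifs <;> simp
    have hs : 0 ≤ ∑ a with unitBallPerm m a i ≠ i, t (unitBallPerm m a i) :=
      Finset.sum_nonneg fun _ _ => ht _
    by_cases hi : 1 ≤ y i
    · have : t i = 1 := if_pos hi
      omega
    · obtain ⟨d, -, hd2, -, h⟩ := hsplit i
      have h0 : 0 < ∑ a with unitBallPerm m a i ≠ i, y (unitBallPerm m a i) := by
        nlinarith
      obtain ⟨a, ha, hpos⟩ := Finset.exists_lt_of_sum_lt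
        (f := fun _ => (0 : ℤ)) (by simpa using h0)
      have h1 : t (unitBallPerm m a i) = 1 := if_pos hpos
      have := Finset.single_le_sum (f := fun a => t (unitBallPerm m a i)) (fun _ _ => ht _) ha
      have := ht i
      linarith
  have hneg (i : Fin (m + 1)) : 2 * (y i)⁻ ≤
      ∑ a with unitBallPerm m a i ≠ i, (y (unitBallPerm m a i) - t (unitBallPerm m a i))⁺ := by
    by_cases hi : 0 ≤ y i
    · rw [negPart_eq_zero.2 hi]
      simpa using Finset.sum_nonneg fun _ _ => posPart_nonneg _
    · obtain ⟨d, -, hd2, hd, h⟩ := hsplit i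
      have hle : ∑ a with unitBallPerm m a i ≠ i, y (unitBallPerm m a i) ≤
          ∑ a with unitBallPerm m a i ≠ i,
            ((y (unitBallPerm m a i) - t (unitBallPerm m a i))⁺ + 1) := by
        refine Finset.sum_le_sum fun a _ => ?_
        have h1 := le_posPart (y (unitBallPerm m a i) - t (unitBallPerm m a i))
        have h2 : t (unitBallPerm m a i) ≤ 1 := by simp only [t]; split_ifs <;> simp
        linarith
      rw [Finset.sum_add_distrib, Finset.sum_const, nsmul_one, hd] at hle
      rw [negPart_of_nonpos (by omega)]
      have : (4 : ℤ) ≤ m := by exact_mod_cast hm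
      nlinarith
  have hident (i : Fin (m + 1)) : y i = t i + (y i - t i)⁺ - (y i)⁻ := by
    simp only [t, posPart_def, negPart_def, max_def]
    split_ifs <;> omega
  have h1 := Finset.sum_le_sum fun i (_ : i ∈ Finset.univ) => hdom i
  have h2 := Finset.sum_le_sum fun i (_ : i ∈ Finset.univ) => hneg i
  have h3 := sum_sum_moving_unitBallPerm_le (f := t) fun i => by
    simp only [t]; split_ifs <;> simp
  have h4 := sum_sum_moving_unitBallPerm_le (f := fun i => (y i - t i)⁺) fun i =>
    posPart_nonneg _
  have h5 := Finset.sum_congr rfl fun i (_ : i ∈ Finset.univ) => hident i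
  rw [Finset.sum_sub_distrib, Finset.sum_add_distrib] at h5
  rw [Finset.sum_add_distrib] at h1
  rw [← Finset.mul_sum] at h2
  simp only [Finset.sum_const, Finset.card_univ, Fintype.card_fin, nsmul_eq_mul, mul_one] at h1
  push_cast at h1
  linarith

theorem P_p_3_upper_bound_prime
    {p : ℕ} (hp : p.Prime) (hp11 : 11 ≤ p)
    (C : Finset (Equiv.Perm (Fin p)))
    (hC : ∀ σ ∈ C, ∀ π ∈ C, σ ≠ π → 3 ≤ kendallDist σ π) :
    C.card ≤ Nat.factorial (p - 1) - ⌈(p : ℚ) / 3⌉₊ + 2 ∧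
    C.card ≤ Nat.factorial (p - 1) - 2 := by
  obtain ⟨m, rfl⟩ : ∃ m, p = m + 1 := ⟨p - 1, by omega⟩
  rw [Nat.add_sub_cancel]
  obtain ⟨M, hM⟩ : ((m + 1 : ℕ) : ℤ) ∣ (m.factorial : ℤ) + 1 := by
    have : Fact (m + 1).Prime := ⟨hp⟩
    have h := ZMod.wilsons_lemma (m + 1)
    rw [Nat.add_sub_cancel] at h
    rw [← ZMod.intCast_zmod_eq_zero_iff_dvd]
    push_cast
    rw [h]
    ring
  let N : Fin (m + 1) → ℤ := fun i => (C.filter fun σ => σ 0 = i).card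
  have hsum : ∑ i, N i = C.card := by
    rw [Finset.card_eq_sum_card_fiberwise (f := fun σ => σ 0) (t := Finset.univ) (by simp)]
    push_cast
    rfl
  have key := le_three_mul_sum_of_unitBall_sum_pos (m := m) (by omega)
      (y := fun i => M - N i) <| by
    intro i
    have h : ∑ a, N (unitBallPerm m a i) ≤ m.factorial := by
      simp only [N]
      exact_mod_cast sum_card_filter_unitBallPerm_le hC i
    rw [Finset.sum_sub_distrib, Finset.sum_const, Finset.card_univ, Fintype.card_option,
      Fintype.card_fin, nsmul_eq_mul]
    linarith
  rw [Finset.sum_sub_distrib, hsum, Finset.sum_const, Finset.card_univ, Fintype.card_fin,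
    nsmul_eq_mul, ← hM] at key
  have hceil : ⌈((m + 1 : ℕ) : ℚ) / 3⌉₊ ≤ (m + 3) / 3 := by
    rw [Nat.ceil_le, div_le_iff₀ (by norm_num)]
    exact_mod_cast (by omega : m + 1 ≤ (m + 3) / 3 * 3)
  have hfac := Nat.self_le_factorial m
  omega
end

section
/- Every subset C ⊆ S_6 such that d_K(σ,π) ≥ 3 for all distinct σ,π ∈ C satisfies |C| ≤ 116. -/
namespace KendallSix

open Equiv Finset

section Group

variable {G ι : Type*} [Group G] [Fintype G] [DecidableEq G]

/-- The number of `x ∈ C` with `h * x ∈ C`. -/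
def pairCount (C : Finset G) (h : G) : ℤ :=
  ∑ x, (if x ∈ C then 1 else 0) * (if h * x ∈ C then 1 else 0)

lemma pairCount_nonneg (C : Finset G) (h : G) : 0 ≤ pairCount C h :=
  sum_nonneg fun x _ => by split_ifs <;> simp

lemma pairCount_inv (C : Finset G) (h : G) : pairCount C h⁻¹ = pairCount C h := by
  rw [pairCount, ← Equiv.sum_comp (Equiv.mulLeft h)]
  simp only [pairCount, Equiv.coe_mulLeft, inv_mul_cancel_left, mul_comm]
  rfl

/-- The indicator function of the elements not covered by the sets `{(s k)⁻¹ * x | k}` with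
`x ∈ C`, provided that these sets are disjoint. -/
def uncovered [Fintype ι] (s : ι → G) (C : Finset G) (x : G) : ℤ :=
  1 - ∑ k, if s k * x ∈ C then 1 else 0

/-- The number of `x ∈ C` with `g * x` uncovered. -/
def uncoveredCount [Fintype ι] (s : ι → G) (C : Finset G) (g : G) : ℤ :=
  ∑ x, (if x ∈ C then 1 else 0) * uncovered s C (g * x)

lemma uncoveredCount_eq [Fintype ι] (s : ι → G) (C : Finset G) (g : G) :
    uncoveredCount s C g = #C - ∑ k, pairCount C (s k * g) := by
  simp only [uncoveredCount, uncovered, pairCount, mul_sub, mul_one, sum_sub_distrib, mul_sum,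
    mul_assoc]
  rw [sum_comm]
  simp

lemma sum_uncovered [Fintype ι] (s : ι → G) (C : Finset G) :
    ∑ x, uncovered s C x = Fintype.card G - Fintype.card ι * #C := by
  have h : ∀ k, ∑ x, (if s k * x ∈ C then (1 : ℤ) else 0) = #C := fun k => by
    refine (Equiv.sum_comp (Equiv.mulLeft (s k)) fun x => if x ∈ C then (1 : ℤ) else 0).trans ?_
    simp
  simp only [uncovered, sum_sub_distrib]
  rw [sum_comm]
  simp [h]

lemma sum_mul_pairCount_nonpos {s : ι → G} (hs : ∀ k, s k * s k = 1) {C : Finset G}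
    (hC : ∀ x k l, s k * x ∈ C → s l * x ∈ C → k = l) {W : G → ℤ}
    (hW : ∀ h, W h + W h⁻¹ ≤ 0 ∨ ∃ k l, k ≠ l ∧ h = s k * s l) :
    ∑ h, W h * pairCount C h ≤ 0 := by
  have h_inv : ∑ h, W h * pairCount C h = ∑ h, W h⁻¹ * pairCount C h := by
    rw [← Equiv.sum_comp (Equiv.inv G)]
    simp [pairCount_inv]
  have h_nonpos : ∑ h, (W h + W h⁻¹) * pairCount C h ≤ 0 := by
    refine sum_nonpos fun h _ => ?_
    obtain hh | ⟨k, l, hkl, rfl⟩ := hW h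
    · exact mul_nonpos_of_nonpos_of_nonneg hh (pairCount_nonneg C h)
    · suffices hz : pairCount C (s k * s l) = 0 by simp [hz]
      refine sum_eq_zero fun x _ => ?_
      rw [mul_eq_zero, ite_eq_right_iff, ite_eq_right_iff]
      by_contra! hx
      refine hkl (hC (s l * x) k l ?_ ?_)
      · simpa [mul_assoc] using hx.2.1
      · simpa [← mul_assoc, hs] using hx.1.1
  simp only [add_mul, sum_add_distrib] at h_nonpos
  linarith

theorem sum_mul_card_le [Fintype ι] {s : ι → G} (hs : ∀ k, s k * s k = 1) {C : Finset G}
    (hC : ∀ x k l, s k * x ∈ C → s l * x ∈ C → k = l) {w β : G → ℤ} (hβ : ∀ g, 0 ≤ β g)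
    (hwβ : ∀ g, w g ≤ ∑ k, β (g * s k))
    (hw : ∀ h, ∑ k, w (s k * h) + ∑ k, w (s k * h⁻¹) ≤ 0 ∨ ∃ k l, k ≠ l ∧ h = s k * s l) :
    (∑ g, w g) * #C ≤ (∑ g, β g) * (Fintype.card G - Fintype.card ι * #C) := by
  have hs_inv : ∀ k x, s k * (s k * x) = x := fun k x => by rw [← mul_assoc, hs, one_mul]
  have h_sum_le : ∀ x, ∑ k, (if s k * x ∈ C then (1 : ℤ) else 0) ≤ 1 := fun x => by
    rw [sum_boole]
    exact_mod_cast card_le_one.2 fun k hk l hl =>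
      hC x k l (mem_filter.1 hk).2 (mem_filter.1 hl).2
  have hu : ∀ x, 0 ≤ uncovered s C x := fun x => sub_nonneg.2 (h_sum_le x)
  have hd : ∀ g, 0 ≤ uncoveredCount s C g := fun g =>
    sum_nonneg fun x _ => mul_nonneg (by split_ifs <;> simp) (hu _)
  have h_ball : ∀ g, ∑ k, uncoveredCount s C (g * s k) ≤ ∑ x, uncovered s C x := fun g =>
    calc ∑ k, uncoveredCount s C (g * s k)
        = ∑ k, ∑ x, (if s k * x ∈ C then 1 else 0) * uncovered s C (g * x) := by
          refine sum_congr rfl fun k _ => ?_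
          rw [uncoveredCount, ← Equiv.sum_comp (Equiv.mulLeft (s k))]
          simp only [Equiv.coe_mulLeft, mul_assoc, hs_inv]
          rfl
      _ = ∑ x, (∑ k, if s k * x ∈ C then 1 else 0) * uncovered s C (g * x) := by
          rw [sum_comm]
          simp only [sum_mul]
      _ ≤ ∑ x, uncovered s C (g * x) :=
          sum_le_sum fun x _ => mul_le_of_le_one_left (hu _) (h_sum_le x)
      _ = ∑ x, uncovered s C x := Equiv.sum_comp (Equiv.mulLeft g) _
  have h_upper : ∑ g, w g * uncoveredCount s C g ≤ (∑ g, β g) * ∑ x, uncovered s C x :=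
    calc ∑ g, w g * uncoveredCount s C g
        ≤ ∑ g, (∑ k, β (g * s k)) * uncoveredCount s C g :=
          sum_le_sum fun g _ => mul_le_mul_of_nonneg_right (hwβ g) (hd g)
      _ = ∑ k, ∑ g, β (g * s k) * uncoveredCount s C g := by
          rw [sum_comm]
          simp only [sum_mul]
      _ = ∑ k, ∑ g, β g * uncoveredCount s C (g * s k) := by
          refine sum_congr rfl fun k _ => ?_
          rw [← Equiv.sum_comp (Equiv.mulRight (s k))]
          simp [mul_assoc, hs]
      _ = ∑ g, β g * ∑ k, uncoveredCount s C (g * s k) := by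
          rw [sum_comm]
          simp only [mul_sum]
      _ ≤ ∑ g, β g * ∑ x, uncovered s C x :=
          sum_le_sum fun g _ => mul_le_mul_of_nonneg_left (h_ball g) (hβ g)
      _ = (∑ g, β g) * ∑ x, uncovered s C x := (sum_mul ..).symm
  have h_lower : ∑ g, w g * uncoveredCount s C g =
      (∑ g, w g) * #C - ∑ h, (∑ k, w (s k * h)) * pairCount C h := by
    simp only [uncoveredCount_eq, mul_sub, sum_sub_distrib, ← sum_mul]
    congr 1
    simp only [mul_sum, sum_mul]
    rw [sum_comm, sum_comm (s := univ (α := G))]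
    refine sum_congr rfl fun k _ => ?_
    rw [← Equiv.sum_comp (Equiv.mulLeft (s k))]
    simp [hs_inv]
  rw [sum_uncovered] at h_upper
  linarith [sum_mul_pairCount_nonpos hs hC (W := fun h => ∑ k, w (s k * h)) hw]

end Group

/-- The five adjacent transpositions of `Fin 6`, followed by the identity. -/
def ballGen : Fin 6 → Perm (Fin 6) :=
  ![swap 0 1, swap 1 2, swap 2 3, swap 3 4, swap 4 5, 1]

/-- The one-line notation of a permutation of `{1, …, 6}`, read as a decimal numeral. -/
def oneLine (g : Perm (Fin 6)) : ℕ :=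
  ∑ i : Fin 6, ((g i : ℕ) + 1) * 10 ^ (5 - (i : ℕ))

/-- The value stored under the key `c`, or `d` if there is none. -/
def tableValue (d : ℕ) (t : List (ℕ × ℕ)) (c : ℕ) : ℕ :=
  t.rec d fun kv _ v => bif Nat.beq c kv.1 then kv.2 else v

/-- Multipliers for the inequalities bounding, for an uncovered `y`, the number of codewords in
the ball around `g⁻¹ * y`. Keys are one-line notations. -/
def centreTable : List (ℕ × ℕ) :=
  [(123465, 3), (124365, 2), (124536, 2), (126354, 2), (132465, 1), (132564, 1), (142356, 2),
   (142365, 1), (213456, 3), (213546, 1), (214356, 2), (214536, 1), (312546, 1), (324156, 2)]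

/-- Weights, increased by `4`, of the pairs formed by a codeword `x` and an uncovered `g * x`.
Keys are one-line notations. -/
def pairTable : List (ℕ × ℕ) :=
  [(123564, 3), (123645, 7), (123654, 6), (124365, 5), (124536, 6), (124563, 5), (125364, 1),
   (125436, 6), (132465, 8), (132564, 5), (132645, 5), (132654, 0), (134526, 3), (134625, 3),
   (135264, 5), (136245, 3), (142356, 6), (142365, 6), (142635, 5), (143256, 6), (143265, 0),
   (152346, 3), (213465, 0), (213546, 8), (213564, 2), (214356, 5), (214365, 8), (214536, 6),
   (214563, 5), (214635, 2), (215364, 3), (215436, 0), (231456, 7), (231546, 5), (231564, 3),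
   (235146, 3), (241365, 2), (241536, 5), (251346, 3), (312456, 3), (312465, 2), (312546, 5),
   (312564, 6), (312645, 3), (314256, 1), (314265, 3), (315246, 5), (321456, 6), (321546, 0),
   (412356, 5), (412365, 5)]

/-- The multiplier of `g` given by `centreTable`. -/
def centreWeight (g : Perm (Fin 6)) : ℕ :=
  tableValue 0 centreTable (oneLine g)

/-- The weight of `g` given by `pairTable`, increased by `4`. -/
def pairWeight (g : Perm (Fin 6)) : ℕ :=
  tableValue 4 pairTable (oneLine g)

/-- Whether `q` holds for all arrangements of `0, …, 5`. -/
def allArrangements (q : ℕ → ℕ → ℕ → ℕ → ℕ → ℕ → Bool) : Bool :=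
  let l := [0, 1, 2, 3, 4, 5]
  l.all fun a => l.all fun b => Nat.beq b a || l.all fun c => Nat.beq c a || Nat.beq c b ||
    l.all fun d => Nat.beq d a || Nat.beq d b || Nat.beq d c ||
    l.all fun e => Nat.beq e a || Nat.beq e b || Nat.beq e c || Nat.beq e d ||
    l.all fun f => Nat.beq f a || Nat.beq f b || Nat.beq f c || Nat.beq f d || Nat.beq f e ||
    q a b c d e f

lemma apply_of_allArrangements {q : ℕ → ℕ → ℕ → ℕ → ℕ → ℕ → Bool} (hq : allArrangements q)
    (g : Perm (Fin 6)) : q (g 0) (g 1) (g 2) (g 3) (g 4) (g 5) := by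
  have h_mem : ∀ i : Fin 6, (i : ℕ) ∈ [0, 1, 2, 3, 4, 5] := by decide
  have h_ne : ∀ i j, i ≠ j → Nat.beq (g i) (g j) = false := fun i j hij => by
    rw [← Bool.not_eq_true, Nat.beq_eq]
    exact fun h => hij (g.injective (Fin.ext h))
  simp only [allArrangements, List.all_eq_true, Bool.or_eq_true] at hq
  have h := hq (g 0) (h_mem _) (g 1) (h_mem _)
  simp only [h_ne 1 0 (by decide), Bool.false_eq_true, false_or] at h
  have h := h (g 2) (h_mem _)
  simp only [h_ne 2 0 (by decide), h_ne 2 1 (by decide), Bool.false_eq_true, false_or] at h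
  have h := h (g 3) (h_mem _)
  simp only [h_ne 3 0 (by decide), h_ne 3 1 (by decide), h_ne 3 2 (by decide),
    Bool.false_eq_true, false_or] at h
  have h := h (g 4) (h_mem _)
  simp only [h_ne 4 0 (by decide), h_ne 4 1 (by decide), h_ne 4 2 (by decide),
    h_ne 4 3 (by decide), Bool.false_eq_true, false_or] at h
  have h := h (g 5) (h_mem _)
  simpa only [h_ne 5 0 (by decide), h_ne 5 1 (by decide), h_ne 5 2 (by decide),
    h_ne 5 3 (by decide), h_ne 5 4 (by decide), Bool.false_eq_true, false_or] using h

/-- The numeral with digits `a + 1, …, f + 1`. -/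
def numeral (a b c d e f : ℕ) : ℕ :=
  (a + 1) * 100000 + (b + 1) * 10000 + (c + 1) * 1000 + (d + 1) * 100 + (e + 1) * 10 + (f + 1)

lemma oneLine_eq_numeral (g : Perm (Fin 6)) :
    oneLine g = numeral (g 0) (g 1) (g 2) (g 3) (g 4) (g 5) := by
  simp [oneLine, numeral, Fin.sum_univ_six]

lemma pairWeight_le_sum_centreWeight (g : Perm (Fin 6)) :
    pairWeight g ≤ ∑ k, centreWeight (g * ballGen k) + 4 := by
  have h : allArrangements fun a b c d e f =>
      Nat.ble (tableValue 4 pairTable (numeral a b c d e f))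
        (tableValue 0 centreTable (numeral b a c d e f) +
        tableValue 0 centreTable (numeral a c b d e f) +
        tableValue 0 centreTable (numeral a b d c e f) +
        tableValue 0 centreTable (numeral a b c e d f) +
        tableValue 0 centreTable (numeral a b c d f e) +
        tableValue 0 centreTable (numeral a b c d e f) + 4) := by
    decide +kernel
  simp only [pairWeight, centreWeight, Fin.sum_univ_six, oneLine_eq_numeral, Perm.mul_apply]
  exact Nat.le_of_ble_eq_true (apply_of_allArrangements h g)

/-- Interchanges `m` and `m + 1`, if both are less than `6`. -/
def natSwap (m x : ℕ) : ℕ :=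
  bif Nat.beq x m then min (m + 1) 5 else bif Nat.beq x (m + 1) then m else x

lemma ballGen_apply : ∀ k x : Fin 6, (ballGen k x : ℕ) = natSwap k x := by
  decide

/-- The sum of `pairWeight` over the ball around a permutation with one-line notation
`a + 1, …, f + 1`. -/
def ballPairWeight (a b c d e f : ℕ) : ℕ :=
  let t := fun m => tableValue 4 pairTable (numeral (natSwap m a) (natSwap m b) (natSwap m c)
    (natSwap m d) (natSwap m e) (natSwap m f))
  t 0 + t 1 + t 2 + t 3 + t 4 + t 5

/-- The sum of `pairWeight` over the ball around the inverse of a permutation with one-line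
notation `a + 1, …, f + 1`. -/
def ballPairWeightInv (a b c d e f : ℕ) : ℕ :=
  let t := fun m => tableValue 4 pairTable ((natSwap m 0 + 1) * 10 ^ (5 - a) +
    (natSwap m 1 + 1) * 10 ^ (5 - b) + (natSwap m 2 + 1) * 10 ^ (5 - c) +
    (natSwap m 3 + 1) * 10 ^ (5 - d) + (natSwap m 4 + 1) * 10 ^ (5 - e) +
    (natSwap m 5 + 1) * 10 ^ (5 - f))
  t 0 + t 1 + t 2 + t 3 + t 4 + t 5

lemma sum_pairWeight_ball (g : Perm (Fin 6)) :
    ∑ k, pairWeight (ballGen k * g) =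
      ballPairWeight (g 0) (g 1) (g 2) (g 3) (g 4) (g 5) := by
  simp only [pairWeight, oneLine_eq_numeral, Perm.mul_apply, ballGen_apply, Fin.sum_univ_six]
  rfl

lemma sum_pairWeight_ball_inv (g : Perm (Fin 6)) :
    ∑ k, pairWeight (ballGen k * g⁻¹) =
      ballPairWeightInv (g 0) (g 1) (g 2) (g 3) (g 4) (g 5) := by
  have h : ∀ k, oneLine (ballGen k * g⁻¹) =
      ∑ i : Fin 6, (natSwap k i + 1) * 10 ^ (5 - (g i : ℕ)) := fun k => by
    rw [oneLine, ← Equiv.sum_comp g]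
    simp [ballGen_apply]
  simp only [pairWeight, h, Fin.sum_univ_six]
  rfl

lemma sum_pairWeight_add_inv_le_or (g : Perm (Fin 6)) :
    ∑ k, pairWeight (ballGen k * g) + ∑ k, pairWeight (ballGen k * g⁻¹) ≤ 48 ∨
      ∃ k l, k ≠ l ∧ g = ballGen k * ballGen l := by
  have h : allArrangements fun a b c d e f =>
      Nat.ble (ballPairWeight a b c d e f + ballPairWeightInv a b c d e f) 48 ||
        decide (∃ k l : Fin 6, k ≠ l ∧ a = natSwap k (natSwap l 0) ∧
          b = natSwap k (natSwap l 1) ∧ c = natSwap k (natSwap l 2) ∧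
          d = natSwap k (natSwap l 3) ∧ e = natSwap k (natSwap l 4) ∧
          f = natSwap k (natSwap l 5)) := by
    decide +kernel
  have hg := apply_of_allArrangements h g
  rw [Bool.or_eq_true, decide_eq_true_iff] at hg
  rw [sum_pairWeight_ball, sum_pairWeight_ball_inv]
  refine hg.imp Nat.le_of_ble_eq_true ?_
  rintro ⟨k, l, hkl, h0, h1, h2, h3, h4, h5⟩
  refine ⟨k, l, hkl, Equiv.ext fun i => Fin.ext ?_⟩
  rw [Perm.mul_apply, ballGen_apply, ballGen_apply]
  fin_cases i
  exacts [h0, h1, h2, h3, h4, h5]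

lemma sum_centreWeight : ∑ g, centreWeight g = 24 := by
  decide +kernel

lemma sum_pairWeight : ∑ g, pairWeight g = 4 + 4 * 720 := by
  decide +kernel

lemma ballGen_mul_self : ∀ k, ballGen k * ballGen k = 1 := by
  decide

lemma ballGen_injective : Function.Injective ballGen := by
  decide

lemma exists_walk_ballGen_mul (k : Fin 6) (x : Perm (Fin 6)) :
    ∃ p : (kendallGraph 6).Walk (ballGen k * x) x, p.length ≤ 1 := by
  by_cases h : ballGen k = 1
  · rw [h, one_mul]
    exact ⟨.nil, by simp⟩
  · have h_mem : ballGen k ∈ adjacentTranspositions 6 := by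
      fin_cases k
      exacts [⟨0, by decide, rfl⟩, ⟨1, by decide, rfl⟩, ⟨2, by decide, rfl⟩,
        ⟨3, by decide, rfl⟩, ⟨4, by decide, rfl⟩, absurd rfl h]
    have h_adj : (kendallGraph 6).Adj (ballGen k * x) x := by
      rw [kendallGraph, SimpleGraph.fromRel_adj]
      exact ⟨by simpa using h, .inl (by simpa using h_mem)⟩
    exact ⟨h_adj.toWalk, by simp⟩

lemma kendallDist_ballGen_mul_le (k l : Fin 6) (x : Perm (Fin 6)) :
    kendallDist (ballGen k * x) (ballGen l * x) ≤ 2 := by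
  obtain ⟨p, hp⟩ := exists_walk_ballGen_mul k x
  obtain ⟨q, hq⟩ := exists_walk_ballGen_mul l x
  refine (SimpleGraph.dist_le (p.append q.reverse)).trans ?_
  rw [SimpleGraph.Walk.length_append, SimpleGraph.Walk.length_reverse]
  lia

end KendallSix

theorem P_6_3_le_116
    (C : Finset (Equiv.Perm (Fin 6)))
    (hC : ∀ σ ∈ C, ∀ π ∈ C, σ ≠ π → 3 ≤ kendallDist σ π) :
    C.card ≤ 116 := by
  have h_disjoint : ∀ x k l, KendallSix.ballGen k * x ∈ C → KendallSix.ballGen l * x ∈ C →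
      k = l := fun x k l hk hl => by
    by_contra hkl
    have h := hC _ hk _ hl fun h => hkl (KendallSix.ballGen_injective (mul_right_cancel h))
    have := KendallSix.kendallDist_ballGen_mul_le k l x
    lia
  have h := KendallSix.sum_mul_card_le KendallSix.ballGen_mul_self h_disjoint
    (w := fun g => (KendallSix.pairWeight g : ℤ) - 4) (β := fun g => KendallSix.centreWeight g)
    (fun g => Int.natCast_nonneg _)
    (fun g => by
      have := KendallSix.pairWeight_le_sum_centreWeight g
      zify at this
      linarith)
    (fun g => by
      refine (KendallSix.sum_pairWeight_add_inv_le_or g).imp_left fun hg => ?_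
      zify at hg
      simp only [Finset.sum_sub_distrib, Finset.sum_const, Finset.card_univ, Fintype.card_fin]
      norm_num
      linarith)
  have h_card : Fintype.card (Equiv.Perm (Fin 6)) = 720 := by
    rw [Fintype.card_perm, Fintype.card_fin]
    rfl
  have h_pair := KendallSix.sum_pairWeight
  have h_centre := KendallSix.sum_centreWeight
  zify at h_pair h_centre
  simp only [Finset.sum_sub_distrib, Finset.sum_const, Finset.card_univ, h_card, h_pair,
    h_centre, Fintype.card_fin] at h
  norm_num at h
  lia
end

section
/- Every subset C ⊆ S_7 such that d_K(σ,π) ≥ 3 for all distinct σ,π ∈ C satisfies |C| ≤ 716. -/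
namespace KendallCode

open Equiv

/-- The adjacent transposition `(i, i+1)` for `i < 6`, and the identity for `i = 6`. -/
def gen (i : Fin 7) : Perm (Fin 7) :=
  swap i ⟨min (i.val + 1) 6, by omega⟩

/-- The one-line notation of `p⁻¹`, read as a number in base eight. -/
def code (p : Perm (Fin 7)) : ℕ :=
  ∑ i : Fin 7, (p⁻¹ i : ℕ) * 8 ^ (i : ℕ)

/-- The effect on codes of left multiplication by `gen i`. -/
def stepCode (i c : ℕ) : ℕ :=
  c + ((c / 8 ^ min (i + 1) 6 % 8) * 8 ^ i + (c / 8 ^ i % 8) * 8 ^ min (i + 1) 6)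
    - ((c / 8 ^ i % 8) * 8 ^ i + (c / 8 ^ min (i + 1) 6 % 8) * 8 ^ min (i + 1) 6)

theorem gen_mul_self (i : Fin 7) : gen i * gen i = 1 := swap_mul_self _ _

theorem gen_inv (i : Fin 7) : (gen i)⁻¹ = gen i := swap_inv _ _

theorem gen_injective : Function.Injective gen := by decide

theorem code_div_mod (p : Perm (Fin 7)) (j : Fin 7) : code p / 8 ^ (j : ℕ) % 8 = p⁻¹ j := by
  rw [code, Fin.sum_univ_seven]
  have h : ∀ i, (p⁻¹ i : ℕ) < 7 := fun i => (p⁻¹ i).isLt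
  generalize p⁻¹ = q at *
  have := h 0; have := h 1; have := h 2; have := h 3
  have := h 4; have := h 5; have := h 6
  fin_cases j <;> simp <;> omega

theorem code_injective : Function.Injective code := by
  intro p q h
  refine inv_injective (Equiv.ext fun j => Fin.ext ?_)
  rw [← code_div_mod, ← code_div_mod, h]

theorem code_gen_mul (i : Fin 7) (p : Perm (Fin 7)) :
    code (gen i * p) = stepCode i (code p) := by
  have h : ∀ j, (gen i * p)⁻¹ j = p⁻¹ (gen i j) := fun j => by
    rw [mul_inv_rev, gen_inv, Perm.mul_apply]
  have hdiv : code p / 8 ^ min (i.val + 1) 6 % 8 = p⁻¹ ⟨min (i.val + 1) 6, by omega⟩ :=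
    code_div_mod p ⟨min (i.val + 1) 6, by omega⟩
  rw [stepCode, hdiv, code_div_mod]
  simp only [code, h, Fin.sum_univ_seven]
  fin_cases i <;> simp [gen, swap_apply_def] <;> omega

theorem exists_walk_gen_mul (i : Fin 7) (p : Perm (Fin 7)) :
    ∃ W : (kendallGraph 7).Walk (gen i * p) p, W.length ≤ 1 := by
  by_cases h : gen i * p = p
  · rw [h]
    exact ⟨.nil, by simp⟩
  · have hi : i.val + 1 < 7 := by
      by_contra hi
      have : i = 6 := by omega
      subst this
      exact h (by rw [show gen 6 = 1 from swap_self _, one_mul])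
    have hadj : (kendallGraph 7).Adj (gen i * p) p := by
      refine (SimpleGraph.fromRel_adj _ _ _).2 ⟨h, .inl ⟨i, hi, ?_⟩⟩
      rw [mul_inv_cancel_right, gen]
      congr 2
      omega
    exact ⟨hadj.toWalk, by simp⟩

theorem kendallDist_gen_mul_gen_mul_le (i j : Fin 7) (p : Perm (Fin 7)) :
    kendallDist (gen i * (gen j * p)) p ≤ 2 := by
  obtain ⟨W, hW⟩ := exists_walk_gen_mul i (gen j * p)
  obtain ⟨W', hW'⟩ := exists_walk_gen_mul j p
  refine (SimpleGraph.dist_le (W.append W')).trans ?_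
  rw [SimpleGraph.Walk.length_append]
  omega

/-- Exhaustive search for an independent set of `conf` (bit `y` of `conf[x]` says that `x` and `y`
are in conflict) that meets every row of `rows`. The rows to branch on are read from a list in
preorder. The result is `none` if the search is inconclusive; otherwise it is the unread part of
the list. -/
def refute (rows : List (List ℕ)) (conf : List ℕ) : ℕ → ℕ → List ℕ → Option (List ℕ)
  | 0, _, _ => none
  | _ + 1, _, [] => none
  | k + 1, forbidden, w :: rest =>
    match rows[w]? with
    | none => none
    | some row => row.foldl (fun r x => r.bind fun l =>
        bif forbidden.testBit x then some l
        else refute rows conf k (forbidden ||| conf.getD x 0) l) (some rest)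

theorem foldl_bind_eq_none {α β : Type*} {f : β → α → Option α} {l : List β} {x : β}
    (hx : x ∈ l) (hf : ∀ a, f x a = none) (r : Option α) :
    l.foldl (fun r x => r.bind (f x)) r = none := by
  have hnone : ∀ l : List β, l.foldl (fun r x => r.bind (f x)) none = none := by
    intro l
    induction l with
    | nil => rfl
    | cons y l ih => simpa using ih
  induction l generalizing r with
  | nil => simp at hx
  | cons y l ih =>
    rcases List.mem_cons.1 hx with rfl | h
    · have : r.bind (f x) = none := by cases r <;> simp [hf]
      rw [List.foldl_cons, this, hnone]
    · exact ih h _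

theorem refute_eq_none {rows : List (List ℕ)} {conf : List ℕ} {S : ℕ → Prop}
    (hrows : ∀ row ∈ rows, ∃ x ∈ row, S x)
    (hconf : ∀ x y, S x → (conf.getD x 0).testBit y = true → ¬ S y) (k : ℕ) :
    ∀ (forbidden : ℕ) (l : List ℕ), (∀ y, forbidden.testBit y = true → ¬ S y) →
      refute rows conf k forbidden l = none := by
  induction k with
  | zero => intro _ _ _; rfl
  | succ k ih =>
    intro forbidden l hforb
    cases l with
    | nil => rfl
    | cons w rest =>
      rw [refute]
      split
      · rfl
      · next row hrow =>
        obtain ⟨x, hx, hSx⟩ := hrows row (List.mem_of_getElem? hrow)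
        refine foldl_bind_eq_none (f := fun x l => bif forbidden.testBit x then some l
          else refute rows conf k (forbidden ||| conf.getD x 0) l) hx (fun a => ?_) _
        have hbit : forbidden.testBit x = false := by
          by_contra h
          exact hforb x (by simpa using h) hSx
        simp only [hbit, cond_false]
        refine ih _ _ fun y hy => ?_
        rw [Nat.testBit_or, Bool.or_eq_true] at hy
        exact hy.elim (hforb y) (hconf x y hSx)

theorem mk_getElem_mem_zip {α β : Type*} (l : List α) (l' : List β) {x : ℕ} (h : x < l.length)
    (h' : x < l'.length) : (l[x], l'[x]) ∈ l.zip l' := by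
  rw [← List.getElem_zip (h := by rw [List.length_zip]; exact lt_min h h')]
  exact List.getElem_mem _

/-- Whether two distinct codes can be reached from a common one by generators. -/
def closeCodes (a b : ℕ) : Bool :=
  a != b && (List.range 7).any fun i => (List.range 7).any fun j => stepCode i a == stepCode j b

/-- Whether `f` holds for the entries of a list selected by the bits of `m`, all of which lie
within the length of the list. -/
def bitsSatisfy (f : ℕ → Bool) : List ℕ → ℕ → Bool
  | [], m => m == 0
  | b :: l, m => (m % 2 == 0 || f b) && bitsSatisfy f l (m / 2)

theorem bitsSatisfy_testBit {f : ℕ → Bool} {l : List ℕ} {m y : ℕ} (h : bitsSatisfy f l m = true)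
    (hy : m.testBit y = true) : f (l.getD y 0) = true := by
  induction l generalizing m y with
  | nil => simp_all [bitsSatisfy]
  | cons b l ih =>
    simp only [bitsSatisfy, Bool.and_eq_true, Bool.or_eq_true, beq_iff_eq] at h
    cases y with
    | zero =>
      refine h.1.resolve_left ?_
      rw [Nat.testBit_zero, decide_eq_true_eq] at hy
      omega
    | succ y => exact ih h.2 (by rwa [Nat.testBit_succ] at hy)

/-- Codes of the permutations in `H ∪ sH`, where `H ≃ S₃ × S₄` is generated by all adjacent
transpositions but `s = (2, 3)`; the first 144 entries are those of `H`. -/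
def pointCodes : List ℕ :=
  [1754760, 1754753, 1754704, 1751176, 1726088, 1525384, 1754641, 1751169, 1726081, 1525377,
   1754690, 1751120, 1726032, 1525328, 1693832, 1521800, 1718920, 1267336, 1468040, 1754634,
   1751057, 1725969, 1525265, 1693825, 1521793, 1718913, 1267329, 1468033, 1751106, 1726018,
   1525314, 1693776, 1521744, 1718864, 1267280, 1467984, 1690248, 1005704, 1435784, 1260168,
   1238664, 1457288, 1751050, 1725962, 1525258, 1693713, 1521681, 1718801, 1267217, 1467921,
   1690241, 1005697, 1435777, 1260161, 1238657, 1457281, 1693762, 1521730, 1718850, 1267266,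
   1467970, 1690192, 1005648, 1435728, 1260112, 1238608, 1457232, 1002120, 977032, 1428616,
   1174152, 1227912, 1693706, 1521674, 1718794, 1267210, 1467914, 1690129, 1005585, 1435665,
   1260049, 1238545, 1457169, 1002113, 977025, 1428609, 1174145, 1227905, 1690178, 1005634,
   1435714, 1260098, 1238594, 1457218, 1002064, 976976, 1428560, 1174096, 1227856, 944776, 969864,
   1170568, 1690122, 1005578, 1435658, 1260042, 1238538, 1457162, 1002001, 976913, 1428497,
   1174033, 1227793, 944769, 969857, 1170561, 1002050, 976962, 1428546, 1174082, 1227842, 944720,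
   969808, 1170512, 941192, 1001994, 976906, 1428490, 1174026, 1227786, 944657, 969745, 1170449,
   941185, 944706, 969794, 1170498, 941136, 944650, 969738, 1170442, 941073, 941122, 941066,
   1754312, 1754305, 1753808, 1750280, 1725640, 1524936, 1753297, 1750273, 1725633, 1524929,
   1753794, 1749776, 1725136, 1524432, 1692936, 1520904, 1717576, 1266888, 1467592, 1753290,
   1749265, 1724625, 1523921, 1692929, 1520897, 1717569, 1266881, 1467585, 1749762, 1725122,
   1524418, 1692432, 1520400, 1717072, 1266384, 1467088, 1688904, 1004808, 1434888, 1258824,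
   1238216, 1455496, 1749258, 1724618, 1523914, 1691921, 1519889, 1716561, 1265873, 1466577,
   1688897, 1004801, 1434881, 1258817, 1238209, 1455489, 1692418, 1520386, 1717058, 1266370,
   1467074, 1688400, 1004304, 1434384, 1258320, 1237712, 1454992, 1000776, 976136, 1426824,
   1172808, 1226120, 1691914, 1519882, 1716554, 1265866, 1466570, 1687889, 1003793, 1433873,
   1257809, 1237201, 1454481, 1000769, 976129, 1426817, 1172801, 1226113, 1688386, 1004290,
   1434370, 1258306, 1237698, 1454978, 1000272, 975632, 1426320, 1172304, 1225616, 943432, 968072,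
   1168776, 1687882, 1003786, 1433866, 1257802, 1237194, 1454474, 999761, 975121, 1425809,
   1171793, 1225105, 943425, 968065, 1168769, 1000258, 975618, 1426306, 1172290, 1225602, 942928,
   967568, 1168272, 939400, 999754, 975114, 1425802, 1171786, 1225098, 942417, 967057, 1167761,
   939393, 942914, 967554, 1168258, 938896, 942410, 967050, 1167754, 938385, 938882, 938378]

/-- Row `w` lists the positions in `pointCodes` of `gen i * p`, for `i < 7`, where `p ∈ H` is the
permutation with code `pointCodes[w]`. -/
def neighbours : List (List ℕ) :=
  [[1, 2, 144, 3, 4, 5, 0], [0, 6, 145, 7, 8, 9, 1], [10, 0, 146, 11, 12, 13, 2], [7, 11, 147, 0,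
   14, 15, 3], [8, 12, 148, 16, 0, 17, 4], [9, 13, 149, 15, 18, 0, 5], [19, 1, 150, 20, 21, 22,
   6], [3, 20, 151, 1, 23, 24, 7], [4, 21, 152, 25, 1, 26, 8], [5, 22, 153, 24, 27, 1, 9], [2, 19,
   154, 28, 29, 30, 10], [28, 3, 155, 2, 31, 32, 11], [29, 4, 156, 33, 2, 34, 12], [30, 5, 157,
   32, 35, 2, 13], [23, 31, 158, 36, 3, 37, 14], [24, 32, 159, 5, 38, 3, 15], [25, 33, 160, 4, 36,
   39, 16], [26, 34, 161, 39, 40, 4, 17], [27, 35, 162, 41, 5, 40, 18], [6, 10, 163, 42, 43, 44,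
   19], [42, 7, 164, 6, 45, 46, 20], [43, 8, 165, 47, 6, 48, 21], [44, 9, 166, 46, 49, 6, 22],
   [14, 45, 167, 50, 7, 51, 23], [15, 46, 168, 9, 52, 7, 24], [16, 47, 169, 8, 50, 53, 25], [17,
   48, 170, 53, 54, 8, 26], [18, 49, 171, 55, 9, 54, 27], [11, 42, 172, 10, 56, 57, 28], [12, 43,
   173, 58, 10, 59, 29], [13, 44, 174, 57, 60, 10, 30], [56, 14, 175, 61, 11, 62, 31], [57, 15,
   176, 13, 63, 11, 32], [58, 16, 177, 12, 61, 64, 33], [59, 17, 178, 64, 65, 12, 34], [60, 18,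
   179, 66, 13, 65, 35], [50, 61, 180, 14, 16, 67, 36], [51, 62, 181, 67, 68, 14, 37], [52, 63,
   182, 69, 15, 68, 38], [53, 64, 183, 17, 70, 16, 39], [54, 65, 184, 71, 17, 18, 40], [55, 66,
   185, 18, 69, 71, 41], [20, 28, 186, 19, 72, 73, 42], [21, 29, 187, 74, 19, 75, 43], [22, 30,
   188, 73, 76, 19, 44], [72, 23, 189, 77, 20, 78, 45], [73, 24, 190, 22, 79, 20, 46], [74, 25,
   191, 21, 77, 80, 47], [75, 26, 192, 80, 81, 21, 48], [76, 27, 193, 82, 22, 81, 49], [36, 77,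
   194, 23, 25, 83, 50], [37, 78, 195, 83, 84, 23, 51], [38, 79, 196, 85, 24, 84, 52], [39, 80,
   197, 26, 86, 25, 53], [40, 81, 198, 87, 26, 27, 54], [41, 82, 199, 27, 85, 87, 55], [31, 72,
   200, 88, 28, 89, 56], [32, 73, 201, 30, 90, 28, 57], [33, 74, 202, 29, 88, 91, 58], [34, 75,
   203, 91, 92, 29, 59], [35, 76, 204, 93, 30, 92, 60], [88, 36, 205, 31, 33, 94, 61], [89, 37,
   206, 94, 95, 31, 62], [90, 38, 207, 96, 32, 95, 63], [91, 39, 208, 34, 97, 33, 64], [92, 40,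
   209, 98, 34, 35, 65], [93, 41, 210, 35, 96, 98, 66], [83, 94, 211, 37, 99, 36, 67], [84, 95,
   212, 100, 37, 38, 68], [85, 96, 213, 38, 41, 100, 69], [86, 97, 214, 101, 39, 99, 70], [87, 98,
   215, 40, 101, 41, 71], [45, 56, 216, 102, 42, 103, 72], [46, 57, 217, 44, 104, 42, 73], [47,
   58, 218, 43, 102, 105, 74], [48, 59, 219, 105, 106, 43, 75], [49, 60, 220, 107, 44, 106, 76],
   [102, 50, 221, 45, 47, 108, 77], [103, 51, 222, 108, 109, 45, 78], [104, 52, 223, 110, 46, 109,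
   79], [105, 53, 224, 48, 111, 47, 80], [106, 54, 225, 112, 48, 49, 81], [107, 55, 226, 49, 110,
   112, 82], [67, 108, 227, 51, 113, 50, 83], [68, 109, 228, 114, 51, 52, 84], [69, 110, 229, 52,
   55, 114, 85], [70, 111, 230, 115, 53, 113, 86], [71, 112, 231, 54, 115, 55, 87], [61, 102, 232,
   56, 58, 116, 88], [62, 103, 233, 116, 117, 56, 89], [63, 104, 234, 118, 57, 117, 90], [64, 105,
   235, 59, 119, 58, 91], [65, 106, 236, 120, 59, 60, 92], [66, 107, 237, 60, 118, 120, 93], [116,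
   67, 238, 62, 121, 61, 94], [117, 68, 239, 122, 62, 63, 95], [118, 69, 240, 63, 66, 122, 96],
   [119, 70, 241, 123, 64, 121, 97], [120, 71, 242, 65, 123, 66, 98], [113, 121, 243, 124, 67, 70,
   99], [114, 122, 244, 68, 124, 69, 100], [115, 123, 245, 70, 71, 124, 101], [77, 88, 246, 72,
   74, 125, 102], [78, 89, 247, 125, 126, 72, 103], [79, 90, 248, 127, 73, 126, 104], [80, 91,
   249, 75, 128, 74, 105], [81, 92, 250, 129, 75, 76, 106], [82, 93, 251, 76, 127, 129, 107],
   [125, 83, 252, 78, 130, 77, 108], [126, 84, 253, 131, 78, 79, 109], [127, 85, 254, 79, 82, 131,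
   110], [128, 86, 255, 132, 80, 130, 111], [129, 87, 256, 81, 132, 82, 112], [99, 130, 257, 133,
   83, 86, 113], [100, 131, 258, 84, 133, 85, 114], [101, 132, 259, 86, 87, 133, 115], [94, 125,
   260, 89, 134, 88, 116], [95, 126, 261, 135, 89, 90, 117], [96, 127, 262, 90, 93, 135, 118],
   [97, 128, 263, 136, 91, 134, 119], [98, 129, 264, 92, 136, 93, 120], [134, 99, 265, 137, 94,
   97, 121], [135, 100, 266, 95, 137, 96, 122], [136, 101, 267, 97, 98, 137, 123], [133, 137, 268,
   99, 100, 101, 124], [108, 116, 269, 103, 138, 102, 125], [109, 117, 270, 139, 103, 104, 126],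
   [110, 118, 271, 104, 107, 139, 127], [111, 119, 272, 140, 105, 138, 128], [112, 120, 273, 106,
   140, 107, 129], [138, 113, 274, 141, 108, 111, 130], [139, 114, 275, 109, 141, 110, 131], [140,
   115, 276, 111, 112, 141, 132], [124, 141, 277, 113, 114, 115, 133], [121, 138, 278, 142, 116,
   119, 134], [122, 139, 279, 117, 142, 118, 135], [123, 140, 280, 119, 120, 142, 136], [142, 124,
   281, 121, 122, 123, 137], [130, 134, 282, 143, 125, 128, 138], [131, 135, 283, 126, 143, 127,
   139], [132, 136, 284, 128, 129, 143, 140], [143, 133, 285, 130, 131, 132, 141], [137, 143, 286,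
   134, 135, 136, 142], [141, 142, 287, 138, 139, 140, 143]]

/-- Bit `y` of entry `x` is set when the points with positions `x ≠ y` in `pointCodes` are at
distance at most two. -/
def conflicts : List ℕ :=
  [1404946947507429257916750251176846774877290494,
   21475617626184990085298896696560372130527052797,
   342650949975423024569696311259242074607840672827,
   1144853356256966600217019168962948935120290105527,
   4481936867765089047116424051282049752131822620975,
   6771598978788625186304179317771402326542744068639,
   175381668328891453205569521283359958272073168062339,
   584603732435198564507467465015634841327511379430219,
   2291640677739040173134118598485938509050061198136019,
   3460848053406456508026560962374335115748336722026979,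
   41915889883816359783562270501021383520063976861349957,
   149657813602219567797140998433727039225470446087500941,
   586658541027590315742349571891994203085479710023691541,
   885974168053623489748386583627162565331192829928840741,
   4645564546013119251786244033761456772037618212630792329,
   6226138010829678671620528968619152410767380901357972137,
   13984771561097998508893445083330327595289116997327147281,
   37164516367034518244760482359297939699213824348758806801,
   74329032734069036489520964718595875266356976186577560097,
   686558014024194517967764131770808183865461701051434402886,
   2451992888773730113745919814342627947136051116758759112906,
   9611812079086043552675975736209949110986620400168422867282,
   14515797856630649284782403445133090397824280517185568768610,
   76109858729003943744582657935777681135332479027820761202826,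
   102002903574923004864635236245180380355431354315153041556138,
   229114214091369896821530334825094464936656996312676959322386,
   608878869832014422984348791967648749651026438280929255489810,
   1217757739664028845968697583935297228502669282884923125137954,
   4820912218477965457909449450269811466296025469970722548354060,
   19283452702509849733107588159228505019513200376754569061340180,
   28925277139465734977000320469051938110259356610337539573163044,
   155872990341012953426964849097236922179041698357973892800202764,
   208901945849450666235022624056788018773145448011005855111620652,
   469225909115188655911978702342763630794156339181241062635147284,
   1246983922728103353384161793233598214241427452560724895174103060,
   2493967845456206706768323586467195873885717305271086571116044324,
   3342456241998138687593272017214306479619845140129921919942213656,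
   9975921598638686171117798405011748664556300696701863060349927432,
   19951843197277372342235596810023494793811400936944924776560885800,
   26739649935985099270234714821394022509689031764714131133263183888,
   53479299871970198540469429642788041216426262844740058188733612080,
   67466490368231440377206500256976323178337056763417188463259418656,
   315936875103757296095916773305968541370032685597026615265165053120,
   1263747500218857700687328614066736386800583720243808829765681943872,
   1895621250426372269495135963384226844199522979845262562057005835840,
   10215292292634685037077619556445526822931867103099370709262588199104,
   13690597918481710195640563933019486041090114966887891063419306017472,
   30751189170357250178542295173560851417828155975657592090470819889472,
   81722338341077480156316799267797534435901192884031794775580477620544,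
   163444676682154960312633598535595059785282883332115238567261216440896,
   219049566695708888704118134418013893627700790296823401555328099238272,
   653778706728622894081922503326984681582966089084449441824464516956288,
   1307557413457245788163845006653969321627557309890277882426556164375168,
   1752396533565671104394923207150155059025818730710463026895927799644416,
   3504793067131342208789846414300310055744075159002994518181299089703680,
   4421431254216222991305348673739357189193281184537117955030722860548608,
   20705344354270298017626752138967127546032908032716044547691953845718016,
   27607196014959468478342924672902339246040335521737152001303993963817984,
   62116138376709500696230119556022676871608257119411725643540118064141312,
   165642754834162384105096152872692750250489505812892982872832409637884928,
   331285509668324768210192305745385498174830019002183186002274642647327744,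
   448613512592808665371494788991533436582615868639646325608714702420006912,
   1338938791380213412707799582300265263450350371225602661623036123065370624,
   2677877582760426825415599164600530516266876776171878395355847985016645632,
   3588908100742469321631024713674614733622005325651154684494756252112588800,
   7177816201484938643262049427349229451293274701883318907978885836143210496,
   9055091208634724296241710811603814490431917468326631907344262922389168128,
   14576703967286017043420460424157378876831763777573420679413471268206362624,
   29153407934572034086840920848314757732395879622588185178756740726780903424,
   30037262832689918937128974665524151785547015175990831673556732663231184896,
   74209302183606912412844614721574764744180885075920371857654360228524916736,
   63609945257851377054730806715197884158828952723389061370930156888968790016,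
   339234636542763690769311997369585907226653472128282610575720699909304221696,
   452312848793894187646201058490328905232191624527521307301573339287209377792,
   1017703909733604971601095440104869499870262658029683921090673863068754640896,
   2713877092342109525566017691264185936203622518600542025869908229615964913664,
   5427754184684219051132035382528371871216256752977799287947010847131384152064,
   7350083792848072173491943103587316445863978020681023005388398429587635175424,
   21937173163028406553895333317907611274645732069923388727510239500577325187072,
   43874346326056813107790666635815222543846946269111765666383944126133886255104,
   58800670342784577365965688754845148889403172781170080372671356121178248839168,
   117601340685569154731931377509690297770639568756237638528916086374965943730176,
   148358614443151162871076109321317941592750804940442503784868724105818444660736,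
   238821184267647517482760138174479409760213687756267683405664780537528380817408,
   477642368535295034965520276348958819509538339771065190909403219881739155406848,
   492116380121325288839358379260287360920621210060211559326758439783022194589696,
   1215816938717282966918920684278960261996292401221982716174892726150069074526208,
   1042128806586771589558458570583160767505270157767921949029589794824729923682304,
   1852786512910951349621500516196450129788776272554422749729739328377164320997376,
   5558246453618961811557694394200994305374034158544201181640783309069480299069440,
   11116492907237923623115388788401988610660956031156649544275178430918078136057856,
   14822292103287610751977738890319873323069937380433989444543415852599836858646528,
   29644584206575221503955477780639746646009206331970340376026954784016287609651200,
   37057087279585733435163309023323726166803721089782974552322895840934361558941696,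
   61138223559014720823516729371686741294418954759957711651826377404675016945041408,
   122276447118029441647033458743373482588663684948051605704750078519078977743618048,
   125981794857047100414458646828755079151588006484757667047232530227044471416029184,
   311249139403600089594776523339546282813959436161697941739883161401521168281763840,
   266784980670164828493847538053609354857337753036397236647860706798328916429766656,
   533801545518804208748818909338140019936576318705831378403501990399894437270388736,
   593318693521561241550581688371749357586713263969529289255299908083751732306247680,
   712352989527075386138325997856858056325507917249749825731309678590193804251234304,
   948568908117212061628072902925553967510422540360818689469329021375724440411701248,
   2845706611266517448355414298027598994892932133831022124852089867594086482020663296,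
   5691413222533034896710828596055197989784470471087257780215455662818689319094452224,
   7588551264937693544280416503803204198377559832682944015780811726747257938863194112,
   15177102529875387088560833007606408396753028970503556209256509957412099810805153792,
   18971379519365639532209610511088786366520622081270024287527466654190747480219451392,
   31302777473064914127842037163103497636670326639406569492348575725210057568694566912,
   62605554946129828255684074326206995273337865685658454878499583084734040461287620608,
   64502707010205703924974965516098408715142291496115313507396100114676779204221075456,
   159359615461438208903493186121195943010449055912502190556678366905348026668305874944,
   136594022276714425248073487080246167191227932287530726157040438097747264324872699904,
   273188044567558342864827287271758959653436930138154909816557710348417732423188480000,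
   303542477606897963709841789729157767943121853006717918201512681468208565523650183168,
   364251343685582381709630887566795960589388406512941061748671671038249737919366430720,
   486617644525354576067137115124589165651039855962024384105707087342255769017305268224,
   973235289050709152134274230249178331302074136736502984309580432123591653666955722752,
   975136131988719410721140480617495643423633186912412805707342925069117555666178801664,
   2435939487033429377405951841858475189132677149000898871286897456997573645592258674688,
   1957875635728486004315808121522869930489329107670697741466667978718895578119397179392,
   4371064293075690097874824598075470787536857296562757606921080540245044566611038568448,
   4856790801694621512716390229515153869286666410022008462363560074591969554239131222016,
   5828243818943085424788191798372019817790742148037468919098819209388255416675297394688,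
   4128645680476133758467901021211237922327293511641064987143429265765264812840895643648,
   7771625997947616388779596303192206620102933114497324930687928610855165277422873477120,
   15543251995895232777559192606384413240205855077984021158087526801800801461642912071680,
   15545152856698510079262288288420620188413566390652935279743157482550842882755030679552,
   38860981275062930864870161990162129440353755117092629069268661351212978831036719824896,
   31097909140326866816339369323546398402811229836510152971231313525742384822126186070016,
   69966434618284502240456496010841447206805712014373155958662487104475478441211635695616,
   77767464598501607283503064435652050644538460330232240196536617564743607814627396681728,
   93369524732623951225570494420629735033035818742876240559954054410688986934338668986368,
   62408714068238311772850904633453930583188610765926525466404564619534108776747801509888,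
   132587227854016548769677473003271331077611835891066859649839914323376632536304197828608,
   140843624373505303435799862644208330462031309202218342522896278661493542421261650493440,
   157356461876645079897463684577340572567026871481218260818206318768371118365791234293760,
   128217036170143461269065338875517114561531181379857752387093603527692845383296103743488,
   256956852317448985494288142811287213428444819588307418910804816787721051664732188049408,
   265240703604464264779610242827053712750567933972560928883316903472687586824144602267648,
   281831171829575593612804280302807299507001378447235939637015840652873173440666636648448,
   311282335777732056598110653976174787306529427536386366003257690709599398945519824797696,
   380277435653186465632484668260703825975251155448279590919184954447214108777545230974976,
   489552560840883725871704400519526764473886534591469223324903180714130094369964323504128,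
   8787251833557815558951885213844724477647487238207,
   4489751249589360964240826440786250190094375158023107,
   1185289816755980996726189288935048904700106907425192965,
   9195535560804791600459780792757814630503237625913067657,
   24521428161023640092900040749230207861618666139967230225,
   24522927667055720446941467283837147153432439888191726113,
   19419783645848713895530877021231940577310096200527599108162,
   150650442211593271701085432180836865659792603666648948277386,
   401734512564260090482697336923159444463859902892644776280338,
   401734514063755418205356083650586114258380845452870182502946,
   38566513098133904972811340672381316666417250735510859614258180,
   313352918780160871393367066830584034361976965000412101995399180,
   835607783409771655524177989765261261208057116986651565740789780,
   848463288158939993014148324618069517235121782570931373287153700,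
   6582068449163886149791063501286635656312752376063556570497171464,
   6582118669042947031803120927166515892682079067300351643398209576,
   29619308021237390835928256521970788096667358655675154809730695184,
   401759032495831194386831655411230702860916025482309447843856,
   401759033989491933541708438144891099612327431926668647989280,
   2527495000633850908748118417477081741514003242855393905914199671872,
   20535896877820644271479437571689089545625038296897059400035567927488,
   54762391674122998352764434068731998719054721841432919245717329936704,
   55604890013944716964197240433318126637770873949321809778767839625792,
   431359146724630115963360246748107995812351429949067848108496035790976,
   431359146774849994650828590467488180091546324516748774542491584070272,
   1941116160260835520151274888400557955778798427017974876585757448929536,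
   401759033989485890039759636346019743432675571520440306368768,
   401759032495837282490270854271348342112004513089479682294272,
   41410478085564197001057008628391286053541369301081436876601861230038016,
   110427941561504525360097258312288229250295950690725115646494591321904128,
   110427941574360030085320535663933717054119809879170290204463404511405056,
   897227025187224265345119957688792443411894911682944695365122566295406592,
   911030517985256365748933351671515003495274354192781503461144156868487168,
   4037521613341705724572957339890312820647518228656159429995469646495551488,
   110427942384256804391851520357267195117275276887483097731018787553153024,
   110427942397112308374772270101997767153774794799997316957999468189589504,
   14134992201091446077094805050364099612001468820313125202261554060438093824,
   431365728742862465591535534328813956458591886351721826782802274697216,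
   431365728793076214670984833649471854409821496858484065926868241514496,
   14136501981142046063541313034378706660717520194766577222978336059788820480,
   401734515563250679025779234786143359448145064813091126378496,
   84812972766650177684235797939410550183967199773748015233576219254456582144,
   678469273190836459919570974533066276861632838318755209786355174235484717056,
   1809251395175563893511174786653933834181055919138391794718838384507226685440,
   1809251396018062232940574633161177440205233763939894073777643646370592587776,
   14700167585801456582256607513391867126311572379531825105914721179255457185792,
   14926324016938388734114849011928297400296594741159127387415278543875798466560,
   66150754136053898466817356943606933316212763336140543027964289801328416260096,
   1809251449095457233893396670451797899539014924515632426556869211378876940288,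
   1809251449937955561160911904647347525631350761852284660639552881898404446208,
   231584178690315255394330519564461236623418946349551053561405482564677233803264,
   431365728793076214483549924751207378824975930664369942774620939616256,
   431365728742862465778975795405926079392991509066232761874721127006208,
   231584180200095305642820723828363250899680471559676360796871788817243361509376,
   24524427173020898565387301949176639646996185842832113664,
   1389505075161451632009296075349971215373150484894698193672318200748159843434496,
   3705346869397611053193310070117724992120760276096280226932644911258929511530496,
   3705346883201103848011534481194109727877449822190087038109100877871059780501504,
   16674060912289249724907452866315003455685296752960432676782459401656417904492544,
   110427942397112308362799580091890779767653432714194023181837471754223616,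
   110427942384256804403824255860894387505867869989185545621575414082174976,
   61138223565916464142836017966745760643679457616275976169995797470883290229506048,
   3705347752821143543622571644096552016216251654369238660467175381921097433743360,
   3705347766624636135966602478540162033685717565476617284448231824645285446942720,
   74106940700790465460028369656518901937892768079662019530646943724280317810311168,
   110427941587215534810543790090413140768463401433307329842868714995712000,
   392766775748067741865972470263869074745749181601708170753720244719781812497285120,
   231598313466856519357010833489941449839276971158348155003360993183689284255744,
   431359146825069873338293901285521364207301254251338238374221583482880,
   474747594143412208641088484682389930373116108898918007669352359285857357626605568,
   231598314976590495829413741166317247753231098256637214364400803107740053405696,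
   475210790772502625264869127666527715620318945245581471665463059912708035901915136,
   1897137816220619788064232212536199762729552285782920957720616818306032145216307200,
   1897138042377050714371802302938758749993961862411778819751561340616264717321633792,
   8537120172992788098478419105720539191859309361038337186899959147115119909850316800,
   1809251449937955560964752440339047208127106467302001144552861488404718682112,
   1809251449095457234089556158141269918952294355646118679564610437127650410496,
   31302777586142927865301133833245666499990200089111062628459893865564792337758945280,
   1897152290231781087263035179932373202136891080834999000621216109780092412825174016,
   1897152516388198744221855032129408251729812514990363308133813865018859797860057088,
   37942810601954090532268732106397267188077093843934099842354713528697237909574516736,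
   1809251396860560572369974467974980699889487576657358659085907954955857166336,
   201096732905418321168272810398852866701787332450931135611909652983122378998985785344,
   231598314976590495653644165853531461819911887885500072268874111488081610670080,
   6582168888922007910782277006067649606363347345693152144368074752,
   242834074724846087052506817168738010611836070636416217374889198707272795497386999808,
   231598313466856519532780410296381909124779029157899266312359243726138399260672,
   242834537921470001238354723640299462353625086466451028651070455828621723277704822784,
   485669075730356990526019024204120053681739054658068167460707032711231992564042170368,
   3705347766624636134359664392376951140665940660923480246393496133293796591927296,
   3705347752821143545229509742232292978398452831135567097886655938045427350241280,
   485682044447395240079201056906613767884404188630147651428110668072288274812762062848,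
   861318792908108307578952596710706314138558739222589852746776576,
   2914040391815983782887265829155718833639992866736658754111483566135196661281108000768,
   485728361283090166557004103426526193264721929269037000776277273256555684199095336960,
   3705346897004596642829758886284138085200599907670927588748964633117537637236736,
   4856798212364701121463131952207339027282480963439659960704114673913958204231884210176,
   485741329994041075832316858868502452796858726802688395238772038627880588915647709184,
   5828273461652777692222162814948119152597405203725914521782928842068842794099897532416,
   231584180415778169964033609402027484416988571754641239386880165607059268567040,
   243308359150629099070535063266223938765703635907838846837134493953137944281416204288,
   243308822290719083493234764113960446550615967005796530773055378810382277717520285696,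
   7771624145839579656240795014729711270152519243428550385330799045562337711283830259712,
   1897152516388198638909562677014195861867379119937701910386724665865569568968146944,
   1897152290231781192575327731206968054780704139677439476623003672851404316657844224,
   7778264177272295896046236921209847950842227549584046329237253992863184809818067042304,
   56447388353766435563936606452244890065952958742389993038503263338496,
   46643024934058251242010314582014567625768389057055676666226536723229054403178710171648,
   7801978397148098228857781758508588667245266931630093628623653283270190739175839367168,
   1897138268533481640679372295261579737815290016989886467063265852667705176912560128,
   77771258486501937381158462230725893385770850051319079718006705528264214126886888931328,
   7808618328845831356052985028670748025998710861800298668563744470022397666244920606720,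
   93384700765886142185268162824334334904320356943309344258808912927015107648621075496960,
   14136717664006417490175778710326569164655511996497696962261809901040828416,
   243308822290716495298863411696813485692877693832826949683770364310031458927244214272,
   243308359150631687264908022523335443998300593994328816579740867043570118699681579008,
   485741329993992763607535798552061869702595341663644349786471252211336189428853899264,
   924834010783288466146760389275847660014686461064706360146041064801697792,
   125302291762435736541984956347905883014687784100682850866982747147940072678196611383296,
   485728361283138478781798019246937724395973308925526013253021744612950613031928201216,
   126273722547572147065713614865365919588850550240451208329748329051466122894441476784128,
   485683897121257847158220633826029986295360428389334629415884773865597224234321444864,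
   129187725885905219275015375274571250144124339008659308573288884060929304757200601743360,
   130158963993005138904594848969912232261608437306667078852143576612309211034858326851584,
   242835001118095640834460451317606489307054135318221932452444048164601683889050615808,
   7808618328054283847863564678796298804430577235730026198900698713125035842791087800320,
   15152480448075320885875010772465285287035761080562254413630083327110840057856,
   264278854878868246392714577440215763723019584257120917397212662673269194387080788049920,
   7801978397939645737889700435454393647010066097862773436297756503410775324532234256384,
   279869531680859814790248733724960094642413737918048042177019461547406311997692002172928,
   7779212753191255358454336595179945005027176523402873631090688643072066236035377397760,
   326493585003814742775662541814059716363794076137667459783420016420417910437807189393408,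
   341985610651122973368814069173848165463710295078509829222604035300146094957276296118272,
   475673987399867631629221528781116683538043501159358316713072582570440151112089600,
   75959614577201037070342381815031446989750416545548334762039315336321130125328384,
   130158941760918925654572444284778237407173344673213515485288532340862542614717202956288,
   129187748117991874236800683546672998410850320325997524308719619163441386695795683622912,
   127245168154092225415900988028654351561834293545337917245340646299751392400045984710656,
   38891386747069970492014933475496452801374251214376732310663130989346048106488135680,
   341974227742357023990378348322443666753954200815291142393403835653528521665423320547328,
   326504967919817697515750951542232283279257060803061789893567929128155865538628539121664,
   295467796971697092426802153670403309968003463952056517239339320010674850488953125994496,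
   6799733889556744724752993426663465642631879280700445319242846350839447460322580889600,
   108990554549187631957346764206065587096295210334664624623813232038578193373620728758272]

/-- The points of `H` on whose covering codeword the exhaustive search branches, in preorder. -/
def branchPoints : List ℕ :=
  [18, 112, 81, 48, 75, 65, 76, 60, 76, 22, 44, 6, 75, 105, 65, 74, 76, 60, 22, 60, 59, 92, 76,
   44, 19, 82, 110, 132, 71, 131, 41, 118, 69, 40, 142, 136, 123, 118, 66, 127, 139, 66, 85, 69,
   41, 123, 136, 137, 132, 111, 71, 127, 41, 22, 76, 98, 41, 66, 22, 60, 92, 41, 71, 87, 76, 6,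
   73, 46, 19, 82, 110, 81, 22, 48, 140, 139, 143, 128, 111, 80, 132, 131, 132, 111, 80, 119, 136,
   120, 134, 136, 120, 118, 135, 122, 96, 58, 91, 75, 106, 22, 6, 132, 131, 139, 140, 141, 111,
   105, 128, 140, 105, 128, 86, 136, 87, 115, 113, 114, 115, 47, 99, 136, 142, 114, 69, 124, 53,
   140, 132, 71, 124, 41, 137, 98, 122, 135, 81, 143, 106, 115, 133, 71, 132, 130, 108, 80, 47,
   74, 77, 102, 78, 45, 126, 103, 81, 48, 80, 125, 136, 74, 135, 142, 51, 113, 83, 7, 23, 14, 116,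
   88, 52, 84, 126, 136, 143, 142, 118, 66, 104, 103, 44, 73, 52, 51, 7, 79, 41, 69, 71, 107, 129,
   132, 98, 41, 71, 140, 133, 136, 98, 87, 115, 141, 130, 111, 81, 106, 106, 81, 111, 76, 138,
   105, 123, 137, 84, 52, 37, 24, 81, 111, 47, 80, 81, 76, 106, 21, 47, 80, 91, 26, 17, 65, 35,
   119, 58, 134, 106, 76, 43, 105, 47, 17, 74, 4, 28, 57, 31, 56, 133, 41, 71, 87, 115, 87, 35,
   120, 66, 123, 136, 124, 65, 13, 34, 65, 13, 66, 34, 123, 136, 69, 119, 96, 82, 107, 5, 0, 34,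
   17, 4, 75, 48, 92, 13, 120, 123, 66, 30, 44, 5, 0, 136, 123, 137, 142, 119, 97, 70, 86, 134,
   138, 128, 120, 97, 65, 34, 138, 105, 81, 65, 34, 29, 10, 44, 6, 48, 75, 59, 8, 0, 143, 139,
   123, 66, 93, 66, 82, 110, 90, 57, 89, 117, 138, 128, 81, 76, 106, 29, 34, 128, 130, 105, 123,
   120, 97, 121, 81, 65, 92, 81, 76, 139, 106, 29, 34, 71, 41, 133, 101, 41, 40, 26, 5, 17, 4, 69,
   71, 100, 64, 120, 136, 97, 140, 65, 34, 33, 97, 136, 120, 75, 48, 97, 121, 133, 85, 17, 106,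
   75, 48, 5, 17, 106, 75, 48, 71, 69, 101, 76, 22, 5, 1, 44, 65, 92, 30, 13, 29, 75, 60, 1, 5, 0,
   8, 69, 71, 100, 86, 53, 71, 101, 21, 43, 65, 60, 5, 0, 32, 57, 28, 42, 46, 85, 69, 71, 100, 71,
   101, 133, 115, 69, 71, 107, 127, 110, 71, 101, 124, 115, 122, 66, 96, 66, 96, 24, 52, 84, 68,
   7, 90, 57, 32, 133, 115, 86, 113, 140, 53, 83, 23, 7, 1, 26, 98, 137, 122, 97, 121, 122, 127,
   107, 66, 76, 44, 106, 124, 101, 141, 122, 137, 124, 71, 110, 131, 15, 7, 52, 23, 5, 0, 1, 133,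
   14, 37, 78, 72, 68, 52, 84, 52, 84, 63, 95, 68, 127, 131, 67, 36, 89, 56, 50, 77, 125, 80, 26,
   17, 40, 133, 114, 23, 50, 83, 31, 133, 95, 62, 67, 31, 56, 1, 26, 5, 76, 22, 133, 115, 86, 113,
   53, 124, 101, 22, 5, 0, 15, 32, 57, 95, 28, 40, 6, 21, 26, 43, 29, 2, 76, 5, 40, 0, 44, 6, 19,
   71, 40, 17, 26, 106, 27, 49, 5, 41, 69, 101, 120, 85, 27, 26, 106, 27, 49, 5, 49, 81, 48, 41,
   69, 101, 120, 85, 27, 41, 69, 101, 120, 100, 93, 118, 81, 106, 140, 132, 141, 122, 110, 107,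
   85, 96, 118, 98, 81, 76, 49, 101, 120, 70, 85, 93, 5, 27, 93, 63, 95, 32, 5, 49, 81, 93, 98,
   120, 27, 0, 24, 15, 1, 41, 69, 40, 5, 17, 115, 114, 133, 86, 113, 39, 70, 124, 100, 101, 39,
   70, 111, 123, 98, 81, 106, 130, 132, 112, 136, 98, 47, 80, 26, 54, 5, 0, 101, 100, 114, 133,
   115, 70, 86, 53, 115, 86, 53, 97, 98, 123, 121, 123, 122, 16, 64, 33, 115, 101, 120, 93, 63,
   95, 142, 143, 139, 131, 133, 123, 98, 137, 101, 99, 67, 39, 16, 25, 50, 36, 37, 14, 38, 93,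
   118, 120, 17, 40, 39, 83, 133, 132, 51, 84, 62, 94, 121, 11, 31, 56, 95, 63, 84, 133, 132, 141,
   120, 112, 129, 51, 50, 23, 52, 52, 24, 63, 95, 62, 55, 87, 101, 120, 93, 115, 137, 98, 93, 98,
   123, 124, 99, 70, 40, 54, 95, 118, 120, 139, 127, 63, 62, 32, 137, 98, 93, 98, 123, 98, 76,
   112, 87, 41, 55, 106, 44, 107, 75, 140, 118, 132, 111, 127, 41, 55, 22, 82, 41, 55, 75, 59, 29,
   17, 26, 81, 44, 112, 140, 107, 22, 9, 5, 41, 69, 49, 132, 140, 143, 141, 111, 128, 119, 97, 64,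
   59, 29, 75, 106, 113, 53, 75, 21, 21, 75, 81, 17, 6, 9, 0, 12, 10, 133, 114, 140, 107, 41, 82,
   107, 41, 69, 79, 109, 118, 96, 113, 86, 40, 17, 21, 75, 54, 86, 99, 53, 75, 106, 81, 106, 40,
   17, 21, 75, 54, 120, 93, 136, 137, 120, 54, 17, 26, 27, 8, 27, 9, 5, 0, 26, 27, 76, 49, 48, 81,
   21, 6, 9, 115, 55, 124, 70, 39, 136, 16, 119, 93, 63, 99, 132, 141, 99, 132, 141, 133, 123,
   136, 137, 142, 55, 69, 85, 81, 93, 118, 96, 123, 93, 136, 118, 96, 122, 139, 110, 136, 142,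
   136, 93, 134, 97, 119, 63, 95, 62, 32, 95, 62, 32, 93, 118, 135, 96, 63, 32, 95, 11, 99, 143,
   132, 139, 131, 67, 36, 70, 64, 58, 59, 88, 116, 95, 62, 34, 92, 59, 30, 105, 17, 54, 138, 132,
   140, 57, 117, 95, 126, 79, 117, 116, 32, 95, 68, 88, 58, 36, 78, 79, 132, 143, 141, 131, 85,
   69, 100, 55, 118, 93, 112, 129, 133, 124, 115, 93, 118, 96, 143, 141, 139, 138, 108, 105, 125,
   74, 54, 26, 17, 97, 33, 93, 55, 69, 85, 133, 115, 93, 118, 96, 138, 128, 111, 92, 59, 34, 128,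
   105, 86, 113, 134, 97, 74, 59, 92, 111, 54, 17, 26, 92, 59, 34, 9, 27, 54, 40, 81, 76, 55, 71,
   41, 17, 101, 124, 112, 52, 82, 110, 5, 15, 52, 7, 14, 42, 45, 28, 57, 73, 17, 41, 69, 13, 60,
   114, 52, 24, 0, 0, 24, 5, 10, 1, 4, 8, 7, 24, 41, 69, 5, 5, 15, 52, 7, 14, 42, 45, 28, 57, 73,
   82, 41, 71, 60, 35, 92, 106, 43, 48, 98, 66, 112, 132, 141, 48, 21, 143, 133, 139, 127, 79,
   109, 20, 77, 47, 17, 0, 127, 41, 71, 98, 66, 65, 60, 41, 71, 98, 66, 0, 57, 63, 118, 135, 24,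
   38, 7, 16, 36, 20, 72, 129, 107, 5, 0, 40, 41, 55, 76, 44, 22, 3, 14, 68, 84, 95, 37, 23, 36,
   50, 25, 23, 50, 25, 61, 31, 11, 94, 31, 95, 64, 33, 25, 22, 6, 20, 11, 28, 53, 50, 86, 64, 33,
   61, 50, 83, 54, 27, 13, 11, 32, 31, 42, 20, 28, 56, 14, 68, 37, 109, 45, 126, 79, 6, 22, 21,
   42, 20, 28, 73, 32, 43, 17, 26, 8, 54, 40, 17, 59, 12, 22, 76, 49, 12, 6, 21, 65, 40, 48, 75,
   60, 22, 44, 20, 42, 11, 28, 17, 54, 27, 17, 40, 59, 29, 6, 44, 22, 65, 35, 40, 10, 22, 21, 75,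
   48, 35, 44, 22, 32, 63, 31, 69, 71, 38, 37, 100, 54, 27, 5, 3, 15, 24, 14, 42, 57, 28, 23, 17,
   4, 40, 41, 85, 27, 27, 54, 44, 76, 15, 38, 68, 69, 41, 100, 27, 54, 41, 40, 101, 129, 70, 16,
   67, 99, 41, 4, 71, 17, 101, 24, 52, 27, 4, 17, 16, 50, 25, 33, 21, 19, 61, 50, 67, 124, 71,
   101, 11, 44, 19, 76, 20, 46, 22, 27, 49, 54, 27, 41, 55, 57, 28, 13, 46, 42, 20, 79, 104, 45,
   52, 84, 68, 118, 95, 63, 45, 23, 51, 56, 11, 11, 63, 28, 31, 56, 95, 90, 56, 68, 14, 42, 20,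
   69, 31, 42, 20, 56, 28, 68, 37, 114, 69, 100, 67, 50, 36, 17, 58, 113, 71, 41, 40, 67, 50, 36,
   17, 70, 51, 63, 95, 118, 96, 127, 139, 107, 2, 12, 17, 11, 31, 56, 20, 88, 116, 91, 47, 21, 43,
   35, 40, 22, 21, 75, 43, 17, 10, 65, 30, 35, 40, 71, 101, 123, 69, 82, 107, 40, 41, 101, 69, 46,
   20, 36, 25, 40, 41, 71, 101, 17, 85, 133, 124, 69, 100, 52, 38, 15, 69, 124, 38, 15, 79, 82,
   110, 109, 46, 78, 50, 25, 20, 46, 85, 17, 4, 26, 8, 69, 93, 120, 97, 64, 96, 122, 66, 87, 54,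
   55, 100, 38, 68, 3, 0, 0, 3, 15, 46, 13, 63, 32, 79, 20, 109, 66, 76, 49, 82, 55, 71, 87, 93,
   120, 118, 122, 54, 65, 35, 59, 17, 34, 17, 34, 0, 2, 13, 35, 13, 35, 0, 3, 15, 14, 6, 37, 49,
   81, 65, 35, 44, 20, 28, 32, 16, 4, 39, 70, 4, 7, 23, 66, 65, 35, 96, 122, 95, 32, 118, 93, 81,
   49, 16, 4, 39, 70, 50, 25, 65, 81, 13, 35, 13, 35, 54, 0, 55, 87, 71, 41, 15, 3, 7, 44, 52, 19,
   33, 64, 97, 61, 15, 3, 68, 38, 87, 55, 41, 65, 92, 13, 6, 2, 12, 59, 65, 35, 65, 2, 35, 0, 3,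
   15, 14, 16, 53, 25, 7, 23, 8, 81, 65, 59, 44, 19, 49, 65, 59, 48, 33, 49, 75, 81, 81, 59, 65,
   64, 65, 61, 97, 88, 56, 89, 28, 91, 81, 58, 94, 13, 65, 12, 59, 81, 49, 65, 81, 49, 65, 98,
   123, 136, 112, 93, 107, 93, 96, 118, 122, 136, 112, 119, 93, 107, 96, 107, 140, 129, 93, 118,
   135, 35, 13, 30, 49, 10, 29, 5, 40, 9, 129, 112, 48, 28, 12, 2, 34, 54, 27, 44, 87, 9, 43, 75,
   21, 44, 49, 34, 64, 54, 30, 27, 96, 93, 118, 81, 119, 75, 48, 96, 107, 129, 76, 27, 40, 54, 93,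
   122, 63, 90, 118, 35, 13, 98, 96, 123, 59, 10, 29, 91, 97, 64, 12, 2, 34, 97, 64, 105, 75, 106,
   74, 75, 106, 17, 26, 47, 17, 4, 31, 28, 136, 120, 96, 122, 34, 2, 10, 59, 12, 64, 119, 91, 59,
   120, 119, 91, 39, 75, 17, 40, 16, 17, 0, 99, 70, 59, 34, 54, 27, 15, 3, 38, 68, 7, 44, 19, 98,
   17, 120, 4, 40, 34, 33, 61, 97, 121, 134, 88, 94, 31, 56, 28, 98, 123, 97, 88, 75, 56, 28, 14,
   36, 16, 68, 37, 51, 3, 15, 28, 75, 43, 81, 106, 56, 89, 57, 57, 118, 120, 81, 49, 60, 92, 34,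
   81, 54, 27, 59, 112, 82, 132, 40, 27, 105, 75, 81, 48, 105, 128, 74, 75, 81, 48, 12, 33, 64,
   98, 120, 120, 98, 64, 58, 119, 93, 48, 21, 3, 73, 42, 15, 23, 14, 98, 64, 97, 121, 98, 120, 93,
   137, 97, 121, 128, 105, 74, 138, 105, 17, 74, 138, 120, 93, 142, 119, 134, 121, 115, 133, 38,
   68, 37, 126, 78, 104, 4, 17, 40, 17, 40, 40, 82, 106, 49, 48, 75, 112, 132, 110, 112, 110, 49,
   132, 48, 105, 75, 9, 22, 35, 60, 127, 139, 76, 85, 114, 132, 115, 133, 136, 98, 129, 110, 106,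
   76, 49, 127, 118, 96, 122, 119, 97, 133, 85, 75, 48, 21, 43, 105, 80, 53, 39, 74, 58, 91, 132,
   112, 58, 119, 98, 132, 112, 143, 132, 139, 118, 122, 123, 136, 124, 114, 29, 10, 21, 22, 76,
   49, 35, 13, 73, 42, 21, 22, 58, 91, 98, 123, 120, 132, 143, 91, 33, 119, 132, 112, 98, 97, 112,
   129, 98, 123, 120, 132, 143, 54, 27, 26, 4, 120, 54, 17, 27, 26, 9, 5, 48, 75, 6, 0, 26, 8, 26,
   27, 76, 49, 87, 101, 115, 60, 13, 30, 81, 49, 59, 75, 43, 59, 30, 75, 43, 93, 136, 96, 12, 59,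
   29, 2, 136, 123, 93, 63, 32, 118, 93, 0, 4, 5, 81, 49, 59, 29, 105, 47, 42, 111, 91, 97, 119,
   123, 136, 93, 142, 93, 118, 122, 96, 136, 93, 87, 101, 115, 93, 118, 135, 96, 140, 101, 87,
   143, 129, 64, 97, 121, 33, 134, 111, 105, 80, 122, 96, 63, 95, 85, 32, 62, 126, 61, 33, 12, 59,
   13, 73, 72, 143, 124, 101, 129, 86, 101, 124, 111, 139, 131, 118, 135, 100, 124, 101, 124, 101,
   91, 33, 97, 61, 59, 12, 29, 122, 58, 88, 13, 2, 97, 121, 97, 121, 128, 134, 138, 105, 80, 89,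
   56, 117, 28, 13, 10, 31, 13, 2, 122, 96, 61, 31, 62, 122, 102, 125, 138, 89, 56, 77, 102, 12,
   59, 17, 54, 122, 96, 63, 95, 32, 118, 135, 17, 59, 29, 105, 47, 111, 138, 4, 43, 75, 21, 54,
   59, 60, 29, 105, 26, 47, 111, 11, 2, 12, 29, 6, 44, 30, 30, 35, 65, 60, 29, 58, 91, 88, 4, 116,
   6, 44, 30, 35, 44, 43, 19, 32, 63, 31, 7, 90, 24, 32, 63, 31, 95, 7, 24, 38, 68, 19, 44, 65,
   35, 68, 46, 104, 90, 38, 68, 3, 46, 45, 36, 16, 25, 31, 7, 61, 90, 24, 35, 30, 20, 24, 46, 35,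
   44, 19, 24, 7, 3, 30, 65, 93, 66, 60, 32, 63, 2, 35, 12, 56, 117, 95, 31, 62, 88, 116, 91, 136,
   123, 137, 31, 95, 33, 61, 102, 42, 72, 125, 74, 47, 17, 4, 105, 74, 29, 10, 35, 65, 31, 95,
   117, 56, 62, 61, 58, 88, 56, 58, 88, 36, 14, 3, 67, 16, 68, 14, 16, 39, 56, 31, 7, 51, 24, 69,
   78, 20, 77, 47, 74, 16, 25, 89, 14, 37, 3, 31, 94, 121, 33, 64, 91, 97, 119, 137, 123, 135,
   142, 12, 2, 33, 134, 135, 142, 124, 67, 99, 71, 101, 69, 100, 135, 89, 72, 103, 42, 20, 118,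
   142, 93, 69, 124, 55, 136, 142, 57, 28, 31, 20, 7, 24, 56, 37, 20, 72, 14, 3, 62, 94, 61, 2,
   10, 100, 69, 124, 41, 69, 124, 41, 37, 14, 3, 14, 3, 3, 22, 42, 28, 57, 32, 6, 49, 46, 21, 45,
   50, 36, 16, 58, 88, 76, 28, 57, 32, 21, 8, 26, 75, 16, 50, 36, 19, 49, 42, 45, 46, 44, 76, 54,
   27, 45, 72, 78, 103, 88, 116, 94, 108, 77, 102, 77, 102, 21, 6, 44, 28, 2, 10, 6, 48, 75, 58,
   74, 105, 64, 58, 64, 88, 67, 36, 83, 12, 2, 50, 16, 26, 36, 113, 54, 83, 67, 48, 21, 6, 21, 6,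
   7, 24, 37, 23, 7, 10, 12, 29, 59, 30, 43, 19, 60, 65, 35, 29, 30, 44, 22, 43, 19, 75, 4, 1, 56,
   57, 62, 61, 33, 50, 64, 23, 24, 69, 94, 77, 102, 94, 102, 74, 105, 108, 89, 88, 14, 37, 51, 57,
   63, 90, 24, 38, 52, 14, 24, 23, 52, 38, 68, 57, 56, 109, 104, 37, 23, 51, 23, 24, 83, 50, 36,
   69, 100, 124, 41, 100, 124, 41, 24, 52, 38, 84, 69, 41, 100, 71, 94, 95, 90, 121, 123, 97, 61,
   16, 33, 61, 4, 100, 124, 1, 26, 27, 47, 56, 16, 57, 45, 109, 108, 56, 111, 105, 74, 55, 114,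
   100, 41, 4, 127, 131, 41, 100, 114, 122, 118, 135, 72, 78, 103, 126, 90, 95, 57, 20, 63, 52,
   24, 42, 20, 42, 20, 89, 56, 62, 20, 42, 77, 24, 38, 52, 78, 103, 126, 109, 20, 42, 73, 20, 42,
   46, 56, 57, 24, 38, 52, 77, 108, 47, 56, 88, 116, 83, 36, 86, 99, 102, 74, 29, 10, 1, 4, 8, 66,
   35, 13, 30, 49, 106, 92, 92, 34, 59, 12, 30, 57, 28, 90, 117, 5, 9, 42, 20, 34, 106, 44, 76,
   98, 123, 136, 92, 98, 123, 136, 112, 142, 135, 101, 124, 41, 76, 81, 106, 122, 96, 96, 55, 87,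
   140, 76, 101, 124, 139, 122, 127, 110, 124, 140, 112, 96, 63, 55, 136, 87, 34, 92, 59, 64, 57,
   82, 112, 87, 34, 106, 76, 87, 41, 55, 92, 12, 64, 91, 29, 98, 123, 35, 34, 13, 118, 142, 137,
   122, 96, 90, 63, 32, 96, 137, 63, 32, 104, 69, 41, 127, 107, 126, 127, 143, 91, 73, 103, 42,
   73, 30, 60, 34, 12, 96, 137, 142, 118, 122, 63, 95, 11, 57, 90, 118, 57, 90, 38, 69, 41, 68,
   69, 124, 11, 3, 15, 118, 96, 55, 87, 112, 140, 141, 69, 41, 100, 96, 95, 62, 32, 11, 28, 31,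
   56, 94, 116, 134, 13, 35, 32, 89, 135, 127, 139, 143, 67, 68, 37, 16, 36, 50, 97, 64, 138, 12,
   34, 134, 135, 127, 139, 140, 112, 119, 116, 59, 91, 12, 29, 26, 4, 97, 88, 116, 120, 93, 96,
   82, 87, 55, 118, 100, 69, 41, 69, 41, 122, 95, 63, 35, 60, 99, 132, 141, 70, 39, 67, 100, 69,
   41, 69, 41, 41, 81, 93, 98, 120, 49, 48, 112, 22, 110, 132, 98, 93, 75, 26, 8, 22, 9, 1, 13,
   30, 76, 48, 107, 112, 110, 75, 59, 26, 8, 59, 34, 12, 29, 91, 64, 39, 86, 124, 101, 98, 123,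
   74, 128, 98, 120, 142, 123, 120, 132, 135, 127, 139, 133, 100, 43, 19, 13, 12, 106, 93, 98,
   134, 142, 128, 138, 133, 115, 49, 76, 13, 57, 28, 12, 105, 74, 47, 128, 98, 123, 98, 120, 112,
   132, 142, 123, 120, 55, 87, 100, 85, 87, 27, 5, 26, 9, 1, 115, 101, 55, 46, 13, 60, 20, 21, 22,
   42, 13, 79, 30, 69, 55, 9, 76, 106, 80, 47, 111, 74, 16, 39, 26, 9, 76, 106, 21, 19, 8, 30, 10,
   55, 69, 85, 92, 34, 26, 4, 59, 76, 49, 75, 120, 136, 123, 4, 26, 8, 0, 58, 64, 105, 120, 136,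
   128, 16, 74, 105, 120, 136, 123, 2, 13, 76, 49, 26, 8, 80, 105, 120, 136, 123, 101, 55, 115,
   85, 69, 100, 133, 115, 115, 120, 136, 123, 55, 85, 69, 114, 132, 123, 120, 112, 141, 39, 70,
   99, 16, 113, 128, 105, 80, 16, 4, 26, 92, 59, 0, 36, 13, 2, 36, 83, 23, 14, 37, 51, 100, 85,
   114, 38, 68, 15, 53, 50, 36, 26, 4, 8, 53, 16, 70, 36, 26, 4, 8, 50, 83, 88, 94, 113, 99, 70,
   70, 99, 111, 113, 130, 105, 80, 51, 23, 125, 84, 7, 31, 102, 89, 32, 14, 116, 45, 134, 95, 89,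
   84, 69, 100, 36, 14, 37, 77, 130, 108, 51, 77, 102, 4, 26, 74, 5, 92, 34, 100, 69, 38, 68, 15,
   85, 114, 34, 26, 8, 80, 105, 120, 136, 123, 21, 81, 43, 48, 92, 26, 27, 8, 59, 120, 136, 123,
   98, 65, 34, 59, 81, 76, 60, 13, 66, 96, 118, 60, 59, 81, 91, 58, 119, 17, 26, 47, 74, 13, 76,
   75, 106, 66, 96, 118, 60, 66, 96, 118, 135, 82, 142, 69, 71, 100, 132, 81, 106, 123, 122, 123,
   87, 55, 69, 127, 100, 143, 132, 140, 127, 82, 123, 97, 87, 118, 55, 13, 60, 112, 82, 55, 13,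
   76, 106, 55, 71, 87, 60, 2, 57, 32, 10, 66, 96, 65, 13, 34, 136, 135, 122, 123, 137, 119, 97,
   64, 123, 122, 97, 64, 128, 140, 129, 138, 105, 140, 139, 125, 105, 74, 59, 92, 13, 2, 123, 122,
   135, 136, 137, 97, 119, 91, 136, 135, 119, 91, 70, 140, 71, 101, 99, 39, 101, 100, 16, 39, 136,
   123, 87, 133, 55, 38, 68, 82, 112, 111, 127, 84, 65, 101, 124, 71, 123, 121, 94, 64, 33, 58,
   16, 50, 61, 62, 31, 89, 117, 65, 34, 64, 116, 140, 58, 139, 143, 37, 125, 67, 99, 3, 14, 68,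
   38, 117, 140, 143, 113, 99, 89, 56, 90, 90, 57, 38, 68, 37, 93, 120, 123, 112, 87, 55, 136, 81,
   49, 75, 21, 48, 91, 58, 42, 33, 73, 104, 72, 125, 138, 128, 128, 105, 91, 138, 124, 140, 132,
   71, 137, 121, 97, 65, 92, 68, 139, 110, 38, 37, 15, 124, 71, 55, 71, 101, 71, 49, 120, 93, 66,
   81, 22, 82, 48, 132, 140, 86, 39, 26, 17, 21, 91, 58, 119, 44, 120, 93, 66, 48, 26, 8, 59, 34,
   106, 22, 129, 132, 82, 44, 76, 9, 1, 132, 140, 143, 82, 119, 134, 121, 130, 111, 128, 111, 128,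
   133, 100, 124, 52, 24, 26, 51, 114, 113, 99, 70, 50, 51, 23, 52, 62, 119, 121, 31, 42, 20, 56,
   42, 20, 99, 70, 36, 37, 14, 13, 65, 12, 7, 52, 15, 0, 8, 78, 42, 20, 20, 45, 79, 82, 110, 73,
   109, 42, 140, 141, 126, 78, 126, 125, 77, 26, 1, 86, 39, 99, 83, 100, 85, 113, 99, 21, 81, 48,
   81, 48, 87, 55, 124, 115, 87, 92, 34, 59, 54, 17, 26, 75, 106, 30, 93, 136, 96, 59, 54, 17, 26,
   75, 106, 43, 17, 54, 136, 93, 137, 97, 64, 33, 86, 54, 26, 48, 106, 43, 119, 140, 143, 121,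
   140, 143, 101, 142, 133, 124, 93, 96, 118, 106, 76, 49, 101, 55, 115, 85, 69, 100, 127, 131,
   133, 115, 115, 55, 113, 86, 70, 38, 68, 37, 15, 68, 37, 15, 55, 54, 17, 26, 106, 76, 43, 59,
   29, 17, 54, 26, 9, 0, 15, 38, 68, 3, 2, 13, 60, 13, 6, 43, 12, 38, 15, 68, 3, 121, 118, 122,
   61, 94, 97, 64, 15, 68, 3, 84, 95, 83, 50, 25, 140, 141, 143, 139, 118, 122, 93, 112, 96, 85,
   55, 112, 129, 93, 136, 118, 96, 112, 111, 55, 69, 85, 141, 143, 139, 118, 122, 93, 110, 112,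
   93, 82, 129, 136, 93, 55, 69, 85, 111, 130, 80, 136, 119, 97, 113, 70, 50, 67, 54, 128, 105,
   59, 92, 54, 17, 26]

theorem neighbours_spec : ∀ w < 144, ∀ i < 7,
    (neighbours.getD w []).getD i 288 < 288 ∧
    stepCode i (pointCodes.getD w 0) =
      pointCodes.getD ((neighbours.getD w []).getD i 288) 0 := by
  decide +kernel

theorem length_neighbours : neighbours.length = 144 := by decide +kernel

theorem exists_lt_stepCode_eq : ∀ w < 144, w = 0 ∨ ∃ i < 7,
    (neighbours.getD w []).getD i 288 < w ∧
    stepCode i (pointCodes.getD ((neighbours.getD w []).getD i 288) 0) =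
      pointCodes.getD w 0 := by
  decide +kernel

theorem conflicts_all : (conflicts.zip pointCodes).all
    (fun x => bitsSatisfy (closeCodes x.2) pointCodes x.1) = true := by
  decide +kernel

theorem length_pointCodes : pointCodes.length = 288 := by decide +kernel

theorem length_conflicts : conflicts.length = 288 := by decide +kernel

theorem conflicts_spec {x y : ℕ} (hx : x < 288) (hxy : (conflicts.getD x 0).testBit y = true) :
    closeCodes (pointCodes.getD x 0) (pointCodes.getD y 0) = true := by
  have hx₁ : x < conflicts.length := hx.trans_eq length_conflicts.symm
  have hx₂ : x < pointCodes.length := hx.trans_eq length_pointCodes.symm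
  rw [List.getD_eq_getElem _ _ hx₁] at hxy
  rw [List.getD_eq_getElem _ _ hx₂]
  exact bitsSatisfy_testBit
    (List.all_eq_true.1 conflicts_all _ (mk_getElem_mem_zip _ _ hx₁ hx₂)) hxy

theorem refute_isSome : (refute neighbours conflicts 25 0 branchPoints).isSome = true := by
  decide +kernel

theorem exists_code_eq (w : ℕ) (hw : w < 144) : ∃ p, code p = pointCodes.getD w 0 := by
  induction w using Nat.strong_induction_on with
  | _ w ih =>
    rcases exists_lt_stepCode_eq w hw with rfl | ⟨i, hi, hlt, h⟩
    · exact ⟨1, by decide +kernel⟩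
    · obtain ⟨p, hp⟩ := ih _ hlt (hlt.trans hw)
      exact ⟨gen ⟨i, hi⟩ * p, by rw [code_gen_mul, hp, h]⟩

theorem eq_of_gen_mul_gen_mul_mem {C : Finset (Perm (Fin 7))}
    (hC : ∀ σ ∈ C, ∀ π ∈ C, σ ≠ π → 3 ≤ kendallDist σ π)
    {p : Perm (Fin 7)} {i j : Fin 7} (hp : p ∈ C)
    (hq : gen i * (gen j * p) ∈ C) : gen i * (gen j * p) = p := by
  by_contra h
  have := hC _ hq _ hp h
  have := kendallDist_gen_mul_gen_mul_le i j p
  omega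

theorem exists_uncovered {C : Finset (Perm (Fin 7))}
    (hC : ∀ σ ∈ C, ∀ π ∈ C, σ ≠ π → 3 ≤ kendallDist σ π)
    (g : Perm (Fin 7)) :
    ∃ w < 144, ∃ p, code p = pointCodes.getD w 0 ∧ ∀ i, gen i * (p * g) ∉ C := by
  by_contra! hcov
  let S : ℕ → Prop := fun x => x < 288 ∧ ∃ p, p * g ∈ C ∧ code p = pointCodes.getD x 0
  have hrows : ∀ row ∈ neighbours, ∃ x ∈ row, S x := by
    intro row hrow
    obtain ⟨w, hw, hrow⟩ := List.getElem_of_mem hrow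
    have hw' : w < 144 := hw.trans_eq length_neighbours
    obtain ⟨p, hp⟩ := exists_code_eq w hw'
    obtain ⟨i, hi⟩ := hcov w hw' p hp
    have hspec := neighbours_spec w hw' i i.isLt
    rw [show neighbours.getD w [] = row by rw [List.getD_eq_getElem _ _ hw, hrow]] at hspec
    have hlen : i.val < row.length := by
      by_contra h
      rw [List.getD_eq_default _ _ (not_lt.1 h)] at hspec
      exact lt_irrefl _ hspec.1
    rw [List.getD_eq_getElem _ _ hlen] at hspec
    exact ⟨row[i], List.getElem_mem hlen, hspec.1, gen i * p, by rwa [mul_assoc],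
      by rw [code_gen_mul, hp]; exact hspec.2⟩
  have hconf : ∀ x y, S x → (conflicts.getD x 0).testBit y = true → ¬ S y := by
    rintro x y ⟨hx, p, hpC, hp⟩ hxy ⟨_, q, hqC, hq⟩
    have hclose := conflicts_spec hx hxy
    simp only [closeCodes, Bool.and_eq_true, bne_iff_ne, List.any_eq_true, List.mem_range,
      beq_iff_eq] at hclose
    obtain ⟨hne, i, hi, j, hj, h⟩ := hclose
    have hpq : gen ⟨i, hi⟩ * p = gen ⟨j, hj⟩ * q :=
      code_injective (by rw [code_gen_mul, code_gen_mul, hp, hq, h])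
    have hqp : gen ⟨j, hj⟩ * (gen ⟨i, hi⟩ * (p * g)) = q * g := by
      rw [← mul_assoc (gen ⟨i, hi⟩), hpq, mul_assoc, ← mul_assoc, gen_mul_self, one_mul]
    have := eq_of_gen_mul_gen_mul_mem hC hpC (hqp ▸ hqC)
    rw [hqp] at this
    exact hne (by rw [← hp, ← hq, mul_right_cancel this])
  have hnone := refute_eq_none hrows hconf 25 0 branchPoints (by simp)
  have hsome := refute_isSome
  rw [hnone] at hsome
  exact absurd hsome (by simp)

theorem card_le_715 {C : Finset (Perm (Fin 7))}
    (hC : ∀ σ ∈ C, ∀ π ∈ C, σ ≠ π → 3 ≤ kendallDist σ π) : C.card ≤ 715 := by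
  classical
  let B : Finset (Perm (Fin 7)) := (C ×ˢ Finset.univ).image fun x : _ × Fin 7 => gen x.2 * x.1
  have hB : B.card = C.card * 7 := by
    rw [Finset.card_image_of_injOn, Finset.card_product, Finset.card_univ, Fintype.card_fin]
    rintro ⟨c, i⟩ hc ⟨d, j⟩ hd (h : gen i * c = gen j * d)
    have hc : c ∈ C := by simpa using hc
    have hd : d ∈ C := by simpa using hd
    have hdc : gen j * (gen i * c) = d := by rw [h, ← mul_assoc, gen_mul_self, one_mul]
    have hcd : d = c := by
      rw [← hdc]
      exact eq_of_gen_mul_gen_mul_mem hC hc (hdc ▸ hd)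
    subst hcd
    rw [gen_injective (mul_right_cancel h)]
  choose w hw p hcode hp using exists_uncovered hC
  have hmem : ∀ g, p g * g ∈ Bᶜ := by
    intro g
    rw [Finset.mem_compl, Finset.mem_image]
    rintro ⟨⟨c, i⟩, hc, h : gen i * c = p g * g⟩
    refine hp g i ?_
    rw [← h, ← mul_assoc, gen_mul_self, one_mul]
    exact (Finset.mem_product.1 hc).1
  have hcard : (Finset.univ : Finset (Perm (Fin 7))).card ≤ (Finset.range 144 ×ˢ Bᶜ).card := by
    refine Finset.card_le_card_of_injOn (fun g => (w g, p g * g))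
      (fun g _ => Finset.mem_product.2 ⟨Finset.mem_range.2 (hw g), hmem g⟩) ?_
    intro g _ g' _ h
    obtain ⟨hww, hpp⟩ := Prod.mk.inj h
    have : p g = p g' := code_injective (by rw [hcode, hcode, hww])
    rw [this] at hpp
    exact mul_left_cancel hpp
  rw [Finset.card_product, Finset.card_compl, hB, Finset.card_univ, Finset.card_range,
    Fintype.card_perm, Fintype.card_fin, show Nat.factorial 7 = 5040 from rfl] at hcard
  omega

end KendallCode

theorem P_7_3_le_716
    (C : Finset (Equiv.Perm (Fin 7)))
    (hC : ∀ σ ∈ C, ∀ π ∈ C, σ ≠ π → 3 ≤ kendallDist σ π) :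
    C.card ≤ 716 :=
  (KendallCode.card_le_715 hC).trans (by norm_num)
end

section
/- Every subset C ⊆ S_11 such that d_K(σ,π) ≥ 3 for all distinct σ,π ∈ C satisfies |C| ≤ 10! − 10. -/
open Finset

/-- The permutations of distance at most one from the identity: the identity and the
adjacent transpositions of `Fin 11`. -/
def ballElt : Option (Fin 10) → Equiv.Perm (Fin 11)
  | none => 1
  | some i => Equiv.swap i.castSucc i.succ

/-- The action of a ball element on pairs of points. -/
def movePair (t : Option (Fin 10)) (p : Fin 11 × Fin 11) : Fin 11 × Fin 11 :=
  (ballElt t p.1, ballElt t p.2)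

/-- The pair of images of the first two points. -/
def imagePair (σ : Equiv.Perm (Fin 11)) : Fin 11 × Fin 11 := (σ 0, σ 1)

theorem ballElt_involutive (t : Option (Fin 10)) (x : Fin 11) :
    ballElt t (ballElt t x) = x := by
  cases t <;> simp [ballElt]

theorem movePair_involutive (t : Option (Fin 10)) (p : Fin 11 × Fin 11) :
    movePair t (movePair t p) = p := by
  simp [movePair, ballElt_involutive]

theorem ballElt_injective : Function.Injective ballElt := by
  have h : ∀ t u, (∀ x, ballElt t x = ballElt u x) → t = u := by decide
  exact fun t u htu => h t u fun x => by rw [htu]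

theorem imagePair_ballElt_mul (t : Option (Fin 10)) (σ : Equiv.Perm (Fin 11)) :
    imagePair (ballElt t * σ) = movePair t (imagePair σ) := rfl

theorem imagePair_mem_offDiag (σ : Equiv.Perm (Fin 11)) :
    imagePair σ ∈ (univ : Finset (Fin 11)).offDiag := by
  simp [imagePair]

theorem movePair_mem_offDiag (t : Option (Fin 10)) {p : Fin 11 × Fin 11}
    (hp : p ∈ (univ : Finset (Fin 11)).offDiag) :
    movePair t p ∈ (univ : Finset (Fin 11)).offDiag := by
  simpa [movePair] using hp

theorem card_moving_le (p : Fin 11 × Fin 11) :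
    #{t | movePair t p ≠ p} ≤ 4 := by
  have h : ∀ a b : Fin 11, #{t | movePair t (a, b) ≠ (a, b)} ≤ 4 := by decide +kernel
  exact h p.1 p.2

theorem exists_walk_ballElt_mul (t : Option (Fin 10)) (σ : Equiv.Perm (Fin 11)) :
    ∃ w : (kendallGraph 11).Walk σ (ballElt t * σ), w.length ≤ 1 := by
  cases t with
  | none => exact ⟨SimpleGraph.Walk.nil.copy rfl (by simp [ballElt]), by simp⟩
  | some i =>
    have hadj : (kendallGraph 11).Adj σ (ballElt (some i) * σ) := by
      rw [kendallGraph, SimpleGraph.fromRel_adj]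
      refine ⟨fun h => ?_, Or.inr ?_⟩
      · have h1 : ballElt (some i) = 1 := by simpa using h.symm
        exact absurd (@ballElt_injective (some i) none h1) (by simp)
      · refine ⟨i.castSucc, Nat.succ_lt_succ i.isLt, ?_⟩
        rw [mul_inv_cancel_right]
        rfl
    exact ⟨hadj.toWalk, by simp⟩

theorem kendallDist_le_two_of_ballElt_mul_eq {t u : Option (Fin 10)}
    {σ π : Equiv.Perm (Fin 11)} (h : ballElt t * σ = ballElt u * π) :
    kendallDist σ π ≤ 2 := by
  obtain ⟨w, hw⟩ := exists_walk_ballElt_mul t σ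
  obtain ⟨v, hv⟩ := exists_walk_ballElt_mul u π
  have hlen := SimpleGraph.dist_le ((w.copy rfl h).append v.reverse)
  rw [SimpleGraph.Walk.length_append, SimpleGraph.Walk.length_copy,
    SimpleGraph.Walk.length_reverse] at hlen
  unfold kendallDist
  omega

theorem exists_perm_imagePair_eq {p : Fin 11 × Fin 11}
    (hp : p ∈ (univ : Finset (Fin 11)).offDiag) : ∃ π, imagePair π = p := by
  have h : ∀ a b : Fin 11, a ≠ b →
      (Equiv.swap (Equiv.swap 0 a 1) b * Equiv.swap 0 a) 0 = a ∧
      (Equiv.swap (Equiv.swap 0 a 1) b * Equiv.swap 0 a) 1 = b := by decide +kernel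
  obtain ⟨h0, h1⟩ := h p.1 p.2 (by simpa using hp)
  exact ⟨_, Prod.ext h0 h1⟩

theorem card_imagePair_fiber_eq {p q : Fin 11 × Fin 11}
    (hp : p ∈ (univ : Finset (Fin 11)).offDiag) (hq : q ∈ (univ : Finset (Fin 11)).offDiag) :
    #{σ | imagePair σ = p} = #{σ | imagePair σ = q} := by
  obtain ⟨π, rfl⟩ := exists_perm_imagePair_eq hp
  obtain ⟨ρ, rfl⟩ := exists_perm_imagePair_eq hq
  refine Finset.card_equiv (Equiv.mulLeft (ρ * π⁻¹)) fun σ => ?_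
  simp only [mem_filter, mem_univ, true_and, Equiv.coe_mulLeft, imagePair, Prod.mk.injEq,
    Equiv.Perm.mul_apply, EmbeddingLike.apply_eq_iff_eq, Equiv.Perm.inv_eq_iff_eq]

theorem card_eq_sum_card_imagePair_fiber (C : Finset (Equiv.Perm (Fin 11))) :
    #C = ∑ p ∈ (univ : Finset (Fin 11)).offDiag, #{σ ∈ C | imagePair σ = p} :=
  Finset.card_eq_sum_card_fiberwise fun σ _ => imagePair_mem_offDiag σ

theorem card_offDiag_fin_eleven : #(univ : Finset (Fin 11)).offDiag = 110 := by
  rw [Finset.offDiag_card, Finset.card_univ, Fintype.card_fin]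

theorem card_perm_fin_eleven :
    #(univ : Finset (Equiv.Perm (Fin 11))) = 110 * Nat.factorial 9 := by
  rw [Finset.card_univ, Fintype.card_perm, Fintype.card_fin, Nat.factorial_succ,
    Nat.factorial_succ, ← mul_assoc]
  norm_num

theorem card_imagePair_fiber {p : Fin 11 × Fin 11}
    (hp : p ∈ (univ : Finset (Fin 11)).offDiag) :
    #{σ | imagePair σ = p} = Nat.factorial 9 := by
  have htotal := card_eq_sum_card_imagePair_fiber univ
  rw [Finset.sum_congr rfl fun q hq => card_imagePair_fiber_eq hq hp, Finset.sum_const,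
    card_offDiag_fin_eleven, card_perm_fin_eleven, smul_eq_mul] at htotal
  exact (Nat.eq_of_mul_eq_mul_left (by norm_num) htotal).symm

/-- Sphere packing inside the fibres of `imagePair`. -/
theorem sum_card_movePair_fiber_le (C : Finset (Equiv.Perm (Fin 11)))
    (hC : ∀ σ ∈ C, ∀ π ∈ C, σ ≠ π → 3 ≤ kendallDist σ π) {p : Fin 11 × Fin 11}
    (hp : p ∈ (univ : Finset (Fin 11)).offDiag) :
    ∑ t, #{σ ∈ C | imagePair σ = movePair t p} ≤ Nat.factorial 9 := by
  rw [← card_imagePair_fiber hp, ← Finset.card_sigma]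
  refine Finset.card_le_card_of_injOn (fun x => ballElt x.1 * x.2) ?_ ?_
  · rintro ⟨t, σ⟩ hx
    simp only [coe_sigma, Set.mem_sigma_iff, mem_coe, mem_filter, mem_univ, true_and] at hx ⊢
    simp [imagePair_ballElt_mul, hx.2, movePair_involutive]
  · rintro ⟨t, σ⟩ hx ⟨u, π⟩ hy hxy
    simp only [coe_sigma, Set.mem_sigma_iff, mem_coe, mem_filter, mem_univ, true_and] at hx hy
    have hσπ : σ = π := by
      by_contra hne
      have := hC σ hx.1 π hy.1 hne
      have : kendallDist σ π ≤ 2 := kendallDist_le_two_of_ballElt_mul_eq hxy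
      omega
    subst hσπ
    have htu : t = u := ballElt_injective (mul_right_cancel hxy)
    subst htu
    rfl

/-- An integer function on pairs whose ball sums are all at most one has nonpositive sum. -/
theorem sum_nonpos_of_ball_sum_le_one (g : Fin 11 × Fin 11 → ℤ)
    (hg : ∀ p ∈ (univ : Finset (Fin 11)).offDiag, ∑ t, g (movePair t p) ≤ 1) :
    ∑ p ∈ (univ : Finset (Fin 11)).offDiag, g p ≤ 0 := by
  set X := (univ : Finset (Fin 11)).offDiag with hX
  have hlocal : ∀ p ∈ X, 6 * max (g p) 0 +
      ∑ t, (if movePair t p ≠ p then min (g (movePair t p)) 0 else 0) ≤ 0 := by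
    intro p hp
    rcases le_or_gt (g p) 0 with h | h
    · rw [max_eq_right h]
      have : ∑ t, (if movePair t p ≠ p then min (g (movePair t p)) 0 else 0) ≤ 0 :=
        Finset.sum_nonpos fun t _ => by split_ifs <;> simp
      omega
    · have hsum : ∑ t, ((if movePair t p ≠ p then min (g (movePair t p)) 0 else 0) + g p -
          (if movePair t p ≠ p then g p else 0)) ≤ ∑ t, g (movePair t p) := by
        refine Finset.sum_le_sum fun t _ => ?_
        split_ifs with ht
        · simp
        · rw [not_not.1 ht]; simp
      rw [Finset.sum_sub_distrib, Finset.sum_add_distrib, ← Finset.sum_filter (fun t => movePair t p ≠ p) (fun _ => g p),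
        Finset.sum_const, Finset.sum_const] at hsum
      have hcard : ((#{t | movePair t p ≠ p} : ℕ) : ℤ) ≤ 4 := by
        exact_mod_cast card_moving_le p
      have hball := hg p hp
      simp only [Finset.card_univ, Fintype.card_option, Fintype.card_fin, nsmul_eq_mul] at hsum
      push_cast at hsum
      rw [max_eq_left h.le]
      nlinarith
  have hswap : ∑ p ∈ X, ∑ t, (if movePair t p ≠ p then min (g (movePair t p)) 0 else 0) =
      ∑ p ∈ X, ∑ t, (if movePair t p ≠ p then min (g p) 0 else 0) := by
    rw [Finset.sum_comm, Finset.sum_comm (s := X)]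
    refine Finset.sum_congr rfl fun t _ => ?_
    refine Finset.sum_nbij' (movePair t) (movePair t) (fun p hp => movePair_mem_offDiag t hp)
      (fun p hp => movePair_mem_offDiag t hp) (fun p _ => movePair_involutive t p)
      (fun p _ => movePair_involutive t p) fun p _ => ?_
    simp only [movePair_involutive, ne_comm]
  have hneg : ∑ p ∈ X, 4 * min (g p) 0 ≤
      ∑ p ∈ X, ∑ t, (if movePair t p ≠ p then min (g p) 0 else 0) := by
    refine Finset.sum_le_sum fun p _ => ?_
    rw [← Finset.sum_filter, Finset.sum_const, nsmul_eq_mul]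
    have hcard : ((#{t | movePair t p ≠ p} : ℕ) : ℤ) ≤ 4 := by
      exact_mod_cast card_moving_le p
    exact mul_le_mul_of_nonpos_right hcard (min_le_right _ _)
  have htotal := Finset.sum_nonpos hlocal
  rw [Finset.sum_add_distrib, hswap, ← Finset.mul_sum] at htotal
  rw [← Finset.mul_sum] at hneg
  have hpos : 0 ≤ ∑ p ∈ X, max (g p) 0 := Finset.sum_nonneg fun p _ => le_max_right _ _
  have hsplit : ∑ p ∈ X, g p = ∑ p ∈ X, max (g p) 0 + ∑ p ∈ X, min (g p) 0 := by
    rw [← Finset.sum_add_distrib]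
    exact Finset.sum_congr rfl fun p _ => by rw [max_add_min, add_zero]
  linarith

theorem P_11_3_upper_bound
    (C : Finset (Equiv.Perm (Fin 11)))
    (hC : ∀ σ ∈ C, ∀ π ∈ C, σ ≠ π → 3 ≤ kendallDist σ π) :
    C.card ≤ Nat.factorial 10 - 10 := by
  have hcard := card_eq_sum_card_imagePair_fiber C
  have hdev := sum_nonpos_of_ball_sum_le_one
    (fun p => (#{σ ∈ C | imagePair σ = p} : ℤ) - 32989) fun p hp => by
      have hball : (∑ t, #{σ ∈ C | imagePair σ = movePair t p} : ℤ) ≤ Nat.factorial 9 := by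
        exact_mod_cast sum_card_movePair_fiber_le C hC hp
      rw [Finset.sum_sub_distrib, Finset.sum_const]
      simp only [Finset.card_univ, Fintype.card_option, Fintype.card_fin, nsmul_eq_mul]
      norm_num [Nat.factorial] at hball ⊢
      linarith
  rw [Finset.sum_sub_distrib, Finset.sum_const, Finset.offDiag_card] at hdev
  simp only [Finset.card_univ, Fintype.card_fin, nsmul_eq_mul] at hdev
  norm_num at hdev
  rw [← Nat.cast_sum, ← hcard] at hdev
  norm_num [Nat.factorial]
  omega
end

section
/- Every subset C ⊆ S_13 such that d_K(σ,π) ≥ 3 for all distinct σ,π ∈ C satisfies |C| ≤ 12! − 12. -/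
/-- The identity (at `none`) and the adjacent transpositions of `Fin (n + 1)`. -/
def ballElement {n : ℕ} : Option (Fin n) → Equiv.Perm (Fin (n + 1))
  | none => 1
  | some j => Equiv.swap j.castSucc j.succ

theorem ballElement_injective {n : ℕ} :
    Function.Injective (ballElement : Option (Fin n) → Equiv.Perm (Fin (n + 1))) := by
  have h1 : ∀ j : Fin n, ballElement (some j) ≠ 1 := fun j h =>
    j.castSucc_lt_succ.ne (Equiv.swap_eq_one_iff.1 h)
  rintro (_ | i) (_ | j) h
  · rfl
  · exact absurd h.symm (h1 j)
  · exact absurd h (h1 i)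
  · have hi : Equiv.swap j.castSucc j.succ i.castSucc = i.succ := by
      rw [← show Equiv.swap i.castSucc i.succ = Equiv.swap j.castSucc j.succ from h]
      exact Equiv.swap_apply_left _ _
    rw [Equiv.swap_apply_def] at hi
    congr 1
    split_ifs at hi with h2 h3 <;> simp only [Fin.ext_iff, Fin.val_castSucc, Fin.val_succ] at * <;>
      omega

theorem ballElement_mul_self {n : ℕ} (o : Option (Fin n)) :
    ballElement o * ballElement o = 1 := by
  cases o <;> simp [ballElement]

theorem ballElement_apply_self {n : ℕ} (o : Option (Fin n)) (a : Fin (n + 1)) :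
    ballElement o (ballElement o a) = a := by
  rw [← Equiv.Perm.mul_apply, ballElement_mul_self, Equiv.Perm.one_apply]

theorem exists_walk_ballElement_mul {n : ℕ} (o : Option (Fin n)) (σ : Equiv.Perm (Fin (n + 1))) :
    ∃ w : (kendallGraph (n + 1)).Walk (ballElement o * σ) σ, w.length ≤ 1 := by
  cases o with
  | none =>
    rw [show ballElement none * σ = σ from one_mul σ]
    exact ⟨SimpleGraph.Walk.nil, Nat.zero_le 1⟩
  | some j =>
    have hadj : (kendallGraph (n + 1)).Adj (ballElement (some j) * σ) σ := by
      refine (SimpleGraph.fromRel_adj _ _ _).2 ⟨fun h => ?_, Or.inl ?_⟩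
      · have := ballElement_injective (a₁ := some j) (a₂ := none) (mul_eq_right.1 h)
        cases this
      · exact ⟨j.castSucc, by simp, by rw [mul_inv_cancel_right]; rfl⟩
    exact ⟨hadj.toWalk, by simp⟩

theorem kendallDist_le_two_of_ballElement_mul_eq {n : ℕ} {o o' : Option (Fin n)}
    {σ π : Equiv.Perm (Fin (n + 1))} (h : ballElement o * σ = ballElement o' * π) :
    kendallDist σ π ≤ 2 := by
  obtain ⟨w, hw⟩ := exists_walk_ballElement_mul o σ
  obtain ⟨w', hw'⟩ := exists_walk_ballElement_mul o' π
  have := SimpleGraph.dist_le (w.reverse.append (w'.copy h.symm rfl))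
  simp only [SimpleGraph.Walk.length_append, SimpleGraph.Walk.length_reverse,
    SimpleGraph.Walk.length_copy] at this
  unfold kendallDist
  omega

/-- The action of `ballElement o` on ordered pairs. -/
def ballPair {n : ℕ} (o : Option (Fin n)) (p : Fin (n + 1) × Fin (n + 1)) :
    Fin (n + 1) × Fin (n + 1) :=
  (ballElement o p.1, ballElement o p.2)

theorem ballPair_ballPair {n : ℕ} (o : Option (Fin n)) (p : Fin (n + 1) × Fin (n + 1)) :
    ballPair o (ballPair o p) = p := by
  simp [ballPair, ballElement_apply_self]

/-- The pairs of distinct points of `Fin 13`. -/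
abbrev distinctPairs : Finset (Fin 13 × Fin 13) := Finset.univ.offDiag

theorem ballPair_mem_distinctPairs {o : Option (Fin 12)} {p : Fin 13 × Fin 13}
    (hp : p ∈ distinctPairs) : ballPair o p ∈ distinctPairs := by
  simpa [ballPair, Finset.mem_offDiag] using hp

/-- The members of `C` sending `(0, 1)` to `p`. -/
def pairFiber (C : Finset (Equiv.Perm (Fin 13))) (p : Fin 13 × Fin 13) :
    Finset (Equiv.Perm (Fin 13)) :=
  C.filter fun σ => (σ 0, σ 1) = p

theorem mem_pairFiber {C : Finset (Equiv.Perm (Fin 13))} {p : Fin 13 × Fin 13}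
    {σ : Equiv.Perm (Fin 13)} : σ ∈ pairFiber C p ↔ σ ∈ C ∧ (σ 0, σ 1) = p :=
  Finset.mem_filter

theorem sum_card_pairFiber (C : Finset (Equiv.Perm (Fin 13))) :
    ∑ p ∈ distinctPairs, (pairFiber C p).card = C.card :=
  (Finset.card_eq_sum_card_fiberwise fun σ _ => by simp).symm

theorem card_pairFiber_univ_le {p q : Fin 13 × Fin 13}
    (hp : p ∈ distinctPairs) (hq : q ∈ distinctPairs) :
    (pairFiber Finset.univ p).card ≤ (pairFiber Finset.univ q).card := by
  have hp' : p.1 ≠ p.2 := by simpa using hp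
  have hq' : q.1 ≠ q.2 := by simpa using hq
  obtain ⟨g, hg1, hg2⟩ : ∃ g : Equiv.Perm (Fin 13), g p.1 = q.1 ∧ g p.2 = q.2 := by
    refine ⟨Equiv.swap (Equiv.swap p.1 q.1 p.2) q.2 * Equiv.swap p.1 q.1, ?_, ?_⟩
    · rw [Equiv.Perm.mul_apply, Equiv.swap_apply_left]
      refine Equiv.swap_apply_of_ne_of_ne (fun h => hp' ?_) hq'
      apply (Equiv.swap p.1 q.1).injective
      exact (Equiv.swap_apply_left _ _).trans h
    · rw [Equiv.Perm.mul_apply, Equiv.swap_apply_left]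
  refine Finset.card_le_card_of_injOn (fun σ => g * σ) (fun σ hσ => ?_)
    (fun σ _ τ _ h => mul_left_cancel h)
  obtain ⟨-, rfl⟩ := mem_pairFiber.1 hσ
  exact mem_pairFiber.2 ⟨Finset.mem_univ _, Prod.ext hg1 hg2⟩

theorem card_pairFiber_univ {p : Fin 13 × Fin 13} (hp : p ∈ distinctPairs) :
    (pairFiber Finset.univ p).card = Nat.factorial 11 := by
  have h := sum_card_pairFiber Finset.univ
  rw [Finset.sum_congr rfl fun q hq =>
      (card_pairFiber_univ_le hq hp).antisymm (card_pairFiber_univ_le hp hq),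
    Finset.sum_const, Finset.offDiag_card, Finset.card_univ, Finset.card_univ, Fintype.card_perm,
    Fintype.card_fin, smul_eq_mul] at h
  simp only [Nat.factorial] at h ⊢
  omega

theorem sum_card_pairFiber_ballPair_le {C : Finset (Equiv.Perm (Fin 13))}
    (hC : ∀ σ ∈ C, ∀ π ∈ C, σ ≠ π → 3 ≤ kendallDist σ π)
    {p : Fin 13 × Fin 13} (hp : p ∈ distinctPairs) :
    ∑ o : Option (Fin 12), (pairFiber C (ballPair o p)).card ≤ Nat.factorial 11 := by
  rw [← card_pairFiber_univ hp, ← Finset.card_sigma]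
  refine Finset.card_le_card_of_injOn (fun x => ballElement x.1 * x.2) ?_ ?_
  · rintro ⟨o, σ⟩ hx
    have hσ := (mem_pairFiber.1 (Finset.mem_sigma.1 hx).2).2
    refine mem_pairFiber.2 ⟨Finset.mem_univ _, ?_⟩
    rw [← ballPair_ballPair o p, ← hσ]
    rfl
  · rintro ⟨o, σ⟩ hx ⟨o', π⟩ hy h
    have hσ := (mem_pairFiber.1 (Finset.mem_sigma.1 hx).2).1
    have hπ := (mem_pairFiber.1 (Finset.mem_sigma.1 hy).2).1
    have h' : ballElement o * σ = ballElement o' * π := h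
    obtain rfl : σ = π := by
      by_contra hne
      have := hC σ hσ π hπ hne
      have := kendallDist_le_two_of_ballElement_mul_eq h'
      omega
    rw [ballElement_injective (mul_right_cancel h')]

theorem card_ballPair_ne_le (p : Fin 13 × Fin 13) :
    (Finset.univ.filter fun o : Option (Fin 12) => ballPair o p ≠ p).card ≤ 4 := by
  revert p
  decide +kernel

/-- An integer weight on pairs whose sum over each ball is at least `-1` has nonnegative total. -/
theorem sum_nonneg_of_ball_sum_ge (v : Fin 13 × Fin 13 → ℤ)
    (hv : ∀ p ∈ distinctPairs, -1 ≤ ∑ o : Option (Fin 12), v (ballPair o p)) :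
    0 ≤ ∑ p ∈ distinctPairs, v p := by
  have hlocal : ∀ p ∈ distinctPairs, 8 * (v p)⁻ ≤
      ∑ o : Option (Fin 12), if ballPair o p ≠ p then (v (ballPair o p))⁺ else 0 := by
    intro p hp
    rcases le_or_gt 0 (v p) with h0 | h0
    · rw [negPart_eq_zero.2 h0]
      exact Finset.sum_nonneg fun o _ => by split_ifs <;> simp [posPart_nonneg]
    · have h1 := hv p hp
      rw [← Finset.sum_filter_add_sum_filter_not Finset.univ fun o => ballPair o p ≠ p] at h1
      rw [← Finset.sum_filter]
      have h2 : ∑ o : Option (Fin 12) with ballPair o p ≠ p, v (ballPair o p) ≤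
          ∑ o : Option (Fin 12) with ballPair o p ≠ p, (v (ballPair o p))⁺ :=
        Finset.sum_le_sum fun o _ => le_posPart _
      have h3 : ∑ o : Option (Fin 12) with ¬ ballPair o p ≠ p, v (ballPair o p) =
          (Finset.univ.filter fun o : Option (Fin 12) => ¬ ballPair o p ≠ p).card * v p := by
        rw [← nsmul_eq_mul, ← Finset.sum_const]
        refine Finset.sum_congr rfl fun o ho => ?_
        rw [not_not.1 (Finset.mem_filter.1 ho).2]
      have h4 := Finset.card_filter_add_card_filter_not (s := Finset.univ)
        (fun o : Option (Fin 12) => ballPair o p ≠ p)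
      have h5 := card_ballPair_ne_le p
      rw [Finset.card_univ, Fintype.card_option, Fintype.card_fin] at h4
      have h6 : (9 : ℤ) ≤ (Finset.univ.filter fun o : Option (Fin 12) =>
          ¬ ballPair o p ≠ p).card := by omega
      rw [negPart_of_nonpos h0.le]
      nlinarith
  have hswap : ∀ o : Option (Fin 12),
      (∑ p ∈ distinctPairs, if ballPair o p ≠ p then (v (ballPair o p))⁺ else 0) =
        ∑ p ∈ distinctPairs, if ballPair o p ≠ p then (v p)⁺ else 0 := by
    intro o
    refine Finset.sum_nbij' (ballPair o) (ballPair o) (fun p => ballPair_mem_distinctPairs)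
      (fun p => ballPair_mem_distinctPairs) (fun p _ => ballPair_ballPair o p)
      (fun p _ => ballPair_ballPair o p) fun p _ => ?_
    rw [ballPair_ballPair]
    simp only [ne_comm]
  have hglobal : ∑ p ∈ distinctPairs, 8 * (v p)⁻ ≤ ∑ p ∈ distinctPairs, 4 * (v p)⁺ := by
    refine (Finset.sum_le_sum hlocal).trans ?_
    rw [Finset.sum_comm, Finset.sum_congr rfl fun o _ => hswap o, Finset.sum_comm]
    refine Finset.sum_le_sum fun p _ => ?_
    rw [← Finset.sum_filter, Finset.sum_const, nsmul_eq_mul]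
    exact mul_le_mul_of_nonneg_right (by exact_mod_cast card_ballPair_ne_le p) (posPart_nonneg _)
  have hneg : 0 ≤ ∑ p ∈ distinctPairs, (v p)⁻ := Finset.sum_nonneg fun p _ => negPart_nonneg _
  rw [← Finset.mul_sum, ← Finset.mul_sum] at hglobal
  rw [← Finset.sum_congr rfl fun p _ => posPart_sub_negPart (v p), Finset.sum_sub_distrib]
  linarith

theorem P_13_3_upper_bound
    (C : Finset (Equiv.Perm (Fin 13)))
    (hC : ∀ σ ∈ C, ∀ π ∈ C, σ ≠ π → 3 ≤ kendallDist σ π) :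
    C.card ≤ Nat.factorial 12 - 12 := by
  have hk : Nat.factorial 11 = 13 * 3070523 + 1 := by decide
  have h := sum_nonneg_of_ball_sum_ge (fun p => 3070523 - ((pairFiber C p).card : ℤ)) fun p hp => by
    have := sum_card_pairFiber_ballPair_le hC hp
    rw [Finset.sum_sub_distrib, Finset.sum_const, Finset.card_univ, Fintype.card_option,
      Fintype.card_fin, ← Nat.cast_sum]
    simp only [nsmul_eq_mul]
    omega
  rw [Finset.sum_sub_distrib, ← Nat.cast_sum, sum_card_pairFiber, Finset.sum_const,
    Finset.offDiag_card, Finset.card_univ, Fintype.card_fin] at h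
  rw [Nat.factorial_succ, hk]
  simp only [nsmul_eq_mul] at h
  omega
end

section
/- Every subset C ⊆ S_17 such that d_K(σ,π) ≥ 3 for all distinct σ,π ∈ C satisfies |C| ≤ 16! − 5. -/
/-- The adjacent transposition `(k, k+1)`, or the identity when `k` is the last point. -/
def adjacentSwapOrOne {n : ℕ} (k : Fin n) : Equiv.Perm (Fin n) :=
  if h : k.val + 1 < n then Equiv.swap k ⟨k.val + 1, h⟩ else 1

theorem exists_kendallGraph_walk_adjacentSwapOrOne_mul {n : ℕ} (k : Fin n)
    (σ : Equiv.Perm (Fin n)) :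
    ∃ p : (kendallGraph n).Walk σ (adjacentSwapOrOne k * σ), p.length ≤ 1 := by
  by_cases h : k.val + 1 < n
  · have hadj : (kendallGraph n).Adj σ (adjacentSwapOrOne k * σ) := by
      have hk : adjacentSwapOrOne k = Equiv.swap k ⟨k.val + 1, h⟩ := dif_pos h
      refine (SimpleGraph.fromRel_adj _ _ _).2 ⟨fun he => ?_, Or.inr ?_⟩
      · have h1 : Equiv.swap k ⟨k.val + 1, h⟩ = 1 := by
          rw [← hk]; exact mul_eq_right.1 he.symm
        have := congrArg Fin.val (Equiv.swap_eq_one_iff.1 h1)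
        simp at this
      · rw [mul_inv_cancel_right, hk]
        exact ⟨k, h, rfl⟩
    exact ⟨hadj.toWalk, by simp⟩
  · have hk : adjacentSwapOrOne k = 1 := dif_neg h
    rw [hk, one_mul]
    exact ⟨SimpleGraph.Walk.nil, by simp⟩

theorem kendallDist_le_two_of_adjacentSwapOrOne_mul_eq {n : ℕ} {k l : Fin n}
    {σ π : Equiv.Perm (Fin n)} (h : adjacentSwapOrOne k * σ = adjacentSwapOrOne l * π) :
    kendallDist σ π ≤ 2 := by
  obtain ⟨p, hp⟩ := exists_kendallGraph_walk_adjacentSwapOrOne_mul k σ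
  have hq := exists_kendallGraph_walk_adjacentSwapOrOne_mul l π
  rw [← h] at hq
  obtain ⟨q, hq⟩ := hq
  refine (SimpleGraph.dist_le (p.append q.reverse)).trans ?_
  rw [SimpleGraph.Walk.length_append, SimpleGraph.Walk.length_reverse]
  omega

theorem adjacentSwapOrOne_injective {n : ℕ} :
    Function.Injective (adjacentSwapOrOne : Fin n → Equiv.Perm (Fin n)) := by
  intro k l h
  wlog hkl : k < l generalizing k l
  · rcases lt_trichotomy k l with h1 | h1 | h1
    · exact this h h1
    · exact h1
    · exact (this h.symm h1).symm
  have hk : k.val + 1 < n := by have := l.isLt; have : k.val < l.val := hkl; omega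
  have hkk : adjacentSwapOrOne k k = ⟨k.val + 1, hk⟩ := by simp [adjacentSwapOrOne, hk]
  have hlk : adjacentSwapOrOne l k = k := by
    unfold adjacentSwapOrOne
    split_ifs with hl
    · refine Equiv.swap_apply_of_ne_of_ne hkl.ne fun he => ?_
      have := congrArg Fin.val he
      have : k.val < l.val := hkl
      simp at *
      omega
    · rfl
  rw [h, hlk] at hkk
  have := congrArg Fin.val hkk
  simp at this

theorem card_filter_perm_apply_zero (n : ℕ) (i : Fin (n + 1)) :
    (Finset.univ.filter fun π : Equiv.Perm (Fin (n + 1)) => π 0 = i).card = n.factorial := by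
  have h : (Finset.univ.filter fun π : Equiv.Perm (Fin (n + 1)) => π 0 = i) =
      (Finset.univ : Finset (Equiv.Perm (Fin n))).image
        fun e => Equiv.Perm.decomposeFin.symm (i, e) := by
    ext π
    simp only [Finset.mem_filter, Finset.mem_univ, true_and, Finset.mem_image]
    constructor
    · intro hπ
      obtain ⟨⟨p, e⟩, rfl⟩ := Equiv.Perm.decomposeFin.symm.surjective π
      rw [Equiv.Perm.decomposeFin_symm_apply_zero] at hπ
      exact ⟨e, by rw [hπ]⟩
    · rintro ⟨e, rfl⟩
      exact Equiv.Perm.decomposeFin_symm_apply_zero i e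
  rw [h, Finset.card_image_of_injective, Finset.card_univ, Fintype.card_perm, Fintype.card_fin]
  intro a b hab
  simpa using hab

/-- Sphere packing inside the set of permutations sending `0` to `i`. -/
theorem sum_card_fiber_mul_le_factorial {n : ℕ} (C : Finset (Equiv.Perm (Fin (n + 1))))
    (hC : ∀ σ ∈ C, ∀ π ∈ C, σ ≠ π → 3 ≤ kendallDist σ π) (i : Fin (n + 1)) :
    ∑ j, (C.filter fun σ => σ 0 = j).card *
      (Finset.univ.filter fun k => adjacentSwapOrOne k j = i).card ≤ n.factorial := by
  rw [← card_filter_perm_apply_zero n i]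
  have h : ∑ j, (C.filter fun σ => σ 0 = j).card *
      (Finset.univ.filter fun k => adjacentSwapOrOne k j = i).card =
      (C.sigma fun σ => Finset.univ.filter fun k => adjacentSwapOrOne k (σ 0) = i).card := by
    rw [Finset.card_sigma,
      ← Finset.sum_fiberwise C (fun σ => σ 0)]
    refine Finset.sum_congr rfl fun j _ => ?_
    rw [← smul_eq_mul, ← Finset.sum_const]
    refine Finset.sum_congr rfl fun σ hσ => ?_
    rw [(Finset.mem_filter.1 hσ).2]
  rw [h]
  refine Finset.card_le_card_of_injOn (fun x => adjacentSwapOrOne x.2 * x.1) ?_ ?_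
  · rintro ⟨σ, k⟩ hx
    simpa using (Finset.mem_sigma.1 hx).2
  · rintro ⟨σ, k⟩ hx ⟨π, l⟩ hy hxy
    have hxy' : adjacentSwapOrOne k * σ = adjacentSwapOrOne l * π := hxy
    have hσπ : σ = π := by
      by_contra hne
      have h3 := hC σ (Finset.mem_sigma.1 hx).1 π (Finset.mem_sigma.1 hy).1 hne
      have h2 := kendallDist_le_two_of_adjacentSwapOrOne_mul_eq hxy'
      omega
    subst hσπ
    rw [adjacentSwapOrOne_injective (mul_right_cancel hxy')]

/-- The entries of the tridiagonal matrix counting steps of `adjacentSwapOrOne` on 17 points. -/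
theorem card_filter_adjacentSwapOrOne_apply (i j : Fin 17) :
    (Finset.univ.filter fun k => adjacentSwapOrOne k j = i).card =
      if i.val = j.val then (if j.val = 0 ∨ j.val = 16 then 16 else 15)
      else if i.val + 1 = j.val ∨ j.val + 1 = i.val then 1 else 0 := by
  revert i j
  decide +kernel

/-- An integer vector on the path with 17 vertices whose image under `17 - L`, with `L` the path
Laplacian, is everywhere positive has sum at least the domination number `6`. -/
theorem six_le_sum_of_path_pos (z : ℕ → ℤ) (h0 : 1 ≤ 16 * z 0 + z 1)
    (h : ∀ i < 15, 1 ≤ z i + 15 * z (i + 1) + z (i + 2)) (h16 : 1 ≤ z 15 + 16 * z 16) :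
    6 ≤ ∑ i ∈ Finset.range 17, z i := by
  by_cases hz : ∀ i < 17, 0 ≤ z i
  · simp only [Finset.sum_range_succ, Finset.sum_range_zero]
    have a0 : 1 ≤ z 0 + z 1 := by
      have := hz 0 (by simp); have := hz 1 (by simp); omega
    have a (i : ℕ) (hi : i < 15) : 1 ≤ z i + z (i + 1) + z (i + 2) := by
      have := h i hi
      have := hz i (by omega); have := hz (i + 1) (by omega); have := hz (i + 2) (by omega)
      omega
    have := a 2 (by simp); have := a 5 (by simp); have := a 8 (by simp)
    have := a 11 (by simp); have := a 14 (by simp)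
    simp only [Nat.reduceAdd] at *
    linarith
  · push Not at hz
    obtain ⟨m, hm, hzm⟩ := hz
    have hsub (i : ℕ) : z i = (z i)⁺ - (z i)⁻ := (posPart_sub_negPart (z i)).symm
    have hp (i : ℕ) : 0 ≤ (z i)⁺ := posPart_nonneg _
    have hn (i : ℕ) : 0 ≤ (z i)⁻ := negPart_nonneg _
    have hpn (i : ℕ) : (z i)⁻ = 0 ∨ (z i)⁺ = 0 := by
      rw [posPart_def, negPart_def]; omega
    have b0 : 15 * (z 0)⁻ ≤ (z 1)⁺ := by
      have := hsub 0; have := hsub 1; have := hp 1; have := hn 1; have := hn 0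
      rcases hpn 0 with h' | h' <;> omega
    have b16 : 15 * (z 16)⁻ ≤ (z 15)⁺ := by
      have := hsub 16; have := hsub 15; have := hp 15; have := hn 15; have := hn 16
      rcases hpn 16 with h' | h' <;> omega
    have b (i : ℕ) (hi : i < 15) : 15 * (z (i + 1))⁻ ≤ (z i)⁺ + (z (i + 2))⁺ := by
      have := h i hi
      have := hsub i; have := hsub (i + 1); have := hsub (i + 2)
      have := hp i; have := hp (i + 2); have := hn i; have := hn (i + 2)
      rcases hpn (i + 1) with h' | h' <;> omega
    have hsum : ∑ i ∈ Finset.range 17, z i =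
        ∑ i ∈ Finset.range 17, (z i)⁺ - ∑ i ∈ Finset.range 17, (z i)⁻ := by
      rw [← Finset.sum_sub_distrib]
      exact Finset.sum_congr rfl fun i _ => hsub i
    have hN : 1 ≤ ∑ i ∈ Finset.range 17, (z i)⁻ := by
      refine le_trans ?_ (Finset.single_le_sum (fun i _ => hn i) (Finset.mem_range.2 hm))
      have := hsub m; have := hp m
      omega
    have hNP : 15 * ∑ i ∈ Finset.range 17, (z i)⁻ ≤ 2 * ∑ i ∈ Finset.range 17, (z i)⁺ := by
      have hs := Finset.sum_le_sum fun i hi => b i (Finset.mem_range.1 hi)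
      have := hp 0; have := hp 16
      simp only [Finset.sum_range_succ, Finset.sum_range_zero, Nat.reduceAdd] at hs ⊢
      linarith
    omega

theorem P_17_3_upper_bound
    (C : Finset (Equiv.Perm (Fin 17)))
    (hC : ∀ σ ∈ C, ∀ π ∈ C, σ ≠ π → 3 ≤ kendallDist σ π) :
    C.card ≤ Nat.factorial 16 - 5 := by
  have hcard : C.card = ∑ j, (C.filter fun σ => σ 0 = j).card :=
    Finset.card_eq_sum_card_fiberwise fun σ _ => Finset.mem_univ (σ 0)
  have hT (i : Fin 17) := (Finset.sum_congr rfl fun j _ => congrArg _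
    (card_filter_adjacentSwapOrOne_apply i j).symm).trans_le
      (sum_card_fiber_mul_le_factorial C hC i)
  obtain ⟨x, hx⟩ : ∃ x : ℕ → ℕ, ∀ j : Fin 17, (C.filter fun σ => σ 0 = j).card = x j :=
    ⟨fun j => (C.filter fun σ => σ 0 = Fin.ofNat 17 j).card, fun j => by simp⟩
  have hf : Nat.factorial 16 = 20922789888000 := by norm_num [Nat.factorial]
  simp only [hx, hf] at hT hcard ⊢
  rw [← Finset.sum_range] at hcard
  have hrow (i : ℕ) (hi : i < 17) : ∑ j ∈ Finset.range 17, x j *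
      (if i = j then (if j = 0 ∨ j = 16 then 16 else 15)
        else if i + 1 = j ∨ j + 1 = i then 1 else 0) ≤ 20922789888000 := by
    rw [Finset.sum_range]
    exact hT ⟨i, hi⟩
  have key := six_le_sum_of_path_pos (fun i => 1230752346353 - (x i : ℤ)) ?_ ?_ ?_
  · rw [Finset.sum_sub_distrib, Finset.sum_const, Finset.card_range, ← Nat.cast_sum,
      ← hcard, nsmul_eq_mul] at key
    omega
  · have := hrow 0 (by simp)
    simp [Finset.sum_range_succ] at this
    omega
  · intro i hi
    have := hrow (i + 1) (by omega)
    interval_cases i <;> simp [Finset.sum_range_succ] at this ⊢ <;> omega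
  · have := hrow 16 (by simp)
    simp [Finset.sum_range_succ] at this
    omega
end
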